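/- Let (A, m) be a two-dimensional regular local ring with infinite residue field, M ≠ (0) a finitely generated torsion-free A-module, F = M** of rank r > 0, and suppose tilde(M) = bar(M). Then: (a) R(M) has finite local cohomology and H^p_𝔐(R(M)) = (0) for every p ≠ 1, r+2; (b) [H^1_𝔐(R(M))]_n ≅ bar(M^n)/M^n as A-modules for every n ∈ ℤ; (c) R(M) is a Cohen–Macaulay ring if and only if M is integrally closed (bar(M) = M). -/

import Mathlib

set_option maxHeartbeats 1000000
set_option synthInstance.maxHeartbeats 400000

open MvPolynomial IsLocalRing

/-- The embedding of the free module `A^r` onto the degree-one part of the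
polynomial ring `Sym_A(A^r) = A[t_1, ..., t_r]`, sending `f` to `∑ i, f i • X i`. -/
noncomputable abbrev emb (A : Type) [CommRing A] (r : ℕ) :
    (Fin r → A) →ₗ[A] MvPolynomial (Fin r) A :=
  Fintype.linearCombination A MvPolynomial.X

/-- The image `F₁` of the free module `F = A^r` inside `S = Sym_A(F)`. -/
noncomputable def freeSub (A : Type) [CommRing A] (r : ℕ) :
    Submodule A (MvPolynomial (Fin r) A) :=
  Submodule.map (emb A r) ⊤

/-- The image `M₁` of a submodule `M ⊆ F` inside `S = Sym_A(F)`. -/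
noncomputable def sub1 (A : Type) [CommRing A] (r : ℕ) (M : Submodule A (Fin r → A)) :
    Submodule A (MvPolynomial (Fin r) A) :=
  M.map (emb A r)

/-- The Rees algebra `R(M)` of `M ⊆ F`, i.e. the `A`-subalgebra of `S = Sym_A(F)`
generated by the degree-one part `M₁`; its `n`-th homogeneous component is `M₁ ^ n`. -/
noncomputable abbrev reesAlg (A : Type) [CommRing A] (r : ℕ) (M : Submodule A (Fin r → A)) :
    Subalgebra A (MvPolynomial (Fin r) A) :=
  Algebra.adjoin A (sub1 A r M : Set (MvPolynomial (Fin r) A))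

/-- The Ratliff--Rush closure `⋃_{ℓ > 0} [N^{ℓ+1} :_{Fn} N^ℓ]` of `N` (inside `Fn`),
where all powers and quotients of submodules are taken inside `S = Sym_A(F)`. -/
noncomputable def ratliffRush (A : Type) [CommRing A] (r : ℕ)
    (Fn N : Submodule A (MvPolynomial (Fin r) A)) : Submodule A (MvPolynomial (Fin r) A) :=
  ⨆ ℓ : ℕ, (Fn ⊓ (N ^ (ℓ + 2) / N ^ (ℓ + 1)))

/-- The positive part `R₊ = ker(constant term)` of a graded subalgebra `R₀ ⊆ S`. -/
noncomputable def posPart (A : Type) [CommRing A] (r : ℕ)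
    (R0 : Subalgebra A (MvPolynomial (Fin r) A)) : Ideal ↥R0 :=
  RingHom.ker ((MvPolynomial.constantCoeff).comp R0.val.toRingHom)

/-- `widetilde{R₀} = ε⁻¹(H⁰_{R₀₊}(S/R₀))`, i.e., the set of `x ∈ S` annihilated into `R₀`
by a power of the irrelevant ideal `R₀₊`; a graded subring of `S` containing `R₀`. -/
noncomputable def rrAlg (A : Type) [CommRing A] (r : ℕ)
    (R0 : Subalgebra A (MvPolynomial (Fin r) A)) : Subalgebra A (MvPolynomial (Fin r) A) where
  carrier := {x | ∃ m : ℕ, ∀ y ∈ (posPart A r R0) ^ m,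
    (y : MvPolynomial (Fin r) A) * x ∈ R0}
  mul_mem' := by
    rintro x₁ x₂ ⟨m₁, h₁⟩ ⟨m₂, h₂⟩
    refine ⟨m₁ + m₂, fun y hy => ?_⟩
    rw [pow_add] at hy
    refine Submodule.mul_induction_on hy (fun p hp q hq => ?_) (fun a b ha hb => ?_)
    · have : ((p * q : ↥R0) : MvPolynomial (Fin r) A) * (x₁ * x₂)
          = ((p : MvPolynomial (Fin r) A) * x₁) * ((q : MvPolynomial (Fin r) A) * x₂) := by
        push_cast; ring
      rw [this]
      exact mul_mem (h₁ p hp) (h₂ q hq)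
    · have : ((a + b : ↥R0) : MvPolynomial (Fin r) A) * (x₁ * x₂)
          = (a : MvPolynomial (Fin r) A) * (x₁ * x₂)
            + (b : MvPolynomial (Fin r) A) * (x₁ * x₂) := by
        push_cast; ring
      rw [this]
      exact add_mem ha hb
  one_mem' := ⟨0, fun y _ => by rw [mul_one]; exact y.2⟩
  add_mem' := by
    rintro x₁ x₂ ⟨m₁, h₁⟩ ⟨m₂, h₂⟩
    refine ⟨m₁ + m₂, fun y hy => ?_⟩
    rw [mul_add]
    exact add_mem (h₁ y (Ideal.pow_le_pow_right (Nat.le_add_right _ _) hy))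
      (h₂ y (Ideal.pow_le_pow_right (Nat.le_add_left _ _) hy))
  zero_mem' := ⟨0, fun y _ => by simpa using R0.zero_mem⟩
  algebraMap_mem' := fun a =>
    ⟨0, fun y _ => mul_mem y.2 (R0.algebraMap_mem a)⟩

/-- The integral closure of the Rees algebra `R(M)` inside `S = Sym_A(F)`,
viewed as an `A`-subalgebra of `S`. -/
noncomputable def intClAlg (A : Type) [CommRing A] (r : ℕ) (M : Submodule A (Fin r → A)) :
    Subalgebra A (MvPolynomial (Fin r) A) :=
  (integralClosure (↥(reesAlg A r M)) (MvPolynomial (Fin r) A)).restrictScalars A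

/-- The integral closure `overline{M^n}`: the `n`-th homogeneous component of the
integral closure of `R(M)` in `S`. -/
noncomputable def barPow (A : Type) [CommRing A] (r : ℕ) (M : Submodule A (Fin r → A))
    (n : ℕ) : Submodule A (MvPolynomial (Fin r) A) :=
  (freeSub A r) ^ n ⊓ (Subalgebra.toSubmodule (intClAlg A r M))

/-- `M` is a faithful `A`-module. -/
def faithfulSub (A : Type) [CommRing A] (r : ℕ) (M : Submodule A (Fin r → A)) : Prop :=
  ∀ a : A, (∀ x ∈ M, a • x = (0 : Fin r → A)) → a = 0

/-- The length of an `A`-module, as the Krull dimension of its lattice of submodules. -/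
noncomputable def modLength (A : Type) [CommRing A] (N : Type) [AddCommGroup N]
    [Module A N] : WithBot ℕ∞ :=
  Order.krullDim (Submodule A N)

/-- The quotient module `P/N` of two submodules of `S`. -/
abbrev quotNP (A : Type) [CommRing A] (r : ℕ)
    (N P : Submodule A (MvPolynomial (Fin r) A)) :=
  ↥P ⧸ (N.comap P.subtype)

/-- The minimal number of generators of a submodule. -/
noncomputable def minGen (A : Type) [CommRing A] {V : Type} [AddCommGroup V] [Module A V]
    (N : Submodule A V) : ℕ :=
  sInf {n : ℕ | ∃ f : Fin n → V, Submodule.span A (Set.range f) = N}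

/-- A Noetherian local ring is Cohen--Macaulay if its depth equals its Krull dimension,
i.e. there is a regular sequence in the maximal ideal whose length is the dimension. -/
def IsCohenMacaulayLocalRing (R : Type) [CommRing R] [IsLocalRing R] : Prop :=
  ∃ rs : List R, (∀ x ∈ rs, x ∈ maximalIdeal R) ∧
    RingTheory.Sequence.IsRegular R rs ∧ (rs.length : WithBot ℕ∞) = ringKrullDim R

/-- A Noetherian local ring is Buchsbaum (in the sense of Stückrad--Vogel) if every
system of parameters `x_1, …, x_d` is a weak sequence:
`(x_1, …, x_{i-1}) : x_i ⊆ (x_1, …, x_{i-1}) : 𝔪` for all `i`. -/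
def IsBuchsbaumLocalRing (R : Type) [CommRing R] [IsLocalRing R] : Prop :=
  ∀ d : ℕ, ringKrullDim R = d →
    ∀ x : Fin d → R, (∀ i, x i ∈ maximalIdeal R) →
      maximalIdeal R ≤ (Ideal.span (Set.range x)).radical →
      ∀ i : Fin d,
        (Ideal.span (x '' {j | j < i})).colon (Ideal.span {x i}) ≤
          (Ideal.span (x '' {j | j < i})).colon (maximalIdeal R)

/-- An ideal `P` of a graded subalgebra `R₀ ⊆ S` is graded (homogeneous) if it contains,
together with any element, all of its homogeneous components. -/
def IsGradedIdeal (A : Type) [CommRing A] (r : ℕ)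
    (R0 : Subalgebra A (MvPolynomial (Fin r) A)) (P : Ideal ↥R0) : Prop :=
  ∀ x : ↥R0, x ∈ P → ∀ n : ℕ,
    ∀ h : MvPolynomial.homogeneousComponent n (x : MvPolynomial (Fin r) A) ∈ R0,
      (⟨_, h⟩ : ↥R0) ∈ P

/-- The graded maximal ideal `𝔐 = 𝔪 R(M) + R(M)₊` of the Rees algebra, i.e. the
preimage of the maximal ideal under the degree-zero projection. -/
noncomputable abbrev gradedMax (A : Type) [CommRing A] [IsLocalRing A] (r : ℕ)
    (M : Submodule A (Fin r → A)) : Ideal ↥(reesAlg A r M) :=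
  Ideal.comap ((MvPolynomial.constantCoeff).comp (reesAlg A r M).val.toRingHom)
    (maximalIdeal A)


/-- The `i`-th local cohomology module `H^i_𝔐(R(M))` of the Rees algebra with respect to
its graded maximal ideal `𝔐 = 𝔪R(M) + R(M)₊`. -/
noncomputable abbrev lcMod (A : Type) [CommRing A] [IsLocalRing A] (r : ℕ)
    (M : Submodule A (Fin r → A)) (i : ℕ) :=
  (localCohomology (gradedMax A r M) i).obj
    (ModuleCat.of ↥(reesAlg A r M) ↥(reesAlg A r M))

/-- `H^i_𝔐(R(M))` viewed as an `A`-module by restriction of scalars along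
`A → R(M)`. -/
noncomputable abbrev lcModA (A : Type) [CommRing A] [IsLocalRing A] (r : ℕ)
    (M : Submodule A (Fin r → A)) (i : ℕ) :=
  RestrictScalars A ↥(reesAlg A r M) (lcMod A r M i)

/-- `overline{M^n}` for `n ∈ ℤ` (zero in negative degrees). -/
noncomputable def barPowZ (A : Type) [CommRing A] (r : ℕ)
    (M : Submodule A (Fin r → A)) (n : ℤ) : Submodule A (MvPolynomial (Fin r) A) :=
  if 0 ≤ n then barPow A r M n.toNat else ⊥

/-- `M^n` for `n ∈ ℤ` (zero in negative degrees). -/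
noncomputable def subPowZ (A : Type) [CommRing A] (r : ℕ)
    (M : Submodule A (Fin r → A)) (n : ℤ) : Submodule A (MvPolynomial (Fin r) A) :=
  if 0 ≤ n then (sub1 A r M) ^ n.toNat else ⊥

section
open CategoryTheory Limits Opposite

namespace LC
variable {R : Type} [CommRing R]

/-- class of a cocycle -/
noncomputable def zc (K : CochainComplex (ModuleCat.{0} R) ℕ) (i : ℕ) :
    ModuleCat.of R (LinearMap.ker (K.d i (i+1)).hom) ⟶ K.homology i :=
  K.liftCycles (ModuleCat.ofHom (LinearMap.ker (K.d i (i+1)).hom).subtype) (i+1) (by simp)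
    (by ext x; exact x.2) ≫ K.homologyπ i

lemma zc_surj (K : CochainComplex (ModuleCat.{0} R) ℕ) (i : ℕ) :
    Function.Surjective (zc K i) := by
  intro h
  have hs : Function.Surjective (K.homologyπ i) := (ModuleCat.epi_iff_surjective _).1 inferInstance
  obtain ⟨z, rfl⟩ := hs h
  refine ⟨⟨K.iCycles i z, ?_⟩, ?_⟩
  · have := congrArg (fun f => f.hom z) (K.iCycles_d i (i+1))
    exact this
  · simp only [zc, ConcreteCategory.comp_apply]
    congr 1
    have hi : Function.Injective (K.iCycles i) := (ModuleCat.mono_iff_injective _).1 inferInstance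
    apply hi
    rw [← ConcreteCategory.comp_apply, HomologicalComplex.liftCycles_i]
    rfl

lemma zc_zero (K : CochainComplex (ModuleCat.{0} R) ℕ) (i : ℕ) (x) :
    zc K i x = 0 ↔ ∃ j, ∃ y, x.1 = K.d j i y := by
  have hi : Function.Injective (K.iCycles i) := (ModuleCat.mono_iff_injective _).1 inferInstance
  have hz : K.iCycles i (K.liftCycles (ModuleCat.ofHom (LinearMap.ker (K.d i (i+1)).hom).subtype) (i+1) (by simp)
    (by ext x; exact x.2) x) = x.1 := by
    rw [← ConcreteCategory.comp_apply, HomologicalComplex.liftCycles_i]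
    rfl
  constructor
  · intro h
    let S := ShortComplex.mk (K.toCycles ((ComplexShape.up ℕ).prev i) i) (K.homologyπ i) (by simp)
    have hS : S.Exact := S.exact_of_g_is_cokernel (K.homologyIsCokernel _ i rfl)
    obtain ⟨y, hy⟩ := (ShortComplex.moduleCat_exact_iff S).1 hS _ h
    refine ⟨_, y, ?_⟩
    refine hz.symm.trans ((congrArg (K.iCycles i) hy.symm).trans ?_)
    change K.iCycles i (K.toCycles _ i y) = _
    rw [← ConcreteCategory.comp_apply, K.toCycles_i]
  · rintro ⟨j, y, hy⟩
    have : K.liftCycles (ModuleCat.ofHom (LinearMap.ker (K.d i (i+1)).hom).subtype) (i+1) (by simp)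
        (by ext x; exact x.2) x = K.toCycles j i y := by
      apply hi
      rw [hz, hy, ← ConcreteCategory.comp_apply, K.toCycles_i]
    simp only [zc, ConcreteCategory.comp_apply]
    rw [this, ← ConcreteCategory.comp_apply, K.toCycles_comp_homologyπ]
    rfl

lemma zc_map {K L : CochainComplex (ModuleCat.{0} R) ℕ} (f : K ⟶ L) (i : ℕ) (x)
    (y : ModuleCat.of R (LinearMap.ker (L.d i (i+1)).hom)) (h : y.1 = f.f i x.1) :
    HomologicalComplex.homologyMap f i (zc K i x) = zc L i y := by
  have hi : Function.Injective (L.iCycles i) := (ModuleCat.mono_iff_injective _).1 inferInstance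
  simp only [zc, ConcreteCategory.comp_apply]
  rw [← ConcreteCategory.comp_apply, HomologicalComplex.homologyπ_naturality,
    ConcreteCategory.comp_apply]
  congr 1
  apply hi
  rw [← ConcreteCategory.comp_apply, HomologicalComplex.cyclesMap_i, ← ConcreteCategory.comp_apply,
   ← ConcreteCategory.comp_apply, HomologicalComplex.liftCycles_i, HomologicalComplex.liftCycles_i_assoc]
  exact h.symm

end LC
end

section
open CategoryTheory Limits Opposite

namespace LC
variable {R : Type} [CommRing R]

noncomputable def lyMap {P Q : ChainComplex (ModuleCat.{0} R) ℕ} (f : P ⟶ Q) (Y : ModuleCat.{0} R) :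
   Q.linearYonedaObj R Y ⟶ P.linearYonedaObj R Y :=
  (HomologicalComplex.unopFunctor _ _).map
   ((((linearYoneda R (ModuleCat.{0} R)).obj Y).rightOp.mapHomologicalComplex _).map f).op

lemma homologyUnop_nat {K L : ChainComplex (ModuleCat.{0} R)ᵒᵖ ℕ} (ψ : K ⟶ L) (i : ℕ) :
    HomologicalComplex.homologyMap ((HomologicalComplex.unopFunctor _ _).map ψ.op) i ≫
      (K.homologyUnop i).hom = (L.homologyUnop i).hom ≫ (HomologicalComplex.homologyMap ψ i).unop := by
  have := HomologicalComplex.homologyOp_hom_naturality ((HomologicalComplex.unopFunctor _ _).map ψ.op) i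
  exact (congrArg Quiver.Hom.unop this).symm

lemma abs_nat {C : Type*} [Category C] {E E' H H' U U' : C} (a : E' ⟶ E) (p : E ⟶ H) (q : E' ⟶ H')
    (k : H' ⟶ H) (u : U ≅ H) (v : U' ≅ H') (h : U' ⟶ U) (h1 : a ≫ p = q ≫ k) (h2 : h ≫ u.hom = v.hom ≫ k) :
    a ≫ (p ≫ u.inv) = (q ≫ v.inv) ≫ h := by
  have : h = v.hom ≫ k ≫ u.inv := by rw [← reassoc_of% h2]; simp
  rw [this, reassoc_of% h1]; simp

lemma isoExt_nat {X X' : ModuleCat.{0} R} (P : ProjectiveResolution X) (Q : ProjectiveResolution X')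
   (f : X ⟶ X') (φ : P.complex ⟶ Q.complex) (comm : φ.f 0 ≫ Q.π.f 0 = P.π.f 0 ≫ f) 
   (n : ℕ) (Y : ModuleCat.{0} R) :
   ((Ext R (ModuleCat.{0} R) n).map f.op).app Y ≫ (P.isoExt n Y).hom =
     (Q.isoExt n Y).hom ≫ HomologicalComplex.homologyMap (lyMap φ Y) n := by
  have h1 := ProjectiveResolution.isoLeftDerivedObj_inv_naturality f P Q φ comm
    ((linearYoneda R (ModuleCat.{0} R)).obj Y).rightOp n
  have h1' := congrArg Quiver.Hom.unop h1
  have h2 := homologyUnop_nat ((((linearYoneda R (ModuleCat.{0} R)).obj Y).rightOp.mapHomologicalComplex _).map φ) n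
  exact abs_nat _ _ _ _ (HomologicalComplex.homologyUnop _ _) (HomologicalComplex.homologyUnop _ _) _ h1' h2

end LC
end

section
open CategoryTheory Limits Opposite

namespace LC
variable {R : Type} [CommRing R]

/-- cocycles -/
def cyc (P : ChainComplex (ModuleCat.{0} R) ℕ) (i : ℕ) (N : ModuleCat.{0} R) :
    Submodule R (P.X i ⟶ N) where
  carrier := {φ | P.d (i+1) i ≫ φ = 0}
  zero_mem' := by simp
  add_mem' := by intro a b ha hb; simp_all
  smul_mem' := by intro c a ha; simp_all

lemma ly_d (P : ChainComplex (ModuleCat.{0} R) ℕ) (N : ModuleCat.{0} R) (i j : ℕ) (φ : P.X i ⟶ N) :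
   ((P.linearYonedaObj R N).d i j).hom φ = P.d j i ≫ φ := rfl

lemma ly_f {P Q : ChainComplex (ModuleCat.{0} R) ℕ} (f : P ⟶ Q) (N : ModuleCat.{0} R) (i : ℕ) (φ : Q.X i ⟶ N) :
   ((lyMap f N).f i) φ = f.f i ≫ φ := rfl

lemma cyc_mem {P : ChainComplex (ModuleCat.{0} R) ℕ} {i : ℕ} {N : ModuleCat.{0} R} {φ : P.X i ⟶ N} :
  φ ∈ cyc P i N ↔ P.d (i+1) i ≫ φ = 0 := Iff.rfl

def cycMap {P Q : ChainComplex (ModuleCat.{0} R) ℕ} (f : P ⟶ Q) {i : ℕ} {N : ModuleCat.{0} R}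
   (φ : cyc Q i N) : cyc P i N := ⟨f.f i ≫ φ.1, by
     rw [cyc_mem, ← f.comm_assoc, cyc_mem.1 φ.2, comp_zero]⟩

abbrev resTower (J : Ideal R) := ∀ n : ℕ, ProjectiveResolution (ModuleCat.of R (R ⧸ J ^ n))

/-- transition -/
noncomputable def qm (J : Ideal R) {n m : ℕ} (h : n ≤ m) : 
   ModuleCat.of R (R ⧸ J ^ m) ⟶ ModuleCat.of R (R ⧸ J ^ n) :=
   (localCohomology.ringModIdeals (localCohomology.idealPowersDiagram J)).map (homOfLE h).op

lemma qm_mk (J : Ideal R) {n m : ℕ} (h : n ≤ m) (a : R) : 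
   qm J h (Ideal.Quotient.mk (J^m) a) = Ideal.Quotient.mk (J^n) a := rfl

noncomputable def tau {J : Ideal R} (P : resTower J) {n m : ℕ} (h : n ≤ m) : (P m).complex ⟶ (P n).complex :=
  ProjectiveResolution.lift (qm J h) (P m) (P n)

lemma tau_comm {J : Ideal R} (P : resTower J) {n m : ℕ} (h : n ≤ m) :
   (tau P h).f 0 ≫ (P n).π.f 0 = (P m).π.f 0 ≫ qm J h := by
  exact ProjectiveResolution.lift_commutes_zero _ _ _

lemma abs_nat2 {C : Type*} [Category C] {E E' H H' : C} (a : E' ⟶ E) (p : E ≅ H) (q : E' ≅ H')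
    (k : H' ⟶ H) (h1 : a ≫ p.hom = q.hom ≫ k)  :
    q.inv ≫ a = k ≫ p.inv := by
  rw [Iso.eq_comp_inv, Category.assoc, h1, Iso.inv_hom_id_assoc]

theorem exists_cls {J : Ideal R} (P : resTower J) (i : ℕ) (N : ModuleCat.{0} R) :
    ∃ cls : ∀ n, cyc (P n).complex i N →ₗ[R] (localCohomology J i).obj N,
      (∀ h, ∃ n φ, cls n φ = h) ∧
      (∀ n φ, cls n φ = 0 ↔ ∃ m, ∃ h : n ≤ m, ∃ j, ∃ ψ : (P m).complex.X j ⟶ N,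
        (tau P h).f i ≫ φ.1 = (P m).complex.d i j ≫ ψ) ∧
      (∀ n m, ∀ h : n ≤ m, ∀ φ, cls n φ = cls m (cycMap (tau P h) φ)) := by
  let F := localCohomology.diagram (localCohomology.idealPowersDiagram J) i
  let hc : IsColimit (((evaluation (ModuleCat.{0} R) (ModuleCat.{0} R)).obj N).mapCocone (colimit.cocone F)) :=
    isColimitOfPreserves _ (colimit.isColimit F)
  let e (n : ℕ) : cyc (P n).complex i N ≃ₗ[R] 
      LinearMap.ker (((P n).complex.linearYonedaObj R N).d i (i+1)).hom :=
    LinearEquiv.refl _ _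
  have he : ∀ n φ, (e n φ).1 = φ.1 := fun _ _ => rfl
  let c (n : ℕ) : cyc (P n).complex i N →ₗ[R] ((Ext R (ModuleCat.{0} R) i).obj (op (ModuleCat.of R (R ⧸ J ^ n)))).obj N :=
    ((P n).isoExt i N).inv.hom ∘ₗ (zc ((P n).complex.linearYonedaObj R N) i).hom ∘ₗ (e n).toLinearMap
  have hcs : ∀ n, Function.Surjective (c n) := by
    intro n x
    obtain ⟨y, hy⟩ := zc_surj ((P n).complex.linearYonedaObj R N) i (((P n).isoExt i N).hom x)
    obtain ⟨z, rfl⟩ := (e n).surjective y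
    refine ⟨z, ?_⟩
    change ((P n).isoExt i N).inv (zc ((P n).complex.linearYonedaObj R N) i (e n z)) = x
    rw [hy]
    exact congrArg (fun f => f.hom x) ((P n).isoExt i N).hom_inv_id
  have hc0 : ∀ n φ, c n φ = 0 ↔ ∃ j, ∃ ψ : (P n).complex.X j ⟶ N, φ.1 = (P n).complex.d i j ≫ ψ := by
    intro n φ
    refine Iff.trans ?_ (zc_zero ((P n).complex.linearYonedaObj R N) i (e n φ))
    change ((P n).isoExt i N).inv (zc ((P n).complex.linearYonedaObj R N) i (e n φ)) = 0 ↔ _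
    constructor
    · intro h
      have h2 := congrArg ((P n).isoExt i N).hom h
      have h3 := congrArg (fun f => f.hom (zc ((P n).complex.linearYonedaObj R N) i (e n φ))) ((P n).isoExt i N).inv_hom_id
      exact h3.symm.trans (h2.trans (map_zero _))
    · intro h
      rw [h]; exact map_zero _
  have hcm : ∀ n m (h : n ≤ m) φ, ((Ext R (ModuleCat.{0} R) i).map (qm J h).op).app N (c n φ) = c m (cycMap (tau P h) φ) := by
    intro n m h φ
    have h1 := isoExt_nat (P m) (P n) (qm J h) (tau P h) (tau_comm P h) i N
    have h1 := abs_nat2 _ _ _ _ h1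
    have h2 := congrArg (fun f => f.hom (zc ((P n).complex.linearYonedaObj R N) i (e n φ))) h1
    refine h2.trans ?_
    refine congrArg ((P m).isoExt i N).inv ?_
    exact zc_map (lyMap (tau P h) N) i (e n φ) (e m (cycMap (tau P h) φ)) rfl
  let ι (n : ℕ) := (((evaluation (ModuleCat.{0} R) (ModuleCat.{0} R)).obj N).mapCocone (colimit.cocone F)).ι.app (op (op n))
  refine ⟨fun n => (ι n).hom ∘ₗ c n, ?_, ?_, ?_⟩
  · intro h
    obtain ⟨j, y, hy⟩ := Concrete.isColimit_exists_rep _ hc h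
    obtain ⟨z, rfl⟩ := hcs j.unop.unop y
    exact ⟨j.unop.unop, z, hy⟩
  · intro n φ
    have := Concrete.isColimit_rep_eq_iff_exists (F ⋙ (evaluation (ModuleCat.{0} R) (ModuleCat.{0} R)).obj N) hc
       (i := op (op n)) (j := op (op n)) (c n φ) 0
    rw [map_zero] at this
    refine this.trans ?_
    constructor
    · rintro ⟨k, f, g, hfg⟩
      have hle : n ≤ k.unop.unop := leOfHom f.unop.unop
      refine ⟨k.unop.unop, hle, ?_⟩
      have h3 := hcm n _ hle φ
      have h4 := (hc0 _ (cycMap (tau P hle) φ)).1 (h3.symm.trans (hfg.trans (map_zero _)))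
      exact h4
    · rintro ⟨m, h, j, ψ, hψ⟩
      refine ⟨op (op m), (homOfLE h).op.op, (homOfLE h).op.op, ?_⟩
      have h3 := hcm n _ h φ
      refine h3.trans (Eq.trans ?_ (map_zero _).symm)
      exact (hc0 _ (cycMap (tau P h) φ)).2 ⟨j, ψ, hψ⟩
  · intro n m h φ
    have h3 := hcm n _ h φ
    change ι n (c n φ) = ι m (c m _)
    rw [← h3]
    have := (((evaluation (ModuleCat.{0} R) (ModuleCat.{0} R)).obj N).mapCocone (colimit.cocone F)).ι.naturality
      (X := op (op n)) (Y := op (op m)) (homOfLE h).op.op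
    exact (congrArg (fun f => f.hom (c n φ)) this).symm

end LC
end

section
open CategoryTheory Limits Opposite

namespace LC
variable {R : Type} [CommRing R]

noncomputable def cls {J : Ideal R} (P : resTower J) (i : ℕ) (N : ModuleCat.{0} R) (n : ℕ) :
  cyc (P n).complex i N →ₗ[R] (localCohomology J i).obj N := (exists_cls P i N).choose n

variable {J : Ideal R} (P : resTower J)

lemma cls_surj {i : ℕ} {N : ModuleCat.{0} R} (h : (localCohomology J i).obj N) :
  ∃ n φ, cls P i N n φ = h := (exists_cls P i N).choose_spec.1 h
lemma cls_zero {i : ℕ} {N : ModuleCat.{0} R} {n : ℕ} {φ : cyc (P n).complex i N} :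
  cls P i N n φ = 0 ↔ ∃ m, ∃ h : n ≤ m, ∃ j, ∃ ψ : (P m).complex.X j ⟶ N,
        (tau P h).f i ≫ φ.1 = (P m).complex.d i j ≫ ψ := (exists_cls P i N).choose_spec.2.1 n φ
lemma cls_tau {i : ℕ} {N : ModuleCat.{0} R} {n m : ℕ} (h : n ≤ m) (φ : cyc (P n).complex i N) :
  cls P i N n φ = cls P i N m (cycMap (tau P h) φ) := (exists_cls P i N).choose_spec.2.2 n m h φ

lemma cls_cob {i : ℕ} {N : ModuleCat.{0} R} {n : ℕ} {φ : cyc (P n).complex i N} {j : ℕ}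
    (ψ : (P n).complex.X j ⟶ N) (h : φ.1 = (P n).complex.d i j ≫ ψ) : cls P i N n φ = 0 := by
  rw [cls_zero]
  exact ⟨n, le_refl n, j, (tau P le_rfl).f j ≫ ψ, by rw [h]; simp⟩

lemma cls_zero_succ {i : ℕ} {N : ModuleCat.{0} R} {n : ℕ} {φ : cyc (P n).complex (i+1) N} :
  cls P (i+1) N n φ = 0 ↔ ∃ m, ∃ h : n ≤ m, ∃ ψ : (P m).complex.X i ⟶ N,
        (tau P h).f (i+1) ≫ φ.1 = (P m).complex.d (i+1) i ≫ ψ := by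
  rw [cls_zero]
  constructor
  · rintro ⟨m, h, j, ψ, hψ⟩
    by_cases hj : j = i
    · subst hj; exact ⟨m, h, ψ, hψ⟩
    · refine ⟨m, h, 0, ?_⟩
      rw [hψ, (P m).complex.shape _ _ (by simp; omega)]; simp
  · rintro ⟨m, h, ψ, hψ⟩
    exact ⟨m, h, i, ψ, hψ⟩

abbrev Van (J : Ideal R) (i : ℕ) (N : ModuleCat.{0} R) : Prop := Subsingleton ((localCohomology J i).obj N)

lemma Van.cls {P : resTower J} {i : ℕ} {N : ModuleCat.{0} R} (h : Van J i N) (n : ℕ) (φ : cyc (P n).complex i N) :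
  cls P i N n φ = 0 := Subsingleton.elim _ _

lemma van_of {i : ℕ} {N : ModuleCat.{0} R} (h : ∀ n φ, LC.cls P i N n φ = 0) : Van J i N := by
  refine subsingleton_of_forall_eq 0 fun x => ?_
  obtain ⟨n, φ, rfl⟩ := cls_surj P x
  exact h n φ

instance projX (n i : ℕ) : Projective ((P n).complex.X i) := (P n).projective i

def cycPost {Q : ChainComplex (ModuleCat.{0} R) ℕ} {i : ℕ} {N N' : ModuleCat.{0} R} (φ : cyc Q i N) (f : N ⟶ N') :
   cyc Q i N' := ⟨φ.1 ≫ f, by rw [cyc_mem, ← Category.assoc, cyc_mem.1 φ.2, zero_comp]⟩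

/-- vanishing of one term makes the next map injective. -/
lemma inj_of_van (S : ShortComplex (ModuleCat.{0} R)) (hS : S.ShortExact) {i : ℕ} (h : Van J i S.X₃)
    {n : ℕ} (χ : cyc (P n).complex (i+1) S.X₁) (h0 : cls P (i+1) S.X₂ n (cycPost χ S.f) = 0) :
    cls P (i+1) S.X₁ n χ = 0 := by
  have := hS.mono_f
  have := hS.epi_g
  obtain ⟨m, hm, ψ, hψ⟩ := (cls_zero_succ P).1 h0
  have hc : (P m).complex.d (i+1) i ≫ (ψ ≫ S.g) = 0 := by
    rw [← Category.assoc, ← hψ]; simp [cycPost]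
  obtain ⟨k, hk, j, ψ2, hψ2⟩ := (cls_zero P).1 (h.cls (P := P) m ⟨ψ ≫ S.g, hc⟩)
  rw [cls_tau P hm]
  let ψ2' := Projective.factorThru ψ2 S.g
  have hw : ((tau P hk).f i ≫ ψ - (P k).complex.d i j ≫ ψ2') ≫ S.g = 0 := by
    simp [ψ2', hψ2]
  let ω := hS.exact.lift _ hw
  have hω : ω ≫ S.f = _ := hS.exact.lift_f _ hw
  rw [cls_zero_succ]
  refine ⟨k, hk, ω, ?_⟩
  rw [← cancel_mono S.f, Category.assoc, Category.assoc, hω]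
  have hψ' : ((tau P hm).f (i+1) ≫ χ.1) ≫ S.f = (P m).complex.d (i+1) i ≫ ψ := by simpa [cycPost] using hψ
  simp only [cycMap, hψ']
  simp

lemma van_succ_of (S : ShortComplex (ModuleCat.{0} R)) (hS : S.ShortExact) {i : ℕ} (h : Van J i S.X₃)
   (h2 : Van J (i+1) S.X₂) : Van J (i+1) S.X₁ := by
  let P : resTower J := fun n => ProjectiveResolution.of _
  exact van_of P fun n φ => inj_of_van P S hS h φ (h2.cls n _)

/-- torsion -/
lemma cls_torsion {i n : ℕ} {N : ModuleCat.{0} R} (φ : cyc (P n).complex i N) (a : R) (ha : a ∈ J ^ n) :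
   a • cls P i N n φ = 0 := by
  rw [← map_smul]
  let f : (P n).complex ⟶ (P n).complex := a • 𝟙 _
  have hf : f ≫ (P n).π = 0 := by
    ext : 1
    apply ModuleCat.hom_ext
    apply LinearMap.ext
    intro x
    have h : ∀ y : ModuleCat.of R (R ⧸ J ^ n), a • y = 0 := by
      intro y
      obtain ⟨y, rfl⟩ := Ideal.Quotient.mk_surjective y
      exact Ideal.Quotient.eq_zero_iff_mem.2 (Ideal.mul_mem_right _ _ ha)
    simp only [f, Linear.smul_comp, Category.id_comp]
    exact h _
  let H := ProjectiveResolution.liftHomotopyZero (P := P n) (Q := P n) f (by simpa using hf)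
  refine cls_cob P (j := (ComplexShape.down ℕ).next i) (H.hom _ _ ≫ φ.1) ?_
  have := H.comm i
  have h2 : (a • φ).1 = f.f i ≫ φ.1 := by simp [f]
  rw [h2, this]
  simp only [HomologicalComplex.zero_f, add_zero, Preadditive.add_comp]
  rw [prevD_eq (j' := i+1) _ (by simp), Category.assoc, cyc_mem.1 φ.2]
  simp [dNext]

lemma quot_surj (n : ℕ) : Function.Surjective ((P n).π.f 0) := 
  (ModuleCat.epi_iff_surjective _).1 inferInstance

end LC
end

section
open CategoryTheory Limits Opposite
open scoped Pointwise

namespace LC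
variable {R : Type} [CommRing R]
variable {J : Ideal R} (P : resTower J)

noncomputable def pr (n : ℕ) : (P n).complex.X 0 ⟶ ModuleCat.of R (R ⧸ J ^ n) := (P n).π.f 0

lemma pr_surj (n : ℕ) : Function.Surjective (pr P n) := quot_surj P n

lemma pr_exact (n : ℕ) (x) (h : pr P n x = 0) : ∃ w, (P n).complex.d 1 0 w = x :=
  (ShortComplex.moduleCat_exact_iff _).1 (P n).exact₀ x h

lemma pr_d (n : ℕ) (w) : pr P n ((P n).complex.d 1 0 w) = 0 := by
  have := congrArg (fun f => f.hom w) (P n).complex_d_comp_π_f_zero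
  exact this

lemma pr_tau {n m : ℕ} (h : n ≤ m) (x) : pr P n ((tau P h).f 0 x) = qm J h (pr P m x) :=
  congrArg (fun f => f.hom x) (tau_comm P h)

lemma cyc_d {n i : ℕ} {N : ModuleCat.{0} R} (φ : cyc (P n).complex i N) (w) :
   φ.1 ((P n).complex.d (i+1) i w) = 0 := 
  congrArg (fun f => f.hom w) (cyc_mem.1 φ.2)

lemma cyc0_zero {n : ℕ} {N : ModuleCat.{0} R} {a : R} (ha : a ∈ J) (hr : IsSMulRegular N a)
    (φ : cyc (P n).complex 0 N) : φ = 0 := by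
  apply Subtype.ext
  apply ModuleCat.hom_ext
  apply LinearMap.ext
  intro x
  have h0 : pr P n (a ^ n • x) = 0 := by
    rw [map_smul]
    obtain ⟨y, hy⟩ := Ideal.Quotient.mk_surjective (pr P n x)
    rw [← hy]
    exact Ideal.Quotient.eq_zero_iff_mem.2 (Ideal.mul_mem_right _ _ (Ideal.pow_mem_pow ha n))
  obtain ⟨w, hw⟩ := pr_exact P n _ h0
  have h1 := cyc_d P φ w
  rw [hw, map_smul] at h1
  have : IsSMulRegular N (a ^ n) := hr.pow n
  exact this (h1.trans (smul_zero _).symm)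

lemma van0 {N : ModuleCat.{0} R} {a : R} (ha : a ∈ J) (hr : IsSMulRegular N a) : Van J 0 N := by
  let P : resTower J := fun n => ProjectiveResolution.of _
  refine van_of P fun n φ => ?_
  rw [cyc0_zero P ha hr φ, map_zero]

lemma van_of_quot {N : Type} [AddCommGroup N] [Module R N] {a : R} (ha : a ∈ J) (hr : IsSMulRegular N a) 
   (k : ℕ) (h : Van J k (ModuleCat.of R (QuotSMulTop a N))) : Van J (k+1) (ModuleCat.of R N) := by
  let P : resTower J := fun n => ProjectiveResolution.of _
  let S : ShortComplex (ModuleCat.{0} R) := ShortComplex.moduleCatMk (LinearMap.lsmul R N a)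
     (Submodule.mkQ (a • (⊤ : Submodule R N))) (by
       ext x
       exact (Submodule.Quotient.mk_eq_zero _).2 (Submodule.smul_mem_pointwise_smul _ _ _ Submodule.mem_top))
  have hS : S.ShortExact := 
    { exact := by
        rw [ShortComplex.moduleCat_exact_iff]
        intro x hx
        obtain ⟨y, -, hy⟩ := (Submodule.mem_smul_pointwise_iff_exists _ _ _).1 ((Submodule.Quotient.mk_eq_zero _).1 hx)
        exact ⟨y, hy⟩
      mono_f := (ModuleCat.mono_iff_injective _).2 hr
      epi_g := (ModuleCat.epi_iff_surjective _).2 (Submodule.mkQ_surjective _) }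
  have key : ∀ h : (localCohomology J (k+1)).obj (ModuleCat.of R N), a • h = 0 → h = 0 := by
    intro x hx
    obtain ⟨n, χ, rfl⟩ := cls_surj P x
    refine inj_of_van P S hS h χ ?_
    rw [← map_smul] at hx
    exact hx
  have key2 : ∀ (n : ℕ) (h : (localCohomology J (k+1)).obj (ModuleCat.of R N)), a ^ n • h = 0 → h = 0 := by
    intro n
    induction n with
    | zero => intro h hh; simpa using hh
    | succ n ih =>
      intro h hh
      rw [pow_succ, mul_smul] at hh
      exact key _ (ih _ hh)
  refine van_of P fun n φ => key2 n _ (cls_torsion P φ _ (Ideal.pow_mem_pow ha n))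

lemma van_injective {E : ModuleCat.{0} R} [Injective E] (i : ℕ) : Van J (i+1) E := by
  let P : resTower J := fun n => ProjectiveResolution.of _
  refine van_of P fun n φ => ?_
  have hex : (ShortComplex.mk ((P n).complex.d (i+1+1) (i+1)) ((P n).complex.d (i+1) i) (by simp)).Exact := (P n).exact_succ i
  refine cls_cob P (hex.descToInjective φ.1 (cyc_mem.1 φ.2)) (hex.comp_descToInjective _ _).symm

def IsTors (J : Ideal R) (N : Type) [AddCommGroup N] [Module R N] : Prop :=
  ∀ x : N, ∃ k, ∀ b ∈ J ^ k, b • x = 0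

lemma exists_uniform [IsNoetherianRing R] {N : Type} [AddCommGroup N] [Module R N] (hN : IsTors J N) (I : Submodule R N) (hI : I.FG) :
   ∃ k, ∀ b ∈ J ^ k, ∀ x ∈ I, b • x = 0 := by
  refine Submodule.fg_induction (motive := fun I _ => ∃ k, ∀ b ∈ J ^ k, ∀ x ∈ I, b • x = 0) ?_ ?_ I hI
  · intro x
    obtain ⟨k, hk⟩ := hN x
    refine ⟨k, fun b hb y hy => ?_⟩
    obtain ⟨c, rfl⟩ := Submodule.mem_span_singleton.1 hy
    rw [smul_comm, hk b hb, smul_zero]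
  · rintro A B - - ⟨k, hk⟩ ⟨l, hl⟩
    refine ⟨k + l, fun b hb y hy => ?_⟩
    obtain ⟨u, hu, v, hv, rfl⟩ := Submodule.mem_sup.1 hy
    rw [smul_add, hk b (Ideal.pow_le_pow_right (by omega) hb) u hu, hl b (Ideal.pow_le_pow_right (by omega) hb) v hv, add_zero]

/-- `H^1` of torsion modules vanishes. -/
lemma van_one_tors [IsNoetherianRing R] {N : ModuleCat.{0} R} (hN : IsTors J N) : Van J 1 N := by
  let P : resTower J := fun n => ProjectiveResolution.of _
  refine van_of P fun n φ => ?_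
  obtain ⟨p0, hp0⟩ := pr_surj P n (Ideal.Quotient.mk _ 1)
  -- kernel
  let d : (P n).complex.X 1 →ₗ[R] (P n).complex.X 0 := ((P n).complex.d 1 0).hom
  let K := LinearMap.range d
  have hker : LinearMap.ker d ≤ LinearMap.ker φ.1.hom := by
    intro x hx
    have hex : (ShortComplex.mk ((P n).complex.d (0+1+1) (0+1)) ((P n).complex.d (0+1) 0) (by simp)).Exact := (P n).exact_succ 0
    obtain ⟨w, rfl⟩ := (ShortComplex.moduleCat_exact_iff _).1 hex x hx
    exact cyc_d P φ w
  let φb : K →ₗ[R] N := (Submodule.liftQ _ φ.1.hom hker) ∘ₗ d.quotKerEquivRange.symm.toLinearMap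
  have hφb : ∀ w (h : d w ∈ K), φb ⟨d w, h⟩ = φ.1 w := by
    intro w h
    have : d.quotKerEquivRange (Submodule.Quotient.mk w) = ⟨d w, h⟩ := rfl
    simp only [φb, LinearMap.comp_apply, LinearEquiv.coe_coe]
    rw [← this, LinearEquiv.symm_apply_apply]
    rfl
  have hK : ∀ x, pr P n x = 0 → x ∈ K := fun x hx => by
    obtain ⟨w, hw⟩ := pr_exact P n x hx; exact ⟨w, hw⟩
  have hJp : ∀ a ∈ J ^ n, a • p0 ∈ K := by
    intro a ha
    apply hK
    rw [map_smul, hp0]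
    exact Ideal.Quotient.eq_zero_iff_mem.2 (Ideal.mul_mem_right _ _ ha)
  let g : ↥(J ^ n) →ₗ[R] N := φb ∘ₗ LinearMap.codRestrict K ((LinearMap.toSpanSingleton R _ p0) ∘ₗ (J ^ n).subtype)
    (fun a => hJp a.1 a.2)
  obtain ⟨k, hk⟩ := exists_uniform hN (LinearMap.range g) (by
     rw [LinearMap.range_eq_map]; exact (IsNoetherian.noetherian (⊤ : Submodule R (↥(J^n)))).map g)
  have hg : ∀ a (h : a • p0 ∈ K), a ∈ J ^ (n + k) → φb ⟨a • p0, h⟩ = 0 := by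
    intro a h ha
    rw [pow_add] at ha
    have haux : a • p0 ∈ Submodule.map K.subtype (LinearMap.ker φb) := by
      clear h
      refine Submodule.mul_induction_on ha (fun b hb c hc => ?_) (fun b c hb hc => ?_)
      · refine ⟨⟨(b * c) • p0, hJp _ (Ideal.mul_mem_right _ _ hb)⟩, ?_, rfl⟩
        have h1 : (⟨(b * c) • p0, hJp _ (Ideal.mul_mem_right _ _ hb)⟩ : K) = c • ⟨b • p0, hJp _ hb⟩ := by
          apply Subtype.ext; simp [mul_comm b c, mul_smul]
        rw [SetLike.mem_coe, LinearMap.mem_ker, h1, map_smul]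
        exact hk c hc _ ⟨⟨b, hb⟩, rfl⟩
      · rw [add_smul]; exact add_mem hb hc
    obtain ⟨y, hy, hy2⟩ := haux
    have : y = ⟨a • p0, h⟩ := Subtype.ext hy2
    rw [← this]; exact hy
  have hnm : n ≤ n + k := Nat.le_add_right _ _
  let mkm : ModuleCat.of R R ⟶ ModuleCat.of R (R ⧸ J ^ (n+k)) := ModuleCat.ofHom (Submodule.mkQ (J ^ (n+k)))
  have : Epi mkm := (ModuleCat.epi_iff_surjective _).2 (Submodule.mkQ_surjective _)
  let lam := Projective.factorThru (pr P (n+k)) mkm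
  have hlam : ∀ x, Ideal.Quotient.mk (J ^ (n+k)) (lam x) = pr P (n+k) x := fun x => 
    congrArg (fun f => f.hom x) (Projective.factorThru_comp (pr P (n+k)) mkm)
  let s : (P (n+k)).complex.X 0 →ₗ[R] (P n).complex.X 0 := 
     ((tau P hnm).f 0).hom - (LinearMap.toSpanSingleton R _ p0) ∘ₗ lam.hom
  have hs : ∀ x, s x = (tau P hnm).f 0 x - (lam x : R) • p0 := fun x => rfl
  have hsK : ∀ x, s x ∈ K := by
    intro x
    apply hK
    rw [hs, map_sub, pr_tau, map_smul, hp0, ← hlam, qm_mk]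
    change Ideal.Quotient.mk _ _ - Ideal.Quotient.mk (J^n) ((lam x : R) * 1) = 0
    rw [mul_one, sub_self]
  rw [cls_zero_succ]
  refine ⟨n + k, hnm, ModuleCat.ofHom (φb ∘ₗ LinearMap.codRestrict K s hsK), ?_⟩
  apply ModuleCat.hom_ext
  apply LinearMap.ext
  intro w
  change φ.1 ((tau P hnm).f 1 w) = φb ⟨s ((P (n+k)).complex.d 1 0 w), _⟩
  have hlw : (lam ((P (n+k)).complex.d 1 0 w) : R) ∈ J ^ (n+k) := by
    rw [← Ideal.Quotient.eq_zero_iff_mem, hlam, pr_d]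
  have hcomm : (tau P hnm).f 0 ((P (n+k)).complex.d 1 0 w) = d ((tau P hnm).f 1 w) :=
    congrArg (fun f => f.hom w) ((tau P hnm).comm 1 0).symm
  have h1 : (⟨s ((P (n+k)).complex.d 1 0 w), hsK _⟩ : K) = ⟨d ((tau P hnm).f 1 w), ⟨_, rfl⟩⟩ - 
      ⟨(lam ((P (n+k)).complex.d 1 0 w) : R) • p0, hJp _ (Ideal.pow_le_pow_right hnm hlw)⟩ := by
    apply Subtype.ext
    simp [hs, hcomm]
  rw [h1, map_sub]
  erw [hφb]
  rw [hg _ _ hlw, sub_zero]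

end LC
end

section
open CategoryTheory Limits Opposite
open scoped Pointwise

namespace LC
variable {R : Type} [CommRing R]
variable {J : Ideal R}

/-- torsion submodule -/
def Gam (J : Ideal R) (E : Type) [AddCommGroup E] [Module R E] : Submodule R E where
  carrier := {x | ∃ k, ∀ b ∈ J ^ k, b • x = 0}
  zero_mem' := ⟨0, by simp⟩
  add_mem' := by
    rintro x y ⟨k, hk⟩ ⟨l, hl⟩
    refine ⟨k + l, fun b hb => ?_⟩
    rw [smul_add, hk b (Ideal.pow_le_pow_right (by omega) hb), hl b (Ideal.pow_le_pow_right (by omega) hb), add_zero]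
  smul_mem' := by
    rintro c x ⟨k, hk⟩
    exact ⟨k, fun b hb => by rw [smul_comm, hk b hb, smul_zero]⟩

lemma Gam_tors (E : Type) [AddCommGroup E] [Module R E] : IsTors J (Gam J E) := by
  rintro ⟨x, k, hk⟩
  exact ⟨k, fun b hb => Subtype.ext (hk b hb)⟩

lemma Gam_baer [IsNoetherianRing R] (E : Type) [AddCommGroup E] [Module R E] (hE : Module.Baer R E) :
    Module.Baer R (Gam J E) := by
  intro I g
  obtain ⟨k, hk⟩ := exists_uniform (Gam_tors (J := J) E) (LinearMap.range g) (by
     rw [LinearMap.range_eq_map]; exact (IsNoetherian.noetherian (⊤ : Submodule R I)).map g)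
  obtain ⟨q, hq⟩ := Ideal.exists_pow_inf_eq_pow_smul J (M := R) I
  have hq1 : ∀ x, x ∈ I → x ∈ J ^ (k + q) → x ∈ J ^ k * I := by
    intro x hx hx2
    have h := hq (k + q) (by omega)
    have h2 : x ∈ J ^ (k + q) • (⊤ : Submodule R R) ⊓ I := ⟨by simpa using hx2, hx⟩
    rw [h, show k + q - q = k by omega] at h2
    exact Ideal.mul_mono_right inf_le_right h2
  have hq2 : ∀ x (hx : x ∈ I), x ∈ J ^ (k + q) → g ⟨x, hx⟩ = 0 := by
    intro x hx hx2
    have haux : x ∈ Submodule.map I.subtype (LinearMap.ker g) := by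
      refine Submodule.mul_induction_on (hq1 x hx hx2) (fun b hb c hc => ?_) (fun b c hb hc => add_mem hb hc)
      refine ⟨b • ⟨c, hc⟩, ?_, rfl⟩
      rw [SetLike.mem_coe, LinearMap.mem_ker, map_smul]
      exact hk b hb _ ⟨_, rfl⟩
    obtain ⟨y, hy, hy2⟩ := haux
    have : y = ⟨x, hx⟩ := Subtype.ext hy2
    rw [← this]; exact hy
  -- extend to I ⊔ J^(k+q)
  let K : Ideal R := J ^ (k+q)
  let f : I →ₗ[R] E := (Gam J E).subtype ∘ₗ g
  obtain ⟨h, hh⟩ : ∃ h : ↥(I ⊔ K) →ₗ[R] E, ∀ x (hx : x ∈ I) y (hy : y ∈ K), 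
      h ⟨x + y, Submodule.add_mem_sup hx hy⟩ = f ⟨x, hx⟩ := by
    -- choose decomposition
    have hdec : ∀ z : ↥(I ⊔ K), ∃ x : I, ∃ y : K, (x : R) + y = z := by
      rintro ⟨z, hz⟩
      obtain ⟨x, hx, y, hy, rfl⟩ := Submodule.mem_sup.1 hz
      exact ⟨⟨x, hx⟩, ⟨y, hy⟩, rfl⟩
    choose a b hab using hdec
    have hwd : ∀ (x x' : I), (x : R) - x' ∈ K → f x = f x' := by
      intro x x' hx
      rw [← sub_eq_zero, ← map_sub]
      have := hq2 _ (x - x').2 hx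
      exact congrArg Subtype.val this
    refine ⟨{ toFun := fun z => f (a z), map_add' := ?_, map_smul' := ?_ }, ?_⟩
    · intro z w
      rw [← map_add]
      apply hwd
      have e1 := hab z; have e2 := hab w; have e3 := hab (z + w)
      have : ((a (z+w) : I) : R) - ((a z + a w : I) : R) = b z + b w - b (z + w) := by
        push_cast at *
        linear_combination e3 - e1 - e2
      rw [this]
      exact sub_mem (add_mem (b z).2 (b w).2) (b (z+w)).2
    · intro c z
      rw [RingHom.id_apply, ← map_smul]
      apply hwd
      have e1 := hab z; have e3 := hab (c • z)
      have : ((a (c • z) : I) : R) - ((c • a z : I) : R) = c * b z - b (c • z) := by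
        simp only [Submodule.coe_smul, smul_eq_mul] at *
        linear_combination e3 - c * e1
      rw [this]
      exact sub_mem (Ideal.mul_mem_left _ _ (b z).2) (b (c • z)).2
    · intro x hx y hy
      apply hwd
      have e1 := hab ⟨x + y, Submodule.add_mem_sup hx hy⟩
      have : ((a ⟨x + y, Submodule.add_mem_sup hx hy⟩ : I) : R) - x = y - b ⟨x + y, Submodule.add_mem_sup hx hy⟩ := by
        simp only at e1
        linear_combination e1
      exact this ▸ sub_mem hy (b _).2
  obtain ⟨G, hG⟩ := hE _ h
  have hGK : ∀ y ∈ K, G y = 0 := by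
    intro y hy
    rw [hG y (Submodule.mem_sup_right hy)]
    have := hh 0 I.zero_mem y hy
    simp only [zero_add] at this
    rw [this]
    exact map_zero f
  have hG1 : G 1 ∈ Gam J E := by
    refine ⟨k + q, fun b hb => ?_⟩
    rw [← map_smul, smul_eq_mul, mul_one]
    exact hGK b hb
  refine ⟨LinearMap.toSpanSingleton R _ ⟨G 1, hG1⟩, ?_⟩
  intro x hx
  apply Subtype.ext
  have h1 : G x = f ⟨x, hx⟩ := by
    rw [hG x (Submodule.mem_sup_left hx)]
    have := hh x hx 0 K.zero_mem
    simpa using this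
  change x • G 1 = f ⟨x, hx⟩
  rw [← h1, ← map_smul, smul_eq_mul, mul_one]

lemma IsTors.quot {N : Type} [AddCommGroup N] [Module R N] (h : IsTors J N) (K : Submodule R N) : IsTors J (N ⧸ K) := by
  intro x
  obtain ⟨x, rfl⟩ := Submodule.mkQ_surjective _ x
  obtain ⟨k, hk⟩ := h x
  exact ⟨k, fun b hb => by rw [← map_smul, hk b hb, map_zero]⟩

lemma van_tors [IsNoetherianRing R] (i : ℕ) : ∀ (N : Type) [AddCommGroup N] [Module R N] (_ : IsTors J N), 
    Van J (i+1) (ModuleCat.of R N) := by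
  induction i with
  | zero => intro N _ _ h; exact van_one_tors (N := ModuleCat.of R N) h
  | succ i ih =>
    intro N _ _ h
    obtain ⟨E⟩ := EnoughInjectives.presentation (ModuleCat.of R N)
    have hE := E.injective
    have hEB : Module.Baer R E.J := Module.Baer.of_injective ((Module.injective_iff_injective_object R E.J).2 hE)
    let Γ := Gam J E.J
    have hΓB : Module.Baer R Γ := Gam_baer _ hEB
    have hΓ : Injective (ModuleCat.of R Γ) := (Module.injective_iff_injective_object R Γ).1 hΓB.injective
    have hf := (ModuleCat.mono_iff_injective E.f).1 E.mono
    let f : N →ₗ[R] Γ := LinearMap.codRestrict Γ E.f.hom (fun x => by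
      obtain ⟨k, hk⟩ := h x
      refine ⟨k, fun b hb => ?_⟩
      rw [← map_smul, hk b hb, map_zero])
    let S : ShortComplex (ModuleCat.{0} R) := ShortComplex.moduleCatMk f (Submodule.mkQ (LinearMap.range f)) (by
       ext x
       exact (Submodule.Quotient.mk_eq_zero _).2 ⟨x, rfl⟩)
    have hS : S.ShortExact := 
      { exact := by
          rw [ShortComplex.moduleCat_exact_iff]
          intro x hx
          exact (Submodule.Quotient.mk_eq_zero _).1 hx
        mono_f := (ModuleCat.mono_iff_injective _).2 (fun x y hxy => hf (congrArg Subtype.val hxy))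
        epi_g := (ModuleCat.epi_iff_surjective _).2 (Submodule.mkQ_surjective _) }
    refine van_succ_of S hS (ih _ ((Gam_tors E.J).quot _)) ?_
    exact van_injective (E := ModuleCat.of R Γ) _

lemma van_regular [IsNoetherianRing R] (rs : List R) : ∀ (N : Type) [AddCommGroup N] [Module R N] 
    (_ : ∀ a ∈ rs, a ∈ J) (_ : RingTheory.Sequence.IsWeaklyRegular N rs)
    (_ : ∀ x : N, ∃ k, ∀ b ∈ J ^ k, b • x ∈ Ideal.ofList rs • (⊤ : Submodule R N)) (i : ℕ), i ≠ rs.length → 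
    Van J i (ModuleCat.of R N) := by
  induction rs with
  | nil => 
    intro N _ _ _ _ h i hi
    obtain ⟨k, rfl⟩ := Nat.exists_eq_succ_of_ne_zero hi
    refine van_tors k N fun x => ?_
    obtain ⟨k, hk⟩ := h x
    exact ⟨k, fun b hb => by simpa using hk b hb⟩
  | cons a l ih =>
    intro N _ _ hJ hreg h i hi
    rw [RingTheory.Sequence.isWeaklyRegular_cons_iff] at hreg
    have ha : a ∈ J := hJ a (by simp)
    cases i with
    | zero => exact van0 (N := ModuleCat.of R N) ha hreg.1
    | succ k =>
      refine van_of_quot ha hreg.1 k (ih _ (fun b hb => hJ b (by simp [hb])) hreg.2 ?_ k (by simpa using hi))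
      intro x
      obtain ⟨x, rfl⟩ := Submodule.mkQ_surjective _ x
      obtain ⟨m, hm⟩ := h x
      refine ⟨m, fun b hb => ?_⟩
      have h1 := Submodule.mem_map_of_mem (f := Submodule.mkQ (a • (⊤ : Submodule R N))) (hm b hb)
      rw [Submodule.map_smul'', Submodule.map_top, Submodule.range_mkQ, Ideal.ofList_cons, Submodule.sup_smul] at h1
      rw [map_smul] at h1
      have h2 : Ideal.span {a} • (⊤ : Submodule R (QuotSMulTop a N)) = ⊥ := by
        rw [eq_bot_iff, Submodule.smul_le]
        intro r hr n _
        obtain ⟨c, rfl⟩ := Ideal.mem_span_singleton'.1 hr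
        obtain ⟨n, rfl⟩ := Submodule.mkQ_surjective _ n
        rw [Submodule.mem_bot, ← map_smul, mul_smul, smul_comm]
        exact (Submodule.Quotient.mk_eq_zero _).2 (Submodule.smul_mem_pointwise_smul _ _ _ Submodule.mem_top)
      change _ ∈ Ideal.span {a} • (⊤ : Submodule R (QuotSMulTop a N)) ⊔ _ at h1
      rw [h2, bot_sup_eq] at h1
      exact h1

end LC
end

section
open CategoryTheory Limits Opposite
open scoped Pointwise

namespace LC
variable {R : Type} [CommRing R]
variable {J : Ideal R}

theorem h1_equiv (S : ShortComplex (ModuleCat.{0} R)) (hS : S.ShortExact) (hC : IsTors J S.X₃)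
   {a : R} (ha : a ∈ J) (hr : IsSMulRegular S.X₂ a) (hB : Van J 1 S.X₂) :
   Nonempty (S.X₃ ≃ₗ[R] (localCohomology J 1).obj S.X₁) := by
  let P : resTower J := fun n => ProjectiveResolution.of _
  have := hS.mono_f
  have := hS.epi_g
  let C := S.X₃
  let H := (localCohomology J 1).obj S.X₁
  -- the relation
  let rel : S.X₃ → ((localCohomology J 1).obj S.X₁) → ℕ → Prop := fun c h n => 
     ∃ φ : (P n).complex.X 0 ⟶ S.X₂, ∃ χ : cyc (P n).complex 1 S.X₁,
      (P n).complex.d 1 0 ≫ φ = χ.1 ≫ S.f ∧ (∀ p (a : R), pr P n p = Ideal.Quotient.mk _ a → S.g (φ p) = a • c) ∧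
      cls P 1 S.X₁ n χ = h
  have relmono : ∀ c h n m, n ≤ m → rel c h n → rel c h m := by
    rintro c h n m hnm ⟨φ, χ, h1, h2, h3⟩
    refine ⟨(tau P hnm).f 0 ≫ φ, cycMap (tau P hnm) χ, ?_, ?_, ?_⟩
    · simp only [cycMap]
      rw [Category.assoc, ← h1]; simp
    · intro p a hp
      refine h2 ((tau P hnm).f 0 p) a ?_
      rw [pr_tau, hp, qm_mk]
    · rw [← cls_tau, h3]
  let G : Submodule R (S.X₃ × ((localCohomology J 1).obj S.X₁)) :=
    { carrier := {x | ∃ n, rel x.1 x.2 n}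
      zero_mem' := ⟨0, 0, 0, by simp, by intro p a _; exact (map_zero S.g.hom).trans (smul_zero a).symm, by simp⟩
      add_mem' := by
        rintro ⟨c, h⟩ ⟨c', h'⟩ ⟨n, hn⟩ ⟨m, hm⟩
        obtain ⟨φ, χ, h1, h2, h3⟩ := relmono _ _ _ _ (Nat.le_add_right n m) hn
        obtain ⟨φ', χ', h1', h2', h3'⟩ := relmono _ _ _ _ (Nat.le_add_left m n) hm
        refine ⟨n + m, φ + φ', χ + χ', ?_, ?_, ?_⟩
        · simp [h1, h1']
        · intro p a hp
          have e1 := h2 p a hp; have e2 := h2' p a hp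
          simp only at e1 e2
          change S.g (φ p + φ' p) = a • (c + c')
          rw [map_add, e1, e2, smul_add]
        · rw [map_add, h3, h3']; rfl
      smul_mem' := by
        rintro r ⟨c, h⟩ ⟨n, φ, χ, h1, h2, h3⟩
        refine ⟨n, r • φ, r • χ, ?_, ?_, ?_⟩
        · simp [h1]
        · intro p a hp
          have e1 := h2 p a hp
          simp only at e1
          change S.g (r • φ p) = a • (r • c)
          rw [map_smul, e1, smul_comm]
        · rw [map_smul, h3]; rfl }
  have hG1 : Function.Injective (LinearMap.fst R _ _ ∘ₗ G.subtype) := by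
    rw [← LinearMap.ker_eq_bot, LinearMap.ker_eq_bot']
    rintro ⟨⟨c, h⟩, n, φ, χ, h1, h2, h3⟩ hc
    replace hc : c = 0 := hc
    subst hc
    suffices h = 0 by subst this; rfl
    have hφ : φ ≫ S.g = 0 := by
      apply ModuleCat.hom_ext; apply LinearMap.ext; intro p
      obtain ⟨a, ha⟩ := Ideal.Quotient.mk_surjective (pr P n p)
      exact (h2 p a ha.symm).trans (smul_zero _)
    have hω := hS.exact.lift_f φ hφ
    simp only at h3
    rw [← h3]
    refine cls_cob P (hS.exact.lift φ hφ) ?_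
    rw [← cancel_mono S.f, Category.assoc, hω, h1]
  have hG2 : Function.Surjective (LinearMap.fst R _ _ ∘ₗ G.subtype) := by
    intro c
    obtain ⟨n, hn⟩ := hC c
    let f : (R ⧸ J ^ n) →ₗ[R] S.X₃ := Submodule.liftQ _ (LinearMap.toSpanSingleton R _ c) (by
      intro b hb; exact hn b hb)
    let φ := Projective.factorThru (pr P n ≫ ModuleCat.ofHom f) S.g
    have hφ : φ ≫ S.g = _ := Projective.factorThru_comp _ _
    have hd : ((P n).complex.d 1 0 ≫ φ) ≫ S.g = 0 := by
      rw [Category.assoc, hφ]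
      apply ModuleCat.hom_ext; apply LinearMap.ext; intro w
      change f (pr P n ((P n).complex.d 1 0 w)) = 0
      rw [pr_d, map_zero]
    have hχ := hS.exact.lift_f _ hd
    refine ⟨⟨(c, cls P 1 S.X₁ n ⟨hS.exact.lift _ hd, ?_⟩), n, φ, _, hχ.symm, ?_, rfl⟩, rfl⟩
    · rw [cyc_mem, ← cancel_mono S.f, Category.assoc, hχ]; simp
    · intro p a hp
      have h1 : S.g (φ p) = f (pr P n p) := congrArg (fun f => f.hom p) hφ
      rw [h1, hp]; rfl
  have hG3 : Function.Injective (LinearMap.snd R _ _ ∘ₗ G.subtype) := by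
    rw [← LinearMap.ker_eq_bot, LinearMap.ker_eq_bot']
    rintro ⟨⟨c, h⟩, n, φ, χ, h1, h2, h3⟩ hc
    replace hc : h = 0 := hc
    subst hc
    suffices c = 0 by subst this; rfl
    simp only at h3
    obtain ⟨m, hm, ω, hω⟩ := (cls_zero_succ P).1 h3
    have hcyc : (tau P hm).f 0 ≫ φ - ω ≫ S.f ∈ cyc (P m).complex 0 S.X₂ := by
      rw [cyc_mem]
      have hω1 : (tau P hm).f 1 ≫ χ.1 = (P m).complex.d 1 0 ≫ ω := hω
      have hc1 : (P m).complex.d 1 0 ≫ (tau P hm).f 0 = (tau P hm).f 1 ≫ (P n).complex.d 1 0 := ((tau P hm).comm 1 0).symm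
      change (P m).complex.d 1 0 ≫ _ = 0
      rw [Preadditive.comp_sub, ← Category.assoc, hc1, Category.assoc, h1, ← Category.assoc _ ω, ← hω1, Category.assoc, sub_self]
    have h0 := congrArg Subtype.val (cyc0_zero P ha hr ⟨_, hcyc⟩)
    simp only [ZeroMemClass.coe_zero, sub_eq_zero] at h0
    obtain ⟨p, hp⟩ := pr_surj P m (Ideal.Quotient.mk _ 1)
    have e1 := h2 ((tau P hm).f 0 p) 1 (by rw [pr_tau, hp, qm_mk])
    have e2 : φ ((tau P hm).f 0 p) = S.f (ω p) := congrArg (fun f => f.hom p) h0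
    rw [e2] at e1
    have e3 : S.g (S.f (ω p)) = 0 := congrArg (fun f => f.hom (ω p)) S.zero
    rw [e3, one_smul] at e1
    exact e1.symm
  have hG4 : Function.Surjective (LinearMap.snd R _ _ ∘ₗ G.subtype) := by
    intro h
    obtain ⟨n, χ, rfl⟩ := cls_surj P h
    obtain ⟨m, hm, φ, hφ⟩ := (cls_zero_succ P).1 (hB.cls (P := P) n (cycPost χ S.f))
    obtain ⟨p1, hp1⟩ := pr_surj P m (Ideal.Quotient.mk _ 1)
    have hdφ : (P m).complex.d 1 0 ≫ φ = (cycMap (tau P hm) χ).1 ≫ S.f := by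
      rw [← hφ]; simp [cycMap, cycPost]
    refine ⟨⟨(S.g (φ p1), cls P 1 S.X₁ n χ), m, φ, cycMap (tau P hm) χ, hdφ, ?_, (cls_tau P hm χ).symm⟩, rfl⟩
    intro p a hp
    have h1 : pr P m (p - a • p1) = 0 := by
      rw [map_sub, map_smul, hp1, hp]
      change Ideal.Quotient.mk _ a - Ideal.Quotient.mk (J^m) (a * 1) = 0
      rw [mul_one, sub_self]
    obtain ⟨w, hw⟩ := pr_exact P m _ h1
    have h2 : S.g (φ ((P m).complex.d 1 0 w)) = 0 := by
      have e1 : φ ((P m).complex.d 1 0 w) = S.f ((cycMap (tau P hm) χ).1 w) := congrArg (fun f => f.hom w) hdφ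
      rw [e1]
      exact congrArg (fun f => f.hom ((cycMap (tau P hm) χ).1 w)) S.zero
    rw [hw, map_sub, map_sub, map_smul, map_smul, sub_eq_zero] at h2
    exact h2
  exact ⟨(LinearEquiv.ofBijective _ ⟨hG1, hG2⟩).symm.trans (LinearEquiv.ofBijective _ ⟨hG3, hG4⟩)⟩

theorem main [IsNoetherianRing R] (B : Type) [AddCommGroup B] [Module R B] (ι : R →ₗ[R] B) (hι : Function.Injective ι)
   (hC : IsTors J (B ⧸ LinearMap.range ι)) (rs : List R) (hrs : ∀ a ∈ rs, a ∈ J) (hl : 2 ≤ rs.length)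
   (hreg : RingTheory.Sequence.IsWeaklyRegular B rs)
   (htors : ∀ x : B, ∃ k, ∀ b ∈ J ^ k, b • x ∈ Ideal.ofList rs • (⊤ : Submodule R B)) :
   (∀ p, p ≠ 1 → p ≠ rs.length → Subsingleton ((localCohomology J p).obj (ModuleCat.of R R))) ∧
   Nonempty ((B ⧸ LinearMap.range ι) ≃ₗ[R] (localCohomology J 1).obj (ModuleCat.of R R)) := by
  obtain ⟨a, l, rfl⟩ : ∃ a l, rs = a :: l := by
    cases rs with
    | nil => simp at hl
    | cons a l => exact ⟨a, l, rfl⟩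
  have ha : a ∈ J := hrs a (by simp)
  have hra := ((RingTheory.Sequence.isWeaklyRegular_cons_iff _ _ _).1 hreg).1
  have hV := van_regular (J := J) (a :: l) B hrs hreg htors
  let S : ShortComplex (ModuleCat.{0} R) := ShortComplex.moduleCatMk ι (Submodule.mkQ (LinearMap.range ι)) (by
       ext x
       exact (Submodule.Quotient.mk_eq_zero _).2 ⟨_, rfl⟩)
  have hS : S.ShortExact := 
      { exact := by
          rw [ShortComplex.moduleCat_exact_iff]
          intro x hx
          exact (Submodule.Quotient.mk_eq_zero _).1 hx
        mono_f := (ModuleCat.mono_iff_injective _).2 hι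
        epi_g := (ModuleCat.epi_iff_surjective _).2 (Submodule.mkQ_surjective _) }
  refine ⟨fun p hp1 hp2 => ?_, ?_⟩
  · cases p with
    | zero =>
      refine van0 (N := ModuleCat.of R R) ha (fun x y hxy => hι (hra ?_))
      change a • ι x = a • ι y
      rw [← map_smul, ← map_smul]; exact congrArg ι hxy
    | succ q =>
      cases q with
      | zero => simp at hp1
      | succ q => exact van_succ_of S hS (van_tors q _ hC) (hV _ hp2)
  · exact h1_equiv S hS hC ha hra (hV 1 (by omega))

end LC
end

section
set_option maxHeartbeats 1000000
set_option synthInstance.maxHeartbeats 400000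
open MvPolynomial IsLocalRing

namespace Core

theorem isInt_map {S S' : Type*} [CommRing S] [CommRing S'] (φ : S →+* S') (D : Subring S) (D' : Subring S')
    (h : ∀ d ∈ D, φ d ∈ D') {s : S} (hs : IsIntegral D s) : IsIntegral D' (φ s) := by
  obtain ⟨p, hp, hps⟩ := hs
  let ψ : D →+* D' := (φ.comp D.subtype).codRestrict D' (fun d => h d d.2)
  refine ⟨p.map ψ, hp.map _, ?_⟩
  have : (algebraMap D' S').comp ψ = φ.comp (algebraMap D S) := rfl
  rw [Polynomial.eval₂_map, this, ← Polynomial.hom_eval₂, hps, map_zero]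

theorem isInt_mono {S : Type*} [CommRing S] {D D' : Subring S} (h : D ≤ D') {s : S} (hs : IsIntegral D s) :
    IsIntegral D' s := isInt_map (RingHom.id S) D D' (fun _ hd => h hd) hs

theorem isInt_self {S : Type*} [CommRing S] {D : Subring S} {s : S} (hs : s ∈ D) : IsIntegral D s :=
  isIntegral_algebraMap (x := (⟨s, hs⟩ : D))

theorem isInt_comap {S S' : Type*} [CommRing S] [CommRing S'] (φ : S →+* S') (hφ : Function.Injective φ) (D : Subring S)
    {s : S} (hs : IsIntegral (D.map φ) (φ s)) : IsIntegral D s := by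
  obtain ⟨p, hp, hps⟩ := hs
  let e := D.equivMapOfInjective φ hφ
  refine ⟨p.map e.symm.toRingHom, hp.map _, hφ ?_⟩
  rw [Polynomial.eval₂_map, map_zero, Polynomial.hom_eval₂]
  rw [← hps]
  congr 1
  ext x
  change φ (e.symm x) = x
  conv_rhs => rw [← e.apply_symm_apply x]
  rfl

/-- valuation criterion -/
theorem isInt_two {S : Type*} [CommRing S] [IsDomain S] (D D₁ D₂ : Subring S)
    (t : FractionRing S)
    (h1 : ∀ V : ValuationSubring (FractionRing S), (∀ d ∈ D, algebraMap S (FractionRing S) d ∈ V) → t ∈ V →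
       ∀ d ∈ D₁, algebraMap S (FractionRing S) d ∈ V)
    (h2 : ∀ V : ValuationSubring (FractionRing S), (∀ d ∈ D, algebraMap S (FractionRing S) d ∈ V) → t⁻¹ ∈ V →
       ∀ d ∈ D₂, algebraMap S (FractionRing S) d ∈ V)
    {s : S} (hs1 : IsIntegral D₁ s) (hs2 : IsIntegral D₂ s) : IsIntegral D s := by
  have key : ∀ V : ValuationSubring (FractionRing S), (∀ d ∈ D, algebraMap S (FractionRing S) d ∈ V) →
      algebraMap S (FractionRing S) s ∈ V := by
    have aux : ∀ (V : ValuationSubring (FractionRing S)) (D₁ : Subring S),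
        (∀ d ∈ D₁, algebraMap S (FractionRing S) d ∈ V) → IsIntegral D₁ s → algebraMap S (FractionRing S) s ∈ V := by
      intro V D₁ h hs
      have := isInt_map (algebraMap S (FractionRing S)) D₁ V.toSubring h hs
      have h3 : IsIntegral V (algebraMap S (FractionRing S) s) := this
      obtain ⟨y, hy⟩ := IsIntegrallyClosed.isIntegral_iff.1 h3
      rw [← hy]; exact y.2
    intro V hV
    rcases V.mem_or_inv_mem t with h | h
    · exact aux V D₁ (h1 V hV h) hs1
    · exact aux V D₂ (h2 V hV h) hs2
  have h3 := iInf_valuationSubring_superset (s := (D.map (algebraMap S (FractionRing S)) : Set (FractionRing S)))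
  have h4 : algebraMap S (FractionRing S) s ∈ ⨅ R : {R : ValuationSubring (FractionRing S) //
      (D.map (algebraMap S (FractionRing S)) : Set (FractionRing S)) ⊆ R.toSubring}, R.1.toSubring := by
    rw [Subring.mem_iInf]
    rintro ⟨V, hV⟩
    exact key V (fun d hd => hV ⟨d, hd, rfl⟩)
  rw [h3] at h4
  refine isInt_comap (algebraMap S (FractionRing S)) (IsFractionRing.injective _ _) D ?_
  have h5 : IsIntegral (Subring.closure (D.map (algebraMap S (FractionRing S)) : Set (FractionRing S)))
    (algebraMap S (FractionRing S) s) := h4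
  exact isInt_mono (by rw [Subring.closure_eq]) h5

end Core
end

section
set_option maxHeartbeats 1000000
set_option synthInstance.maxHeartbeats 400000
open MvPolynomial IsLocalRing

namespace Core

variable {K : Type} [Field K] {n r : ℕ}

noncomputable def CR (R : Subring K) (n : ℕ) : Subring (MvPolynomial (Fin n) K) := (MvPolynomial.map (σ := Fin n) R.subtype).range

theorem mem_CR {R : Subring K} {G : MvPolynomial (Fin n) K} : G ∈ CR R n ↔ ∀ m, coeff m G ∈ R := by
  change G ∈ Set.range (MvPolynomial.map R.subtype) ↔ _
  rw [MvPolynomial.mem_range_map_iff_coeffs_subset]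
  constructor
  · intro h m
    by_cases h0 : coeff m G = 0
    · rw [h0]; exact R.zero_mem
    · have := h (MvPolynomial.coeff_mem_coeffs _ h0)
      simpa using this
  · intro h a ha
    obtain ⟨m, _, rfl⟩ := MvPolynomial.mem_coeffs_iff.1 ha
    simpa using h m

theorem CR_mono {R R' : Subring K} (h : R ≤ R') : CR R n ≤ CR R' n := fun G hG => mem_CR.2 fun m => h (mem_CR.1 hG m)

theorem C_mem_CR {R : Subring K} {a : K} : (C a : MvPolynomial (Fin n) K) ∈ CR R n ↔ a ∈ R := by
  rw [mem_CR]
  constructor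
  · intro h; simpa using h 0
  · intro h m
    rw [coeff_C]; split_ifs
    · exact h
    · exact R.zero_mem

theorem X_mem_CR {R : Subring K} (j : Fin n) : (X j : MvPolynomial (Fin n) K) ∈ CR R n := by
  rw [mem_CR]; intro m
  rw [coeff_X]; split_ifs
  · exact R.one_mem
  · exact R.zero_mem

theorem CR_ind {R : Subring K} (T : Subring (MvPolynomial (Fin n) K)) (hC : ∀ a ∈ R, C a ∈ T) (hX : ∀ j, X j ∈ T) :
    CR R n ≤ T := by
  rintro _ ⟨p, rfl⟩
  induction p using MvPolynomial.induction_on with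
  | C a => simpa using hC a a.2
  | add p q hp hq => rw [map_add]; exact T.add_mem hp hq
  | mul_X p i hp => rw [map_mul]; exact T.mul_mem hp (by simpa using hX i)

theorem emb_mem_CR {R : Subring K} {c : Fin n → K} (h : ∀ j, c j ∈ R) : emb K n c ∈ CR R n := by
  simp only [emb, Fintype.linearCombination_apply, smul_eq_C_mul]
  exact Subring.sum_mem _ fun j _ => Subring.mul_mem _ (C_mem_CR.2 (h j)) (X_mem_CR j)

noncomputable def ev (u : Fin n → Fin r → K) : MvPolynomial (Fin n) K →ₐ[K] MvPolynomial (Fin r) K :=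
  aeval (fun j => emb K r (u j))

@[simp] theorem ev_X (u : Fin n → Fin r → K) (j) : ev u (X j) = emb K r (u j) := by simp [ev]
@[simp] theorem ev_C (u : Fin n → Fin r → K) (a) : ev u (C a) = C a := by simp [ev]

noncomputable def DD (u : Fin n → Fin r → K) (R : Subring K) : Subring (MvPolynomial (Fin r) K) :=
  (CR R n).map (ev u : MvPolynomial (Fin n) K →+* MvPolynomial (Fin r) K)

theorem mem_DD {u : Fin n → Fin r → K} {R : Subring K} {s} : s ∈ DD u R ↔ ∃ G ∈ CR R n, ev u G = s := by
  simp [DD, Subring.mem_map]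

theorem DD_mono {u : Fin n → Fin r → K} {R R' : Subring K} (h : R ≤ R') : DD u R ≤ DD u R' := by
  intro s hs
  obtain ⟨G, hG, rfl⟩ := mem_DD.1 hs
  exact mem_DD.2 ⟨G, CR_mono h hG, rfl⟩

def B1 (u : Fin n → Fin r → K) (R : Subring K) (w : Fin r → K) : Prop := IsIntegral (DD u R) (emb K r w)

def VB (u : Fin n → Fin r → K) (R : Subring K) (v : Fin r → MvPolynomial (Fin n) K) : Prop :=
  ∀ m, B1 u R (fun i => coeff m (v i))

noncomputable def Ev (u : Fin n → Fin r → K) (v : Fin r → MvPolynomial (Fin n) K) : MvPolynomial (Fin r) K :=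
  ∑ i, ev u (v i) * X i

def Surj (u : Fin n → Fin r → K) (R : Subring K) : Prop :=
  ∀ s, IsIntegral (DD u R) s → ∃ G ∈ CR R n, ∃ v, VB u R v ∧ s = ev u G + Ev u v

structure Rel (u : Fin n → Fin r → K) (c : Fin n → K) : Prop where
  ne : c ≠ 0
  rel : ∑ j, c j • u j = 0
  ker : ∀ v : Fin n → K, ∑ j, v j • u j = 0 → ∃ μ : K, v = μ • c
  span : ∀ w, ∃ v : Fin n → K, ∑ j, v j • u j = w

theorem B1_add {u : Fin n → Fin r → K} {R : Subring K} {w w' : Fin r → K} (h : B1 u R w) (h' : B1 u R w') :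
    B1 u R (w + w') := by
  unfold B1 at *; rw [map_add]; exact h.add h'

theorem B1_zero {u : Fin n → Fin r → K} {R : Subring K} : B1 u R 0 := by
  unfold B1 at *; rw [map_zero]; exact isIntegral_zero

theorem B1_smul {u : Fin n → Fin r → K} {R : Subring K} {w : Fin r → K} {a : K} (ha : a ∈ R) (h : B1 u R w) :
    B1 u R (a • w) := by
  unfold B1 at *; rw [map_smul, smul_eq_C_mul]
  exact (isInt_self (mem_DD.2 ⟨C a, C_mem_CR.2 ha, by simp⟩)).mul h

theorem B1_u {u : Fin n → Fin r → K} {R : Subring K} (j) : B1 u R (u j) := 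
  isInt_self (mem_DD.2 ⟨X j, X_mem_CR j, by simp⟩)

theorem B1_sum {u : Fin n → Fin r → K} {R : Subring K} {ι : Type*} (s : Finset ι) (f : ι → Fin r → K)
    (h : ∀ i ∈ s, B1 u R (f i)) : B1 u R (∑ i ∈ s, f i) := by
  classical
  induction s using Finset.induction_on with
  | empty => simpa using B1_zero
  | insert a s ha ih =>
    rw [Finset.sum_insert ha]
    exact B1_add (h _ (by simp)) (ih (fun i hi => h i (by simp [hi])))

theorem B1_mono {u : Fin n → Fin r → K} {R R' : Subring K} (hR : R ≤ R') {w} (h : B1 u R w) : B1 u R' w :=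
  isInt_mono (DD_mono hR) h

theorem VB_add {u : Fin n → Fin r → K} {R : Subring K} {w w' : Fin r → MvPolynomial (Fin n) K} (h : VB u R w) (h' : VB u R w') :
    VB u R (w + w') := by
  intro m
  convert B1_add (h m) (h' m) using 1
  ext i; simp

theorem VB_zero {u : Fin n → Fin r → K} {R : Subring K} : VB u R 0 := by
  intro m
  convert B1_zero using 1
  ext i; simp

theorem VB_mono {u : Fin n → Fin r → K} {R R' : Subring K} (hR : R ≤ R') {w} (h : VB u R w) : VB u R' w :=
  fun m => B1_mono hR (h m)

/-- combination of the `u j`. -/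
noncomputable def comb (u : Fin n → Fin r → K) (p : Fin n → MvPolynomial (Fin n) K) : Fin r → MvPolynomial (Fin n) K :=
  fun i => ∑ j, p j * C (u j i)

theorem coeff_comb (u : Fin n → Fin r → K) (p) (m) :
    (fun i => coeff m (comb u p i)) = ∑ j, coeff m (p j) • u j := by
  ext i
  simp [comb, coeff_sum, mul_comm _ (C _), mul_comm (coeff _ _)]

theorem VB_comb {u : Fin n → Fin r → K} {R : Subring K} {p : Fin n → MvPolynomial (Fin n) K} (h : ∀ j, p j ∈ CR R n) :
    VB u R (comb u p) := by
  intro m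
  rw [coeff_comb]
  exact B1_sum _ _ fun j _ => B1_smul (mem_CR.1 (h j) m) (B1_u j)

theorem VB_smul {u : Fin n → Fin r → K} {R : Subring K} {w : Fin r → MvPolynomial (Fin n) K} {a : K} (ha : a ∈ R) (h : VB u R w) :
    VB u R (fun i => C a * w i) := by
  intro m
  convert B1_smul ha (h m) using 1
  ext i; simp

theorem Ev_comb (u : Fin n → Fin r → K) (p) : Ev u (comb u p) = ev u (∑ j, p j * X j) := by
  simp only [Ev, comb, map_sum, map_mul, ev_X, ev_C, Finset.sum_mul]
  rw [Finset.sum_comm]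
  refine Finset.sum_congr rfl fun j _ => ?_
  simp only [emb, Fintype.linearCombination_apply, smul_eq_C_mul, Finset.mul_sum]
  exact Finset.sum_congr rfl fun i _ => by ring

theorem Ev_add (u : Fin n → Fin r → K) (v w) : Ev u (v + w) = Ev u v + Ev u w := by
  simp [Ev, add_mul, Finset.sum_add_distrib]

theorem Ev_smul (u : Fin n → Fin r → K) (v) (a : K) : Ev u (fun i => C a * v i) = C a * Ev u v := by
  simp [Ev, mul_assoc, Finset.mul_sum]

theorem Ev_sub (u : Fin n → Fin r → K) (v w) : Ev u (v - w) = Ev u v - Ev u w := by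
  simp [Ev, sub_mul, Finset.sum_sub_distrib]

theorem comb_sub (u : Fin n → Fin r → K) (v w) : comb u (v - w) = comb u v - comb u w := by
  ext1 i; simp [comb, sub_mul, Finset.sum_sub_distrib]

theorem emb_comb (u : Fin n → Fin r → K) (c : Fin n → K) : ev u (emb K n c) = emb K r (∑ j, c j • u j) := by
  rw [map_sum]
  conv_lhs => rw [emb, Fintype.linearCombination_apply]
  rw [map_sum]
  refine Finset.sum_congr rfl fun j _ => ?_
  rw [map_smul, map_smul, ev_X]

theorem emb_inj {w w' : Fin r → K} (h : emb K r w = emb K r w') : w = w' := by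
  ext i
  have := congrArg (coeff (Finsupp.single i 1)) h
  simpa [emb, Fintype.linearCombination_apply, coeff_sum, coeff_X, Finsupp.single_left_inj] using this

variable {u : Fin n → Fin r → K} {c : Fin n → K}

theorem Rel.ev_f (hc : Rel u c) : ev u (emb K n c) = 0 := by rw [emb_comb, hc.rel, map_zero]

theorem Rel.section_k (hc : Rel u c) (k : Fin n) (hk : c k ≠ 0) :
    ∃ σ : (Fin r → K) →ₗ[K] (Fin n → K), (∀ w, ∑ j, σ w j • u j = w) ∧ (∀ w, σ w k = 0) ∧
      ∀ j, σ (u j) = Pi.single j 1 - ((if j = k then 1 else 0) / c k : K) • c := by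
  let Φ : (Fin n → K) →ₗ[K] (Fin r → K) := Fintype.linearCombination K u
  have hΦ : ∀ v, Φ v = ∑ j, v j • u j := fun v => Fintype.linearCombination_apply K u v
  obtain ⟨τ, hτ⟩ := Φ.exists_rightInverse_of_surjective (LinearMap.range_eq_top.2 fun w => by
    obtain ⟨v, hv⟩ := hc.span w
    exact ⟨v, by rw [hΦ, hv]⟩)
  let σ : (Fin r → K) →ₗ[K] (Fin n → K) := τ - (((c k)⁻¹ • (LinearMap.proj k ∘ₗ τ)).smulRight c)
  have h1 : ∀ w, σ w = τ w - ((c k)⁻¹ * τ w k) • c := fun w => rfl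
  have hΦc : Φ c = 0 := by rw [hΦ, hc.rel]
  have h2 : ∀ w, Φ (σ w) = w := fun w => by
    rw [h1, map_sub, map_smul, hΦc, smul_zero, sub_zero]
    exact LinearMap.congr_fun hτ w
  have h3 : ∀ w, σ w k = 0 := fun w => by
    rw [h1]; simp; field_simp; simp
  refine ⟨σ, fun w => by rw [← hΦ, h2], h3, fun j => ?_⟩
  obtain ⟨μ, hμ⟩ := hc.ker (σ (u j) - Pi.single j 1) (by
    rw [← hΦ, map_sub, h2, hΦ]; simp [Pi.single_apply])
  have h4 := congrFun hμ k
  simp only [Pi.sub_apply, h3, Pi.smul_apply, smul_eq_mul, zero_sub, Pi.single_apply] at h4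
  have h5 : μ = - ((if j = k then 1 else 0) / c k : K) := by
    rw [eq_comm] at h4
    rw [← neg_div, eq_div_iff hk, h4]; simp [eq_comm]
  rw [h5, neg_smul] at hμ
  rw [sub_eq_iff_eq_add] at hμ
  rw [hμ]; abel

/-- retraction -/
noncomputable def ret (σ : (Fin r → K) →ₗ[K] (Fin n → K)) : MvPolynomial (Fin r) K →ₐ[K] MvPolynomial (Fin n) K :=
  aeval (fun i => emb K n (σ (Pi.single i 1)))

theorem ret_emb (σ : (Fin r → K) →ₗ[K] (Fin n → K)) (w) : ret σ (emb K r w) = emb K n (σ w) := by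
  conv_lhs => rw [emb, Fintype.linearCombination_apply]
  conv_rhs => rw [← LinearMap.sum_single_apply (φ := fun _ => K) w]
  rw [map_sum, map_sum, map_sum]
  refine Finset.sum_congr rfl fun i _ => ?_
  rw [map_smul, ret, aeval_X, ← map_smul, ← map_smul]
  congr 2
  ext j
  simp [Pi.single_apply]

theorem ev_ret {σ : (Fin r → K) →ₗ[K] (Fin n → K)} (h : ∀ w, ∑ j, σ w j • u j = w) (q) : ev u (ret σ q) = q := by
  have : (ev u).comp (ret σ) = AlgHom.id K _ := by
    ext1 i
    rw [AlgHom.comp_apply, ret, aeval_X, emb_comb, h]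
    simp [emb, Fintype.linearCombination_apply, Pi.single_apply]
  exact AlgHom.congr_fun this q

theorem Rel.ker_ev (hc : Rel u c) {G : MvPolynomial (Fin n) K} (hG : ev u G = 0) : ∃ p, G = emb K n c * p := by
  obtain ⟨k, hk⟩ : ∃ k, c k ≠ 0 := by
    by_contra! h; exact hc.ne (funext h)
  obtain ⟨σ, h1, h2, h3⟩ := hc.section_k k hk
  let I := Ideal.span {emb K n c}
  have : (Ideal.Quotient.mkₐ K I).comp ((ret σ).comp (ev u)) = Ideal.Quotient.mkₐ K I := by
    ext1 j
    rw [AlgHom.comp_apply, AlgHom.comp_apply, ev_X, ret_emb, h3, map_sub, map_sub, map_smul, map_smul]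
    have h4 : Ideal.Quotient.mkₐ K I (emb K n c) = 0 := Ideal.Quotient.eq_zero_iff_mem.2 (Ideal.subset_span rfl)
    rw [h4, smul_zero, sub_zero]
    congr 1
    simp [emb, Fintype.linearCombination_apply, Pi.single_apply]
  have h5 := AlgHom.congr_fun this G
  simp only [AlgHom.comp_apply, hG, map_zero] at h5
  have h6 := Ideal.Quotient.eq_zero_iff_mem.1 h5.symm
  obtain ⟨p, hp⟩ := Ideal.mem_span_singleton'.1 h6
  exact ⟨p, by rw [← hp, mul_comm]⟩

def Normal (R : Subring K) : Prop := ∀ z : K, IsIntegral R z → z ∈ R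

theorem normal_CR {R : Subring K} (hR : Normal R) {G : MvPolynomial (Fin n) K} (hG : IsIntegral (CR R n) G) : G ∈ CR R n := by
  rw [mem_CR]
  intro m
  apply hR
  letI := MvPolynomial.algebraMvPolynomial (R := R) (S := K) (σ := Fin n)
  have h : IsIntegral (MvPolynomial (Fin n) R) G := by
    obtain ⟨p, hp, hpG⟩ := hG
    let e : MvPolynomial (Fin n) R ≃+* CR R n := RingEquiv.ofBijective (MvPolynomial.map (σ := Fin n) R.subtype).rangeRestrict
      ⟨fun a b hab => MvPolynomial.map_injective R.subtype R.subtype_injective (congrArg Subtype.val hab),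
       RingHom.rangeRestrict_surjective _⟩
    refine ⟨p.map e.symm.toRingHom, hp.map _, ?_⟩
    rw [Polynomial.eval₂_map, ← hpG]
    congr 1
    ext1 x
    obtain ⟨y, rfl⟩ := e.surjective x
    change algebraMap (MvPolynomial (Fin n) R) (MvPolynomial (Fin n) K) (e.symm (e y)) = _
    rw [e.symm_apply_apply]
    rfl
  exact MvPolynomial.isIntegral_iff_isIntegral_coeff.1 h m

theorem Rel.base (hc : Rel u c) {R : Subring K} (hR : Normal R) (k : Fin n) (hk : c k ≠ 0) (h : ∀ i, c i / c k ∈ R) :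
    Surj u R := by
  obtain ⟨σ, h1, h2, h3⟩ := hc.section_k k hk
  intro s hs
  have h4 : IsIntegral (CR R n) (ret σ s) := by
    refine isInt_map (ret σ : MvPolynomial (Fin r) K →+* MvPolynomial (Fin n) K) _ _ ?_ hs
    intro d hd
    obtain ⟨G, hG, rfl⟩ := mem_DD.1 hd
    change (((ret σ).comp (ev u) : MvPolynomial (Fin n) K →ₐ[K] MvPolynomial (Fin n) K) : MvPolynomial (Fin n) K →+* MvPolynomial (Fin n) K) G ∈ _
    refine CR_ind ((CR R n).comap _) ?_ ?_ hG
    · intro a ha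
      rw [Subring.mem_comap]
      simpa [ret] using C_mem_CR.2 ha
    · intro j
      rw [Subring.mem_comap]
      change ret σ (ev u (X j)) ∈ _
      rw [ev_X, ret_emb]
      refine emb_mem_CR fun i => ?_
      rw [h3]
      simp only [Pi.sub_apply, Pi.single_apply, Pi.smul_apply, smul_eq_mul]
      refine R.sub_mem (by split_ifs; exacts [R.one_mem, R.zero_mem]) ?_
      split_ifs
      · rw [one_div_mul_eq_div]; exact h i
      · simp
  refine ⟨_, normal_CR hR h4, 0, VB_zero, ?_⟩
  rw [ev_ret h1]; simp [Ev]

end Core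
end

section
set_option maxHeartbeats 1000000
set_option synthInstance.maxHeartbeats 400000
open MvPolynomial IsLocalRing

namespace Core

variable {K : Type} [Field K] {n r : ℕ} {u : Fin n → Fin r → K} {c : Fin n → K}

theorem Rel.delta (hc : Rel u c) {R : Subring K} (hR : Normal R) {g : K}
    (h : ∀ i, c i / g ∈ R) {l : Fin n → K} (hw : B1 u R (∑ j, l j • u j)) (i j : Fin n) :
    (c j * l i - c i * l j) / g ∈ R := by
  obtain ⟨k, hk⟩ : ∃ k, c k ≠ 0 := by
    by_contra! h; exact hc.ne (funext h)
  obtain ⟨σ, h1, h2, h3⟩ := hc.section_k k hk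
  let η : MvPolynomial (Fin n) K →ₐ[K] K := aeval (fun k => (c j * (if k = i then 1 else 0) - c i * (if k = j then 1 else 0)) / g)
  have hη : ∀ l : Fin n → K, η (emb K n l) = (c j * l i - c i * l j) / g := by
    intro l
    simp only [η, emb, Fintype.linearCombination_apply, map_sum, map_smul, aeval_X, smul_eq_mul]
    simp only [mul_div_assoc', mul_sub, ← Finset.sum_div, Finset.sum_sub_distrib]
    simp [mul_comm]
  have hf : η (emb K n c) = 0 := by rw [hη, mul_comm, sub_self, zero_div]
  have hev : ∀ G, η (ret σ (ev u G)) = η G := by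
    intro G
    obtain ⟨p, hp⟩ := hc.ker_ev (G := ret σ (ev u G) - G) (by rw [map_sub, ev_ret h1, sub_self])
    have := congrArg η hp
    rwa [map_sub, map_mul, hf, zero_mul, sub_eq_zero] at this
  apply hR
  rw [← hη, ← hev, emb_comb]
  refine isInt_map ((η.comp (ret σ) : MvPolynomial (Fin r) K →ₐ[K] K) : MvPolynomial (Fin r) K →+* K) (DD u R) R ?_ hw
  intro d hd
  obtain ⟨G, hG, rfl⟩ := mem_DD.1 hd
  change η (ret σ (ev u G)) ∈ R
  rw [hev]
  refine CR_ind (R.comap (η : MvPolynomial (Fin n) K →+* K)) ?_ ?_ hG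
  · intro a ha; rw [Subring.mem_comap]; simpa [η] using ha
  · intro k
    rw [Subring.mem_comap]
    change η (X k) ∈ R
    simp only [η, aeval_X, sub_div]
    refine R.sub_mem ?_ ?_ <;> split_ifs
    · simpa using h j
    · simp
    · simpa using h i
    · simp

theorem Rel.inj (hc : Rel u c) {R : Subring K} (hR : Normal R) {g : K} (hg : g ≠ 0)
    (h : ∀ i, c i / g ∈ R) (hprim : ∀ q, emb K n c * q ∈ CR R n → C g * q ∈ CR R n)
    {v : Fin r → MvPolynomial (Fin n) K} (hv : VB u R v) {G} (hG : G ∈ CR R n) (e : Ev u v = ev u G) :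
    ∃ p : Fin n → MvPolynomial (Fin n) K, (∀ j, p j ∈ CR R n) ∧ v = comb u p := by
  obtain ⟨k, hk⟩ : ∃ k, c k ≠ 0 := by
    by_contra! h; exact hc.ne (funext h)
  obtain ⟨σ, h1, h2, h3⟩ := hc.section_k k hk
  let l : Fin n → MvPolynomial (Fin n) K := fun j => ∑ i, v i * C (σ (Pi.single i 1) j)
  have hl : comb u l = v := by
    ext1 i
    simp only [comb, l, Finset.sum_mul]
    rw [Finset.sum_comm]
    have : ∀ a : Fin r, ∑ j, v a * C (σ (Pi.single a 1) j) * C (u j i) = v a * C ((Pi.single a 1 : Fin r → K) i) := by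
      intro a
      conv_rhs => rw [← h1 (Pi.single a 1)]
      simp [Finset.mul_sum, mul_assoc]
    simp only [this, Pi.single_apply]
    simp
  have hev : ev u ((∑ j, l j * X j) - G) = 0 := by
    rw [map_sub, ← Ev_comb, hl, e, sub_self]
  obtain ⟨p, hp⟩ := hc.ker_ev hev
  refine ⟨fun j => l j - C (c j) * p, fun i => ?_, ?_⟩
  · have h5 : emb K n c * (C g⁻¹ * (l i - C (c i) * p)) ∈ CR R n := by
      have e1 : emb K n c * (C g⁻¹ * (l i - C (c i) * p)) = 
          (∑ j, (C g⁻¹ * (C (c j) * l i - C (c i) * l j)) * X j) + C (c i / g) * G := by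
        have : emb K n c * p = (∑ j, l j * X j) - G := hp.symm
        have e3 : emb K n c * (C g⁻¹ * (l i - C (c i) * p)) = C g⁻¹ * (emb K n c * l i) - C (g⁻¹) * C (c i) * (emb K n c * p) := by ring
        rw [e3, this, div_eq_mul_inv, C_mul]
        simp only [emb, Fintype.linearCombination_apply, smul_eq_C_mul, mul_sub, Finset.mul_sum, Finset.sum_mul, sub_mul,
          Finset.sum_sub_distrib]
        have e4 : ∀ j, C g⁻¹ * (C (c j) * X j * l i) = C g⁻¹ * (C (c j) * l i) * X j := fun j => by ring
        have e5 : ∀ j, C g⁻¹ * C (c i) * (l j * X j) = C g⁻¹ * (C (c i) * l j) * X j := fun j => by ring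
        simp only [e4, e5]; ring
      rw [e1]
      refine Subring.add_mem _ (Subring.sum_mem _ fun j _ => Subring.mul_mem _ ?_ (X_mem_CR j)) (Subring.mul_mem _ (C_mem_CR.2 (h i)) hG)
      rw [mem_CR]
      intro m
      have h6 := hv m
      rw [← hl, coeff_comb] at h6
      have h7 := hc.delta hR h h6 i j
      simpa [div_eq_inv_mul] using h7
    have h8 := hprim _ h5
    rwa [← mul_assoc, ← C_mul, mul_inv_cancel₀ hg, C_1, one_mul] at h8
  · rw [← hl]
    ext1 i
    simp only [comb, sub_mul, Finset.sum_sub_distrib]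
    have : ∑ x, C (c x) * p * C (u x i) = p * C (∑ x, c x * u x i) := by
      simp [Finset.mul_sum]; exact Finset.sum_congr rfl fun x _ => by ring
    have h9 : ∑ x, c x * u x i = 0 := by
      have := congrFun hc.rel i
      simpa using this
    rw [this, h9]; simp

end Core
end

section
set_option maxHeartbeats 1000000
set_option synthInstance.maxHeartbeats 400000
open MvPolynomial IsLocalRing

namespace Core

variable {K : Type} [Field K] {n r : ℕ} {u : Fin n → Fin r → K} {c : Fin n → K}

theorem B1_inter {A A₁ A₂ : Subring K} (t : K)
    (h1 : ∀ T : Subring K, A ≤ T → t ∈ T → A₁ ≤ T) (h2 : ∀ T : Subring K, A ≤ T → t⁻¹ ∈ T → A₂ ≤ T)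
    {w : Fin r → K} (hw1 : B1 u A₁ w) (hw2 : B1 u A₂ w) : B1 u A w := by
  let Q := MvPolynomial (Fin r) K
  let φ : K →+* FractionRing Q := (algebraMap Q (FractionRing Q)).comp C
  have aux : ∀ (t : K) (A₁ : Subring K), (∀ T : Subring K, A ≤ T → t ∈ T → A₁ ≤ T) → 
      ∀ V : ValuationSubring (FractionRing Q), (∀ d ∈ DD u A, algebraMap Q (FractionRing Q) d ∈ V) → φ t ∈ V →
       ∀ d ∈ DD u A₁, algebraMap Q (FractionRing Q) d ∈ V := by
    intro t A₁ h V hV htV d hd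
    obtain ⟨G, hG, rfl⟩ := mem_DD.1 hd
    have h3 : A₁ ≤ V.toSubring.comap φ := by
      apply h _ _ htV
      intro a ha
      rw [Subring.mem_comap]
      exact hV (C a) (mem_DD.2 ⟨C a, C_mem_CR.2 ha, by simp⟩)
    refine CR_ind (V.toSubring.comap ((algebraMap Q (FractionRing Q)).comp (ev u : MvPolynomial (Fin n) K →+* Q))) ?_ ?_ hG
    · intro a ha
      rw [Subring.mem_comap]
      have := h3 ha
      rw [Subring.mem_comap] at this
      simpa [φ] using this
    · intro j
      rw [Subring.mem_comap]
      exact hV _ (mem_DD.2 ⟨X j, X_mem_CR j, rfl⟩)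
  refine isInt_two (DD u A) (DD u A₁) (DD u A₂) (φ t) (aux t A₁ h1) ?_ hw1 hw2
  rw [← map_inv₀]
  exact aux t⁻¹ A₂ h2

theorem CR_split {A₁ A₂ A₁₂ : Subring K} (h : ∀ z ∈ A₁₂, ∃ a ∈ A₁, ∃ b ∈ A₂, z = a - b)
    {G : MvPolynomial (Fin n) K} (hG : G ∈ CR A₁₂ n) : ∃ a ∈ CR A₁ n, ∃ b ∈ CR A₂ n, G = a - b := by
  rw [mem_CR] at hG
  choose a ha b hb hab using fun m => h _ (hG m)
  let a' : MvPolynomial (Fin n) K := ∑ m ∈ G.support, monomial m (a m)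
  let b' : MvPolynomial (Fin n) K := ∑ m ∈ G.support, monomial m (b m)
  refine ⟨a', ?_, b', ?_, ?_⟩
  · rw [mem_CR]; intro m
    simp only [a', coeff_sum]
    refine Subring.sum_mem _ fun k _ => ?_
    rw [coeff_monomial]; split_ifs
    exacts [ha _, Subring.zero_mem _]
  · rw [mem_CR]; intro m
    simp only [b', coeff_sum]
    refine Subring.sum_mem _ fun k _ => ?_
    rw [coeff_monomial]; split_ifs
    exacts [hb _, Subring.zero_mem _]
  · simp only [a', b', ← Finset.sum_sub_distrib, ← map_sub, ← hab]
    exact G.as_sum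

theorem glue (hc : Rel u c) {A A₁ A₂ A₁₂ : Subring K} (hA1 : A₁ ≤ A₁₂) (hA2 : A₂ ≤ A₁₂)
    (hsplit : ∀ z ∈ A₁₂, ∃ a ∈ A₁, ∃ b ∈ A₂, z = a - b) (hinter : ∀ z ∈ A₁, z ∈ A₂ → z ∈ A)
    (h01 : A ≤ A₁) (h02 : A ≤ A₂)
    (hB : ∀ w, B1 u A₁ w → B1 u A₂ w → B1 u A w) (hS1 : Surj u A₁) (hS2 : Surj u A₂)
    (hN : Normal A₁₂) {g : K} (hg : g ≠ 0) (h : ∀ i, c i / g ∈ A₁₂)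
    (hprim : ∀ q, emb K n c * q ∈ CR A₁₂ n → C g * q ∈ CR A₁₂ n) : Surj u A := by
  have VBsub : ∀ (R : Subring K) v w, VB u R v → VB u R w → VB u R (v - w) := by
    intro R v w hv hw
    have := VB_add hv (VB_smul (R.neg_mem R.one_mem) hw)
    convert this using 1
    ext1 i; simp [sub_eq_add_neg]
  have hVB : ∀ w, VB u A₁ w → VB u A₂ w → VB u A w := fun w a b m => hB _ (a m) (b m)
  intro s hs
  obtain ⟨G1, hG1, v1, hv1, e1⟩ := hS1 s (isInt_mono (DD_mono h01) hs)
  obtain ⟨G2, hG2, v2, hv2, e2⟩ := hS2 s (isInt_mono (DD_mono h02) hs)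
  obtain ⟨p, hp, hvp⟩ := hc.inj hN hg h hprim (v := v1 - v2) (G := G2 - G1)
    (VBsub _ _ _ (VB_mono hA1 hv1) (VB_mono hA2 hv2)) (Subring.sub_mem _ (CR_mono hA2 hG2) (CR_mono hA1 hG1))
    (by rw [Ev_sub, map_sub, sub_eq_sub_iff_add_eq_add, add_comm, ← e1, e2, add_comm])
  choose p1 hp1 p2 hp2 hpp using fun j => CR_split hsplit (hp j)
  have hpp' : p = p1 - p2 := funext hpp
  let z := v1 - comb u p1
  have hz : z = v2 - comb u p2 := by
    have : v1 - v2 = comb u p1 - comb u p2 := by rw [hvp, hpp', comb_sub]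
    simp only [z]
    rw [sub_eq_sub_iff_add_eq_add] at this ⊢
    rw [this, add_comm]
  have hzA : VB u A z := hVB z (VBsub _ _ _ hv1 (VB_comb hp1)) (hz ▸ VBsub _ _ _ hv2 (VB_comb hp2))
  let H1 := G1 + ∑ j, p1 j * X j
  let H2 := G2 + ∑ j, p2 j * X j
  have hH1 : H1 ∈ CR A₁ n := Subring.add_mem _ hG1 (Subring.sum_mem _ fun j _ => Subring.mul_mem _ (hp1 j) (X_mem_CR j))
  have hH2 : H2 ∈ CR A₂ n := Subring.add_mem _ hG2 (Subring.sum_mem _ fun j _ => Subring.mul_mem _ (hp2 j) (X_mem_CR j))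
  have es1 : s = ev u H1 + Ev u z := by
    simp only [H1, z, map_add, Ev_sub, Ev_comb, e1]; ring
  have es2 : s = ev u H2 + Ev u z := by
    rw [hz]; simp only [H2, map_add, Ev_sub, Ev_comb, e2]; ring
  obtain ⟨q, hq⟩ := hc.ker_ev (G := H1 - H2) (by
    rw [map_sub, sub_eq_zero]; rw [es1] at es2; exact add_right_cancel es2)
  have hgq := hprim q (hq ▸ Subring.sub_mem _ (CR_mono hA1 hH1) (CR_mono hA2 hH2))
  have hcq : ∀ j, C (c j) * q ∈ CR A₁₂ n := by
    intro j
    have := Subring.mul_mem _ (C_mem_CR.2 (h j)) hgq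
    rwa [← mul_assoc, ← C_mul, div_mul_cancel₀ _ hg] at this
  choose l1 hl1 l2 hl2 hll using fun j => CR_split hsplit (hcq j)
  have eG : H1 - ∑ j, l1 j * X j = H2 - ∑ j, l2 j * X j := by
    have e5 : emb K n c * q = (∑ j, l1 j * X j) - ∑ j, l2 j * X j := by
      rw [← Finset.sum_sub_distrib]
      simp only [← sub_mul, ← hll]
      simp only [emb, Fintype.linearCombination_apply, smul_eq_C_mul, Finset.sum_mul]
      exact Finset.sum_congr rfl fun j _ => by ring
    rw [e5] at hq
    rw [sub_eq_sub_iff_add_eq_add] at hq ⊢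
    rw [hq, add_comm]
  have ew : comb u l1 = comb u l2 := by
    rw [← sub_eq_zero, ← comb_sub]
    ext1 i
    have h9 : ∑ x, c x * u x i = 0 := by
      have := congrFun hc.rel i
      simpa using this
    have : ∑ x, C (c x) * q * C (u x i) = q * C (∑ x, c x * u x i) := by
      simp [Finset.mul_sum]; exact Finset.sum_congr rfl fun x _ => by ring
    simp only [comb, Pi.sub_apply, ← hll, this, h9]; simp
  refine ⟨H1 - ∑ j, l1 j * X j, ?_, z + comb u l1, VB_add hzA (hVB _ (VB_comb hl1) (ew ▸ VB_comb hl2)), ?_⟩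
  · have a1 : H1 - ∑ j, l1 j * X j ∈ CR A₁ n :=
      Subring.sub_mem _ hH1 (Subring.sum_mem _ fun j _ => Subring.mul_mem _ (hl1 j) (X_mem_CR j))
    have a2 : H1 - ∑ j, l1 j * X j ∈ CR A₂ n := eG ▸
      Subring.sub_mem _ hH2 (Subring.sum_mem _ fun j _ => Subring.mul_mem _ (hl2 j) (X_mem_CR j))
    rw [mem_CR] at a1 a2 ⊢
    exact fun m => hinter _ (a1 m) (a2 m)
  · rw [Ev_add, Ev_comb, map_sub, es1]; ring

end Core
end

section
set_option maxHeartbeats 1000000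
set_option synthInstance.maxHeartbeats 400000
open MvPolynomial IsLocalRing

namespace Core

variable {K : Type} [Field K] {n r : ℕ} {u : Fin n → Fin r → K} {c : Fin n → K}

noncomputable abbrev Loc (R : Subring K) (P : Ideal R) [P.IsPrime] : Subring K := (LocalSubring.ofPrime R P).toSubring

theorem mem_Loc {R : Subring K} {P : Ideal R} [P.IsPrime] {z : K} :
    z ∈ Loc R P ↔ ∃ s : R, s ∉ P ∧ (s : K) * z ∈ R := by
  constructor
  · intro hz
    obtain ⟨⟨a, s⟩, h⟩ := IsLocalization.surj P.primeCompl (⟨z, hz⟩ : Loc R P)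
    refine ⟨s, s.2, ?_⟩
    have h2 := congrArg Subtype.val h
    have h3 : z * (s : R) = (a : K) := h2
    rw [mul_comm, h3]; exact a.2
  · rintro ⟨s, hs, h⟩
    have h1 := IsLocalization.map_units (Loc R P) (⟨s, hs⟩ : P.primeCompl)
    obtain ⟨v, hv⟩ := h1.exists_right_inv
    have h2 : (s : K) * v = 1 := congrArg Subtype.val hv
    have : z = v * (s * z) := by
      rw [← mul_assoc, mul_comm (v : K), h2, one_mul]
    rw [this]
    exact Subring.mul_mem _ v.2 (LocalSubring.le_ofPrime R P h)

theorem le_Loc (R : Subring K) (P : Ideal R) [P.IsPrime] : R ≤ Loc R P := LocalSubring.le_ofPrime R P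

/-- finite simultaneous clearing -/
theorem clear_fin {R : Subring K} {P : Ideal R} [P.IsPrime] {ι : Type*} (F : Finset ι) (prop : ι → K → Prop)
    (hm : ∀ i ∈ F, ∀ s : K, ∀ a ∈ R, prop i s → prop i (a * s))
    (h : ∀ i ∈ F, ∃ s : R, s ∉ P ∧ prop i s) : ∃ s : R, s ∉ P ∧ ∀ i ∈ F, prop i s := by
  classical
  choose! s hs hp using h
  refine ⟨∏ i ∈ F, s i, fun hmem => ?_, fun i hi => ?_⟩
  · obtain ⟨i, hi, h⟩ := Ideal.IsPrime.prod_mem_iff.1 hmem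
    exact hs i hi h
  · rw [← Finset.prod_erase_mul _ _ hi]
    push_cast
    exact hm i hi _ _ (by exact_mod_cast (∏ x ∈ F.erase i, s x).2) (hp i hi)

theorem clear_CR {R : Subring K} {P : Ideal R} [P.IsPrime] {G : MvPolynomial (Fin n) K} (hG : G ∈ CR (Loc R P) n) :
    ∃ s : R, s ∉ P ∧ C (s : K) * G ∈ CR R n := by
  rw [mem_CR] at hG
  obtain ⟨s, hs, h⟩ := clear_fin (P := P) G.support (fun m s => s * coeff m G ∈ R)
    (fun m _ s a ha h => by rw [mul_assoc]; exact R.mul_mem ha h) (fun m _ => mem_Loc.1 (hG m))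
  refine ⟨s, hs, mem_CR.2 fun m => ?_⟩
  rw [coeff_C_mul]
  by_cases hm : m ∈ G.support
  · exact h m hm
  · rw [notMem_support_iff.1 hm, mul_zero]; exact R.zero_mem

theorem clear_DD {R : Subring K} {P : Ideal R} [P.IsPrime] {d} (hd : d ∈ DD u (Loc R P)) :
    ∃ s : R, s ∉ P ∧ C (s : K) * d ∈ DD u R := by
  obtain ⟨G, hG, rfl⟩ := mem_DD.1 hd
  obtain ⟨s, hs, h⟩ := clear_CR hG
  exact ⟨s, hs, mem_DD.2 ⟨_, h, by simp⟩⟩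

theorem C_mem_DD {R : Subring K} {a : K} (ha : a ∈ R) : C a ∈ DD u R := mem_DD.2 ⟨C a, C_mem_CR.2 ha, by simp⟩

theorem clear_int {R : Subring K} {P : Ideal R} [P.IsPrime] {x : MvPolynomial (Fin r) K} (hx : IsIntegral (DD u (Loc R P)) x) :
    ∃ s : R, s ∉ P ∧ IsIntegral (DD u R) (C (s : K) * x) := by
  obtain ⟨p, hp, hpx⟩ := hx
  obtain ⟨s, hs, h⟩ := clear_fin (P := P) p.support (fun m s => C s * (p.coeff m : MvPolynomial (Fin r) K) ∈ DD u R)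
    (fun m _ s a ha h => by rw [C_mul, mul_assoc]; exact Subring.mul_mem _ (C_mem_DD ha) h) (fun m _ => clear_DD (p.coeff m).2)
  refine ⟨s, hs, ?_⟩
  let q := (p.map (DD u (Loc R P)).subtype).scaleRoots (C (s : K))
  have hq : q.Monic := (Polynomial.monic_scaleRoots_iff _).2 (hp.map _)
  have hq0 : Polynomial.eval (C (s : K) * x) q = 0 := by
    have h0 : Polynomial.eval x (p.map (DD u (Loc R P)).subtype) = 0 := by
      rw [Polynomial.eval_map]; exact hpx
    have := Polynomial.scaleRoots_eval₂_eq_zero (RingHom.id _) (s := C (s : K)) (p := p.map (DD u (Loc R P)).subtype) (r := x) h0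
    exact this
  have hco : ↑q.coeffs ⊆ (DD u R : Set (MvPolynomial (Fin r) K)) := by
    intro a ha
    obtain ⟨m, hm, rfl⟩ := Polynomial.mem_coeffs_iff.1 ha
    have hm' : m ≤ q.natDegree := Polynomial.le_natDegree_of_mem_supp _ hm
    rcases hm'.eq_or_lt with h1 | h1
    · rw [h1, Polynomial.coeff_natDegree, hq]; exact Subring.one_mem _
    · simp only [q, Polynomial.coeff_scaleRoots, Polynomial.natDegree_scaleRoots, Polynomial.coeff_map] at h1 ⊢
      obtain ⟨k, hk⟩ := Nat.exists_eq_add_of_lt h1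
      rw [hk, show m + k + 1 - m = k + 1 by omega, pow_succ, mul_comm, mul_assoc]
      refine Subring.mul_mem _ (by rw [← map_pow]; exact C_mem_DD (R.pow_mem s.2 _)) ?_
      by_cases hms : m ∈ p.support
      · exact h m hms
      · rw [Polynomial.notMem_support_iff.1 hms]; simp
  refine ⟨q.toSubring (DD u R) hco, ?_, ?_⟩
  · rwa [Polynomial.monic_toSubring]
  · have : (q.toSubring (DD u R) hco).map (DD u R).subtype = q := Polynomial.map_toSubring _ _ _
    rw [← this, Polynomial.eval_map] at hq0
    exact hq0

theorem B1_clear {R : Subring K} {P : Ideal R} [P.IsPrime] {w} (hw : B1 u (Loc R P) w) :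
    ∃ s : R, s ∉ P ∧ B1 u R ((s : K) • w) := by
  obtain ⟨s, hs, h⟩ := clear_int hw
  exact ⟨s, hs, by unfold B1; rwa [map_smul, smul_eq_C_mul]⟩

theorem VB_clear {R : Subring K} {P : Ideal R} [P.IsPrime] {v} (hv : VB u (Loc R P) v) :
    ∃ s : R, s ∉ P ∧ VB u R (fun i => C (s : K) * v i) := by
  classical
  obtain ⟨s, hs, h⟩ := clear_fin (P := P) (Finset.univ.biUnion fun i => (v i).support)
    (fun m s => B1 u R (s • (fun i => coeff m (v i))))
    (fun m _ s a ha h => by rw [mul_smul]; exact B1_smul ha h) (fun m _ => B1_clear (hv m))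
  refine ⟨s, hs, fun m => ?_⟩
  have e : (fun i => coeff m (C (s : K) * v i)) = (s : K) • (fun i => coeff m (v i)) := by
    ext i; simp
  rw [e]
  by_cases hm : m ∈ Finset.univ.biUnion fun i => (v i).support
  · exact h m hm
  · have : (fun i => coeff m (v i)) = 0 := by
      ext i
      simp only [Finset.mem_biUnion, Finset.mem_univ, true_and, not_exists] at hm
      exact notMem_support_iff.1 (hm i)
    rw [this, smul_zero]; exact B1_zero

theorem loc_glob {R : Subring K} (h : ∀ (P : Ideal R) [P.IsMaximal], Surj u (Loc R P)) : Surj u R := by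
  intro s hs
  let I : Ideal R :=
    { carrier := {a | ∃ G ∈ CR R n, ∃ v, VB u R v ∧ C (a : K) * s = ev u G + Ev u v}
      add_mem' := by
        rintro a b ⟨G, hG, v, hv, e⟩ ⟨G', hG', v', hv', e'⟩
        refine ⟨G + G', Subring.add_mem _ hG hG', v + v', VB_add hv hv', ?_⟩
        push_cast
        rw [C_add, add_mul, e, e', map_add, Ev_add]; ring
      zero_mem' := ⟨0, Subring.zero_mem _, 0, VB_zero, by simp [Ev]⟩
      smul_mem' := by
        rintro a b ⟨G, hG, v, hv, e⟩
        refine ⟨C (a : K) * G, Subring.mul_mem _ (C_mem_CR.2 a.2) hG, _, VB_smul a.2 hv, ?_⟩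
        rw [Ev_smul, smul_eq_mul]
        push_cast
        rw [C_mul, mul_assoc, e, map_mul, ev_C]; ring }
  have hI : I = ⊤ := by
    by_contra hI
    obtain ⟨P, hP, hIP⟩ := Ideal.exists_le_maximal I hI
    obtain ⟨G, hG, v, hv, e⟩ := h P s (isInt_mono (DD_mono (le_Loc R P)) hs)
    obtain ⟨a, ha, hG'⟩ := clear_CR hG
    obtain ⟨b, hb, hv'⟩ := VB_clear hv
    have : a * b ∈ I := by
      refine ⟨C (b : K) * (C (a : K) * G), Subring.mul_mem _ (C_mem_CR.2 b.2) hG', _, VB_smul a.2 hv', ?_⟩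
      rw [e, Ev_smul, Ev_smul]; push_cast
      simp only [map_mul, ev_C]; ring
    rcases hP.isPrime.mem_or_mem (hIP this) with h | h
    exacts [ha h, hb h]
  obtain ⟨G, hG, v, hv, e⟩ : (1 : R) ∈ I := by rw [hI]; trivial
  exact ⟨G, hG, v, hv, by simpa using e⟩

end Core
end

section
set_option maxHeartbeats 1000000
set_option synthInstance.maxHeartbeats 400000
open MvPolynomial IsLocalRing

namespace Core

structure RLR2 (A : Type) [CommRing A] [IsLocalRing A] (x y : A) : Prop where
  max : maximalIdeal A = Ideal.span {x, y}
  px : Prime x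
  nd : ¬ x ∣ y

variable {A : Type} [CommRing A] [IsLocalRing A] [IsNoetherianRing A] [IsDomain A] {x y : A}

theorem RLR2.mem_x (h : RLR2 A x y) : x ∈ maximalIdeal A := by rw [h.max]; exact Ideal.subset_span (by simp)
theorem RLR2.mem_y (h : RLR2 A x y) : y ∈ maximalIdeal A := by rw [h.max]; exact Ideal.subset_span (by simp)

theorem RLR2.quot (h : RLR2 A x y) : ∃ (_ : IsDomain (A ⧸ Ideal.span {x})) (_ : IsLocalRing (A ⧸ Ideal.span {x})),
    IsPrincipalIdealRing (A ⧸ Ideal.span {x}) ∧ 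
    maximalIdeal (A ⧸ Ideal.span {x}) = Ideal.span {Ideal.Quotient.mk (Ideal.span {x}) y} := by
  have hp : (Ideal.span {x}).IsPrime := (Ideal.span_singleton_prime h.px.ne_zero).2 h.px
  have h1 : IsDomain (A ⧸ Ideal.span {x}) := Ideal.Quotient.isDomain _
  have h2 : IsLocalRing (A ⧸ Ideal.span {x}) := IsLocalRing.of_surjective' _ Ideal.Quotient.mk_surjective
  have hm : maximalIdeal (A ⧸ Ideal.span {x}) = Ideal.span {Ideal.Quotient.mk (Ideal.span {x}) y} := by
    have e1 : maximalIdeal (A ⧸ Ideal.span {x}) = (maximalIdeal A).map (Ideal.Quotient.mk (Ideal.span {x})) := by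
      symm
      refine IsLocalRing.eq_maximalIdeal ?_
      have := Ideal.map_eq_top_or_isMaximal_of_surjective (Ideal.Quotient.mk (Ideal.span {x})) Ideal.Quotient.mk_surjective
        (I := maximalIdeal A) inferInstance
      refine this.resolve_left fun h3 => ?_
      have h4 := congrArg (Ideal.comap (Ideal.Quotient.mk (Ideal.span {x}))) h3
      rw [Ideal.comap_map_of_surjective _ Ideal.Quotient.mk_surjective, Ideal.comap_top, ← RingHom.ker_eq_comap_bot, Ideal.mk_ker,
        sup_eq_left.2 ((Ideal.span_singleton_le_iff_mem _).2 h.mem_x)] at h4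
      exact (maximalIdeal.isMaximal A).ne_top h4
    rw [e1, h.max, Ideal.map_span, Set.image_pair]
    have : Ideal.Quotient.mk (Ideal.span {x}) x = 0 := Ideal.Quotient.eq_zero_iff_mem.2 (Ideal.subset_span rfl)
    rw [this, Ideal.span_insert_zero]
  refine ⟨h1, h2, ?_, hm⟩
  have := (tfae_of_isNoetherianRing_of_isLocalRing_of_isDomain (R := A ⧸ Ideal.span {x})).out 0 4
  rw [this, hm]
  exact ⟨⟨_, rfl⟩⟩

/-- primes not containing x are principal -/
theorem RLR2.principal (h : RLR2 A x y) (p : Ideal A) [p.IsPrime] (hx : x ∉ p) : ∃ g, p = Ideal.span {g} := by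
  obtain ⟨h1, h2, h3, h4⟩ := h.quot
  obtain ⟨gb, hg⟩ := (h3.principal (p.map (Ideal.Quotient.mk (Ideal.span {x})))).principal
  have hgb : gb ∈ p.map (Ideal.Quotient.mk (Ideal.span {x})) := by rw [hg]; exact Submodule.mem_span_singleton_self _
  obtain ⟨g, hgp, rfl⟩ := (Ideal.mem_map_iff_of_surjective _ Ideal.Quotient.mk_surjective).1 hgb
  refine ⟨g, le_antisymm ?_ ((Ideal.span_singleton_le_iff_mem _).2 hgp)⟩
  refine Submodule.le_of_le_smul_of_le_jacobson_bot (I := maximalIdeal A) (IsNoetherian.noetherian p)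
    (by rw [IsLocalRing.jacobson_eq_maximalIdeal _ bot_ne_top]) ?_
  intro a ha
  have : Ideal.Quotient.mk (Ideal.span {x}) a ∈ Ideal.span {Ideal.Quotient.mk (Ideal.span {x}) g} := by
    have := Ideal.mem_map_of_mem (Ideal.Quotient.mk (Ideal.span {x})) ha
    rw [hg] at this; exact this
  obtain ⟨b, hb⟩ := Ideal.mem_span_singleton'.1 this
  obtain ⟨b, rfl⟩ := Ideal.Quotient.mk_surjective b
  rw [← map_mul, eq_comm, Ideal.Quotient.eq, Ideal.mem_span_singleton'] at hb
  obtain ⟨d, hd⟩ := hb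
  have hdp : d ∈ p := by
    have : d * x ∈ p := by rw [hd]; exact p.sub_mem ha (p.mul_mem_left _ hgp)
    exact (Ideal.IsPrime.mem_or_mem ‹_› this).resolve_right hx
  have e : a = b * g + x • d := by rw [smul_eq_mul, mul_comm x, hd]; ring
  rw [e]
  exact Submodule.add_mem_sup (Ideal.mem_span_singleton'.2 ⟨b, rfl⟩) (Submodule.smul_mem_smul h.mem_x hdp)

theorem RLR2.ufd (h : RLR2 A x y) : UniqueFactorizationMonoid A := by
  rw [UniqueFactorizationMonoid.iff_exists_prime_mem_of_isPrime]
  intro p hp0 hp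
  by_cases hx : x ∈ p
  · exact ⟨x, hx, h.px⟩
  · obtain ⟨g, rfl⟩ := h.principal p hx
    refine ⟨g, Ideal.mem_span_singleton_self _, ?_⟩
    refine (Ideal.span_singleton_prime ?_).1 hp
    rintro rfl; simp at hp0

theorem RLR2.symm (h : RLR2 A x y) : RLR2 A y x := by
  have hy0 : y ≠ 0 := by rintro rfl; exact h.nd (dvd_zero _)
  have hyn : ¬ IsUnit y := (mem_maximalIdeal _).1 h.mem_y
  obtain ⟨h1, h2, h3, h4⟩ := h.quot
  have := h.ufd
  refine ⟨by rw [h.max, Set.pair_comm], ?_, ?_⟩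
  · rw [← UniqueFactorizationMonoid.irreducible_iff_prime]
    refine ⟨hyn, fun a b hab => ?_⟩
    have hyp : Prime (Ideal.Quotient.mk (Ideal.span {x}) y) := by
      rw [← Ideal.span_singleton_prime, ← h4]
      · infer_instance
      · intro h0
        rw [Ideal.Quotient.eq_zero_iff_mem, Ideal.mem_span_singleton] at h0
        exact h.nd h0
    have hu : ∀ a, IsUnit (Ideal.Quotient.mk (Ideal.span {x}) a) → IsUnit a := by
      intro a ha
      by_contra hna
      have : Ideal.Quotient.mk (Ideal.span {x}) a ∈ maximalIdeal _ := by
        rw [h4]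
        have ham : a ∈ maximalIdeal A := hna
        rw [h.max, Ideal.mem_span_pair] at ham
        obtain ⟨p, q, rfl⟩ := ham
        rw [map_add, map_mul, map_mul, Ideal.Quotient.eq_zero_iff_mem.2 (Ideal.mem_span_singleton_self x), mul_zero, zero_add]
        exact Ideal.mul_mem_left _ _ (Ideal.mem_span_singleton_self _)
      exact this ha
    have := hyp.irreducible.isUnit_or_isUnit (a := Ideal.Quotient.mk (Ideal.span {x}) a) (b := Ideal.Quotient.mk (Ideal.span {x}) b)
      (by rw [hab, map_mul])
    exact this.imp (hu a) (hu b)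
  · rintro ⟨b, hb⟩
    rcases h.px.irreducible.isUnit_or_isUnit hb with h5 | h5
    · exact hyn h5
    · obtain ⟨v, rfl⟩ := h5
      exact h.nd ⟨(v⁻¹ : Aˣ), by rw [hb]; simp⟩

theorem RLR2.prime_eq (h : RLR2 A x y) (p : Ideal A) [p.IsPrime] : (∃ g, p = Ideal.span {g}) ∨ p = maximalIdeal A := by
  by_cases hx : x ∈ p
  swap
  · exact Or.inl (h.principal p hx)
  by_cases hy : y ∈ p
  swap
  · exact Or.inl (h.symm.principal p hy)
  right
  refine le_antisymm (le_maximalIdeal (Ideal.IsPrime.ne_top ‹_›)) ?_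
  rw [h.max, Ideal.span_le]
  rintro z (rfl | rfl) <;> assumption

theorem RLR2.pow_le (h : RLR2 A x y) (I : Ideal A) (hI : I ≠ ⊥) (hg : ∀ g, Prime g → ∃ a ∈ I, ¬ g ∣ a) :
    ∃ N, maximalIdeal A ^ N ≤ I := by
  refine Ideal.exists_pow_le_of_le_radical_of_fg ?_ (IsNoetherian.noetherian _)
  rw [Ideal.radical_eq_sInf]
  refine le_sInf ?_
  rintro p ⟨hIp, hp⟩
  rcases h.prime_eq p with ⟨g, rfl⟩ | h1
  · exfalso
    have hg0 : g ≠ 0 := by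
      rintro rfl
      exact hI (le_bot_iff.1 (by simpa using hIp))
    obtain ⟨a, ha, hga⟩ := hg g ((Ideal.span_singleton_prime hg0).1 hp)
    exact hga (Ideal.mem_span_singleton.1 (hIp ha))
  · exact h1.ge

/-- no prime divides all of an `m`-primary ideal -/
theorem RLR2.no_prime (h : RLR2 A x y) (I : Ideal A) {N : ℕ} (hN : maximalIdeal A ^ N ≤ I) (g : A) (hg : Prime g) : ∃ a ∈ I, ¬ g ∣ a := by
  by_contra! hc
  have h1 : g ∣ x := hg.dvd_of_dvd_pow (hc _ (hN (Ideal.pow_mem_pow h.mem_x N)))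
  have h2 : g ∣ y := hg.dvd_of_dvd_pow (hc _ (hN (Ideal.pow_mem_pow h.mem_y N)))
  have h3 : Associated g x := (hg.irreducible.dvd_irreducible_iff_associated h.px.irreducible).1 h1
  exact h.nd (h3.symm.dvd.trans h2)

theorem RLR2.pow_le' (h : RLR2 A x y) (I : Ideal A) {k : ℕ} (hk : x ^ k ∈ I) (ha : ∃ a ∈ I, ¬ x ∣ a) :
    ∃ N, maximalIdeal A ^ N ≤ I := by
  refine h.pow_le I ?_ ?_
  · rintro rfl
    exact pow_ne_zero k h.px.ne_zero (by simpa using hk)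
  · intro g hg
    by_contra! hc
    have h1 : g ∣ x := hg.dvd_of_dvd_pow (hc _ hk)
    have h3 : Associated g x := (hg.irreducible.dvd_irreducible_iff_associated h.px.irreducible).1 h1
    obtain ⟨a, haI, ha⟩ := ha
    exact ha (h3.symm.dvd.trans (hc a haI))

/-- bounded chains -/
def Bd {A : Type} [CommRing A] : Ideal A → ℕ → Prop
  | I, n => ∀ J, I < J → ∃ k, ∃ _ : k < n, Bd J k
termination_by _ n => n

theorem bd_iff {A : Type} [CommRing A] {I : Ideal A} {n : ℕ} : Bd I n ↔ ∀ J, I < J → ∃ k < n, Bd J k := by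
  rw [Bd]; simp only [exists_prop]

theorem RLR2.bd (I : Ideal A) {N : ℕ} (hN : maximalIdeal A ^ N ≤ I) : ∃ n, Bd I n := by
  have hfin : ∀ I : Ideal A, maximalIdeal A ^ N ≤ I → IsFiniteLength A (A ⧸ I) := by
    intro I hI
    by_cases htop : I = ⊤
    · subst htop
      have : Subsingleton (A ⧸ (⊤ : Ideal A)) := Ideal.Quotient.subsingleton_iff.2 rfl
      exact Module.length_ne_top_iff.1 (by rw [Module.length_eq_zero]; simp)
    have hnt : Nontrivial (A ⧸ I) := Ideal.Quotient.nontrivial_iff.2 htop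
    have h2 : IsLocalRing (A ⧸ I) := IsLocalRing.of_surjective' _ Ideal.Quotient.mk_surjective
    have h3 : IsArtinianRing (A ⧸ I) := by
      rw [isArtinianRing_iff_isNilpotent_maximalIdeal]
      refine ⟨N, ?_⟩
      have h4 : maximalIdeal (A ⧸ I) ≤ (maximalIdeal A).map (Ideal.Quotient.mk I) := by
        intro z hz
        obtain ⟨z, rfl⟩ := Ideal.Quotient.mk_surjective z
        refine Ideal.mem_map_of_mem _ ?_
        rw [mem_maximalIdeal] at hz ⊢
        exact fun hu => hz (hu.map _)
      refine le_bot_iff.1 ((Ideal.pow_right_mono h4 N).trans ?_)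
      rw [← Ideal.map_pow, Ideal.map_le_iff_le_comap, ← RingHom.ker_eq_comap_bot, Ideal.mk_ker]
      exact hI
    rw [← Module.length_ne_top_iff, Module.length_eq_of_surjective (R := A ⧸ I) (S := A) (M := A ⧸ I) Ideal.Quotient.mk_surjective]
    exact Module.length_ne_top
  have key : ∀ n : ℕ, ∀ I : Ideal A, maximalIdeal A ^ N ≤ I → Module.length A (A ⧸ I) ≤ n → Bd I n := by
    intro n
    induction n using Nat.strong_induction_on with
    | _ n ih =>
      intro I hI hn
      rw [bd_iff]
      intro J hJ
      have hlt : Module.length A (A ⧸ J) < Module.length A (A ⧸ I) := by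
        have h5 := Module.length_ne_top_iff.2 (hfin J (hI.trans hJ.le))
        rw [Module.length_quotient] at h5 ⊢
        rw [Module.length_quotient]
        exact Order.coheight_strictAnti hJ h5.lt_top
      obtain ⟨k, hk⟩ := ENat.ne_top_iff_exists.1 (Module.length_ne_top_iff.2 (hfin J (hI.trans hJ.le)))
      refine ⟨k, ?_, ih k ?_ J (hI.trans hJ.le) hk.ge⟩
      all_goals exact_mod_cast (hk ▸ hlt).trans_le hn
  obtain ⟨k, hk⟩ := ENat.ne_top_iff_exists.1 (Module.length_ne_top_iff.2 (hfin I hN))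
  exact ⟨k, key k I hN hk.ge⟩

end Core
end

section
set_option maxHeartbeats 1000000
set_option synthInstance.maxHeartbeats 400000
open MvPolynomial IsLocalRing

namespace Core

variable {K : Type} [Field K] {n r : ℕ} {u : Fin n → Fin r → K} {c : Fin n → K}

/-- `π` is a prime element of the subring `R`. -/
structure PR (R : Subring K) (π : K) : Prop where
  ne : π ≠ 0
  mem : π ∈ R
  inv : π⁻¹ ∉ R
  mul : ∀ a ∈ R, ∀ b ∈ R, a * b / π ∈ R → a / π ∈ R ∨ b / π ∈ R

theorem dvd_iff_div {R : Subring K} {a b : R} (ha : (a : K) ≠ 0) : a ∣ b ↔ (b : K) / a ∈ R := by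
  constructor
  · rintro ⟨d, rfl⟩
    push_cast
    rw [mul_div_cancel_left₀ _ ha]; exact d.2
  · intro h
    refine ⟨⟨_, h⟩, Subtype.ext ?_⟩
    push_cast
    rw [mul_div_cancel₀ _ ha]

theorem PR.prime {R : Subring K} {π : K} (h : PR R π) : Prime (⟨π, h.mem⟩ : R) := by
  refine ⟨fun h0 => h.ne (congrArg Subtype.val h0), fun hu => ?_, fun a b hab => ?_⟩
  · rw [isUnit_iff_dvd_one, dvd_iff_div h.ne] at hu
    exact h.inv (by simpa using hu)
  · rw [dvd_iff_div h.ne] at hab ⊢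
    rw [dvd_iff_div h.ne]
    exact h.mul a a.2 b b.2 hab

theorem PR.of_prime {R : Subring K} {π : R} (h : Prime π) : PR R (π : K) := by
  have h0 : (π : K) ≠ 0 := fun h0 => h.ne_zero (Subtype.ext h0)
  refine ⟨h0, π.2, fun hi => h.not_unit ?_, fun a ha b hb hab => ?_⟩
  · rw [isUnit_iff_dvd_one, dvd_iff_div h0]
    simpa using hi
  · have := h.dvd_or_dvd (a := ⟨a, ha⟩) (b := ⟨b, hb⟩) ((dvd_iff_div h0).2 hab)
    rwa [dvd_iff_div h0, dvd_iff_div h0] at this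

theorem PR.pow {R : Subring K} {π : K} (h : PR R π) {a : K} (ha : a ∈ R) {k : ℕ} (hk : a ^ k / π ∈ R) : a / π ∈ R := by
  induction k with
  | zero => exact absurd (by simpa using hk) h.inv
  | succ k ih =>
    rw [pow_succ] at hk
    rcases h.mul _ (R.pow_mem ha k) _ ha hk with h1 | h1
    · exact ih h1
    · exact h1

theorem prime_step {R : Subring K} {π : K} (h : PR R π) (hc : ∀ i, c i ∈ R) (hn : ∃ i, c i / π ∉ R)
    {q : MvPolynomial (Fin n) K} (h1 : emb K n c * q ∈ CR R n) (h2 : C π * q ∈ CR R n) : q ∈ CR R n := by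
  obtain ⟨F, hF⟩ := emb_mem_CR hc
  obtain ⟨G, hG⟩ := h1
  obtain ⟨Q, hQ⟩ := h2
  have hinj : Function.Injective (MvPolynomial.map (σ := Fin n) R.subtype) := map_injective _ R.subtype_injective
  have hp : Prime (C (⟨π, h.mem⟩ : R) : MvPolynomial (Fin n) R) := (prime_C_iff _).2 h.prime
  have e : F * Q = C (⟨π, h.mem⟩ : R) * G := by
    apply hinj
    rw [map_mul, map_mul, map_C]
    change _ = C π * _
    erw [hF, hQ, hG]; ring
  rcases hp.dvd_or_dvd ⟨_, e⟩ with ⟨d, hd⟩ | ⟨d, hd⟩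
  · obtain ⟨i, hi⟩ := hn
    exfalso; apply hi
    have h3 : emb K n c = C π * MvPolynomial.map (σ := Fin n) R.subtype d := by
      rw [← hF, hd]; erw [map_mul, map_C]; rfl
    have h4 := congrArg (coeff (Finsupp.single i 1)) h3
    rw [coeff_C_mul] at h4
    have h5 : coeff (Finsupp.single i 1) (emb K n c) = c i := by
      simp [emb, Fintype.linearCombination_apply, coeff_sum, coeff_X, Finsupp.single_left_inj]
    rw [h5] at h4
    rw [h4, mul_div_cancel_left₀ _ h.ne, coeff_map]
    exact (coeff _ d).2
  · refine ⟨d, ?_⟩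
    have hC : (C π : MvPolynomial (Fin n) K) ≠ 0 := by simpa using h.ne
    apply mul_left_cancel₀ hC
    rw [← hQ, hd]; erw [map_mul, map_C]; rfl

theorem prim_ufd {A : Subring K} [UniqueFactorizationMonoid A] (hF : ∀ z : K, ∃ a ∈ A, a ≠ 0 ∧ a * z ∈ A)
    (hc : ∀ i, c i ∈ A) (hp : ∀ π, PR A π → ∃ i, c i / π ∉ A) (q) (h : emb K n c * q ∈ CR A n) : q ∈ CR A n := by
  have key : ∀ a : A, a ≠ 0 → ∀ q, emb K n c * q ∈ CR A n → C (a : K) * q ∈ CR A n → q ∈ CR A n := by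
    intro a
    induction a using UniqueFactorizationMonoid.induction_on_prime with
    | h₁ => intro h0; exact absurd rfl h0
    | h₂ a ha =>
      intro _ q _ h2
      obtain ⟨b, hb⟩ := ha.exists_left_inv
      have : q = C (b : K) * (C (a : K) * q) := by
        rw [← mul_assoc, ← C_mul]
        have := congrArg Subtype.val hb
        push_cast at this
        rw [this]; simp
      rw [this]
      exact Subring.mul_mem _ (C_mem_CR.2 b.2) h2
    | h₃ a p ha hpp ih =>
      intro _ q h1 h2
      refine ih ha q h1 ?_
      have hpr := PR.of_prime hpp
      refine prime_step hpr hc (hp _ hpr) ?_ ?_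
      · rw [mul_left_comm]
        exact Subring.mul_mem _ (C_mem_CR.2 a.2) h1
      · rw [← mul_assoc, ← C_mul]; exact_mod_cast h2
  have hden : ∃ a : A, a ≠ 0 ∧ ∀ m ∈ q.support, (a : K) * coeff m q ∈ A := by
    classical
    choose f hf1 hf2 hf3 using hF
    refine ⟨∏ m ∈ q.support, ⟨f (coeff m q), hf1 _⟩, ?_, ?_⟩
    · rw [Finset.prod_ne_zero_iff]
      intro m _ h0
      exact hf2 _ (congrArg Subtype.val h0)
    · intro m hm
      rw [← Finset.prod_erase_mul _ _ hm, Subring.coe_mul, mul_assoc]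
      exact A.mul_mem (SetLike.coe_mem _) (hf3 _)
  obtain ⟨a, ha, h2⟩ := hden
  refine key a ha q h (mem_CR.2 fun m => ?_)
  rw [coeff_C_mul]
  by_cases hm : m ∈ q.support
  · exact h2 m hm
  · rw [notMem_support_iff.1 hm, mul_zero]; exact A.zero_mem

/-- evaluating a monic relation: `z` integral over R -/
theorem isInt_poly {R : Subring K} {z : K} (hz : IsIntegral R z) :
    ∃ (d : ℕ) (a : ℕ → K), (∀ i, a i ∈ R) ∧ z ^ d = ∑ i ∈ Finset.range d, a i * z ^ i := by
  obtain ⟨p, hp, h⟩ := hz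
  refine ⟨p.natDegree, fun i => -(p.coeff i : K), fun i => R.neg_mem (p.coeff i).2, ?_⟩
  rw [Polynomial.eval₂_eq_sum_range, Finset.sum_range_succ] at h
  rw [Polynomial.coeff_natDegree, hp.leadingCoeff, map_one, one_mul] at h
  rw [eq_neg_of_add_eq_zero_right h, ← Finset.sum_neg_distrib]
  exact Finset.sum_congr rfl fun i _ => by rw [neg_mul]; rfl

theorem isInt_of_poly {R : Subring K} {z : K} (d : ℕ) (a : ℕ → K) (ha : ∀ i < d, a i ∈ R)
    (h : z ^ d = ∑ i ∈ Finset.range d, a i * z ^ i) : IsIntegral R z := by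
  classical
  have hq : (∑ i ∈ Finset.range d, Polynomial.C (if h : i < d then (⟨a i, ha i h⟩ : R) else 0) * Polynomial.X ^ i).degree < (d : WithBot ℕ) := by
    refine (Polynomial.degree_sum_le _ _).trans_lt ((Finset.sup_lt_iff (WithBot.bot_lt_coe d)).2 ?_)
    intro i hi
    refine (Polynomial.degree_C_mul_X_pow_le _ _).trans_lt ?_
    exact WithBot.coe_lt_coe.2 (Finset.mem_range.1 hi)
  refine ⟨Polynomial.X ^ d - ∑ i ∈ Finset.range d, Polynomial.C (if h : i < d then (⟨a i, ha i h⟩ : R) else 0) * Polynomial.X ^ i,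
    Polynomial.monic_X_pow_sub hq, ?_⟩
  rw [Polynomial.eval₂_sub, Polynomial.eval₂_X_pow, h, Polynomial.eval₂_finset_sum, sub_eq_zero]
  refine Finset.sum_congr rfl fun i hi => ?_
  rw [Polynomial.eval₂_mul, Polynomial.eval₂_C, Polynomial.eval₂_X_pow, dif_pos (Finset.mem_range.1 hi)]
  rfl

theorem normal_of {A R : Subring K} (hA : Normal A) {x d : K} (hx : PR R x) 
    (h1 : ∀ z ∈ R, ∃ N : ℕ, d ^ N * z ∈ A) (hd : d ∈ A)
    (h2 : ∀ z ∈ A, ∀ N : ℕ, ∀ w, d ^ N * w = z → ∃ M : ℕ, x ^ M * w ∈ R) : Normal R := by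
  intro z hz
  have hzx : ∃ M : ℕ, x ^ M * z ∈ R := by
    obtain ⟨k, a, ha, h⟩ := isInt_poly hz
    choose N hN using fun i => h1 (a i) (ha i)
    set L := ∑ i ∈ Finset.range k, N i
    have hL : ∀ i < k, d ^ L * a i ∈ A := by
      intro i hi
      have : N i ≤ L := Finset.single_le_sum (f := N) (fun _ _ => Nat.zero_le _) (Finset.mem_range.2 hi)
      obtain ⟨e, he⟩ := Nat.exists_eq_add_of_le this
      rw [he, pow_add, mul_right_comm, mul_comm]
      exact A.mul_mem (A.pow_mem hd _) (hN i)
    have : IsIntegral A (d ^ L * z) := by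
      refine isInt_of_poly k (fun i => (d ^ L * a i) * (d ^ L) ^ (k - i - 1)) (fun i hi => A.mul_mem (hL i hi) (A.pow_mem (A.pow_mem hd _) _)) ?_
      rw [mul_pow, h, Finset.mul_sum]
      refine Finset.sum_congr rfl fun i hi => ?_
      have hi := Finset.mem_range.1 hi
      obtain ⟨e, rfl⟩ := Nat.exists_eq_add_of_lt hi
      rw [show i + e + 1 - i - 1 = e by omega]
      ring
    exact h2 _ (hA _ this) L z rfl
  classical
  by_contra hzR
  have hk := Nat.find_spec hzx
  have hk0 : Nat.find hzx ≠ 0 := by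
    intro h0; rw [h0] at hk; exact hzR (by simpa using hk)
  obtain ⟨k, hkk⟩ := Nat.exists_eq_succ_of_ne_zero hk0
  have hmin := Nat.find_min hzx (m := k) (by omega)
  rw [hkk] at hk
  apply hmin
  set w := x ^ (k + 1) * z with hw
  have e : x ^ k * z = w / x := by rw [hw, pow_succ]; field_simp [hx.ne]
  have hisint : IsIntegral R (w / x) := by
    rw [← e]
    exact (isIntegral_algebraMap (R := R) (x := ⟨x ^ k, R.pow_mem hx.mem k⟩)).mul hz
  rw [e]
  obtain ⟨l, a, ha, h⟩ := isInt_poly hisint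
  refine hx.pow hk (k := l) ?_
  have : w ^ l / x = ∑ i ∈ Finset.range l, a i * w ^ i * x ^ (l - i - 1) := by
    have : w ^ l = x ^ l * (w / x) ^ l := by rw [div_pow]; field_simp [hx.ne]
    rw [this, h, Finset.mul_sum, Finset.sum_div]
    refine Finset.sum_congr rfl fun i hi => ?_
    have hi := Finset.mem_range.1 hi
    obtain ⟨e, rfl⟩ := Nat.exists_eq_add_of_lt hi
    rw [show i + e + 1 - i - 1 = e by omega, div_pow, pow_succ, pow_add]
    field_simp [hx.ne]
  rw [this]
  exact R.sum_mem fun i _ => R.mul_mem (R.mul_mem (ha i) (R.pow_mem hk _)) (R.pow_mem hx.mem _)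

theorem normal_Loc {R : Subring K} (hR : Normal R) (P : Ideal R) [P.IsPrime] : Normal (Loc R P) := by
  intro z hz
  obtain ⟨k, a, ha, h⟩ := isInt_poly hz
  obtain ⟨s, hs, h1⟩ := clear_fin (P := P) (Finset.range k) (fun i s => s * a i ∈ R)
    (fun m _ s a ha h => by rw [mul_assoc]; exact R.mul_mem ha h) (fun m _ => mem_Loc.1 (ha m))
  refine mem_Loc.2 ⟨s, hs, hR _ ?_⟩
  refine isInt_of_poly k (fun i => (s * a i) * s ^ (k - i - 1)) (fun i hi => R.mul_mem (h1 i (Finset.mem_range.2 hi)) (R.pow_mem s.2 _)) ?_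
  rw [mul_pow, h, Finset.mul_sum]
  refine Finset.sum_congr rfl fun i hi => ?_
  have hi := Finset.mem_range.1 hi
  obtain ⟨e, rfl⟩ := Nat.exists_eq_add_of_lt hi
  rw [show i + e + 1 - i - 1 = e by omega]
  ring

theorem PR.Loc {R : Subring K} {π : K} (h : PR R π) (P : Ideal R) [P.IsPrime] (hP : (⟨π, h.mem⟩ : R) ∈ P) : PR (Loc R P) π := by
  refine ⟨h.ne, le_Loc _ _ h.mem, fun hi => ?_, fun a ha b hb hab => ?_⟩
  · obtain ⟨s, hs, h1⟩ := mem_Loc.1 hi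
    apply hs
    have : s = ⟨_, h1⟩ * ⟨π, h.mem⟩ := Subtype.ext (by push_cast; rw [mul_assoc, inv_mul_cancel₀ h.ne, mul_one])
    rw [this]; exact P.mul_mem_left _ hP
  · obtain ⟨s, hs, h1⟩ := mem_Loc.1 ha
    obtain ⟨s', hs', h2⟩ := mem_Loc.1 hb
    obtain ⟨s'', hs'', h3⟩ := mem_Loc.1 hab
    have := h.mul _ h1 (s'' * (s' * b)) (R.mul_mem s''.2 h2) (by
      have e : (s : K) * a * (s'' * (s' * b)) / π = s * s' * (s'' * (a * b / π)) := by ring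
      rw [e]; exact R.mul_mem (s * s').2 h3)
    refine this.imp (fun h4 => mem_Loc.2 ⟨s, hs, by rwa [← mul_div_assoc]⟩) fun h4 => mem_Loc.2 ⟨s'' * s', ?_, ?_⟩
    · exact fun h5 => (Ideal.IsPrime.mem_or_mem ‹_› h5).elim hs'' hs'
    · push_cast; rwa [← mul_div_assoc, mul_assoc]

theorem PR.div_Loc {R : Subring K} {π : K} (h : PR R π) (P : Ideal R) [P.IsPrime] (hP : (⟨π, h.mem⟩ : R) ∈ P)
    {a : K} (ha : a ∈ R) (hal : a / π ∈ Core.Loc R P) : a / π ∈ R := by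
  obtain ⟨s, hs, h1⟩ := mem_Loc.1 hal
  rw [← mul_div_assoc] at h1
  rcases h.mul _ s.2 _ ha h1 with h2 | h2
  · exfalso; apply hs
    have : s = ⟨_, h2⟩ * ⟨π, h.mem⟩ := Subtype.ext (by push_cast; rw [div_mul_cancel₀ _ h.ne])
    rw [this]; exact P.mul_mem_left _ hP
  · exact h2

/-- localisation at powers of t -/
def Away (R : Subring K) (t : K) (ht : t ∈ R) : Subring K where
  carrier := {z | ∃ N : ℕ, t ^ N * z ∈ R}
  mul_mem' := by
    rintro a b ⟨N, h⟩ ⟨M, h'⟩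
    exact ⟨N + M, by rw [pow_add, mul_mul_mul_comm]; exact R.mul_mem h h'⟩
  one_mem' := ⟨0, by simp⟩
  add_mem' := by
    rintro a b ⟨N, h⟩ ⟨M, h'⟩
    refine ⟨N + M, ?_⟩
    have : t ^ (N + M) * (a + b) = t ^ M * (t ^ N * a) + t ^ N * (t ^ M * b) := by ring
    rw [this]
    exact R.add_mem (R.mul_mem (R.pow_mem ht _) h) (R.mul_mem (R.pow_mem ht _) h')
  zero_mem' := ⟨0, by simp⟩
  neg_mem' := by
    rintro a ⟨N, h⟩
    exact ⟨N, by rw [mul_neg]; exact R.neg_mem h⟩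

theorem mem_Away {R : Subring K} {t : K} {ht : t ∈ R} {z : K} : z ∈ Away R t ht ↔ ∃ N : ℕ, t ^ N * z ∈ R := Iff.rfl

theorem le_Away {R : Subring K} {t : K} {ht : t ∈ R} : R ≤ Away R t ht := fun z hz => ⟨0, by simpa using hz⟩

theorem PR.div_Away {R : Subring K} {π t : K} (h : PR R π) (ht : t ∈ R) (hπ : t / π ∉ R)
    {a : K} (ha : a ∈ R) (hal : a / π ∈ Core.Away R t ht) : a / π ∈ R := by
  obtain ⟨N, h1⟩ := hal
  rw [← mul_div_assoc] at h1
  exact (h.mul _ (R.pow_mem ht _) _ ha h1).resolve_left fun h2 => hπ (h.pow ht h2)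

theorem PR.Away {R : Subring K} {π t : K} (h : PR R π) (ht : t ∈ R) (hπ : t / π ∉ R) : PR (Away R t ht) π := by
  refine ⟨h.ne, le_Away h.mem, fun hi => ?_, fun a ⟨N, ha⟩ b ⟨M, hb⟩ hab => ?_⟩
  · rw [← one_div] at hi
    exact h.inv (by simpa using h.div_Away ht hπ R.one_mem hi)
  · have h2 := h.div_Away ht hπ (R.mul_mem ha hb) (by
      have : t ^ N * a * (t ^ M * b) / π = t ^ N * t ^ M * (a * b / π) := by ring
      rw [this]
      exact Subring.mul_mem _ (le_Away (R.mul_mem (R.pow_mem ht _) (R.pow_mem ht _))) hab)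
    refine (h.mul _ ha _ hb h2).imp (fun h3 => ⟨N, ?_⟩) (fun h3 => ⟨M, ?_⟩)
    all_goals rwa [← mul_div_assoc]

end Core
end

section
set_option maxHeartbeats 1000000
set_option synthInstance.maxHeartbeats 400000
open IsLocalRing

namespace Core

variable {K : Type} [Field K] {A : Subring K}

noncomputable abbrev phi (A : Subring K) (t : K) : Polynomial A →+* K := Polynomial.eval₂RingHom A.subtype t

noncomputable def adj (A : Subring K) (t : K) : Subring K := (phi A t).range

theorem mem_adj {t z : K} : z ∈ adj A t ↔ ∃ p, phi A t p = z := Iff.rfl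

theorem le_adj (t : K) : A ≤ adj A t := fun a ha => ⟨Polynomial.C ⟨a, ha⟩, by simp⟩
theorem self_adj (t : K) : t ∈ adj A t := ⟨Polynomial.X, by simp⟩

theorem adj_le {t : K} (T : Subring K) (hA : A ≤ T) (ht : t ∈ T) : adj A t ≤ T := by
  rintro z ⟨p, rfl⟩
  rw [Polynomial.coe_eval₂RingHom, Polynomial.eval₂_eq_sum_range]
  exact T.sum_mem fun i _ => T.mul_mem (hA (p.coeff i).2) (T.pow_mem ht _)

instance adj_noeth [IsNoetherianRing A] (t : K) : IsNoetherianRing (adj A t) :=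
  isNoetherianRing_of_surjective _ _ (phi A t).rangeRestrict (phi A t).rangeRestrict_surjective

theorem phi_deg {x y : A} (hx : (x : K) ≠ 0) (d : ℕ) (p : Polynomial A) (hp : p.natDegree ≤ d) :
    (x : K) ^ d * phi A (y / x) p ∈ A := by
  rw [Polynomial.coe_eval₂RingHom, Polynomial.eval₂_eq_sum_range' _ (Nat.lt_succ_of_le hp), Finset.mul_sum]
  refine A.sum_mem fun i hi => ?_
  obtain ⟨e, rfl⟩ := Nat.exists_eq_add_of_le (Nat.lt_succ_iff.1 (Finset.mem_range.1 hi))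
  have : (x : K) ^ (i + e) * (A.subtype (p.coeff i) * (y / x) ^ i) = x ^ e * p.coeff i * y ^ i := by
    rw [pow_add, div_pow, Subring.subtype_apply]; field_simp
  rw [this]
  exact (x ^ e * p.coeff i * y ^ i).2

variable [IsLocalRing A] [IsNoetherianRing A] {x y : A}

theorem RLR2.x0 (h : RLR2 A x y) : (x : K) ≠ 0 := fun h0 => h.px.ne_zero (Subtype.ext h0)
theorem RLR2.y0 (h : RLR2 A x y) : (y : K) ≠ 0 := fun h0 => h.nd ⟨0, by rw [mul_zero]; exact Subtype.ext h0⟩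

theorem RLR2.ker_aux (h : RLR2 A x y) (d : ℕ) : ∀ p : Polynomial A, p.natDegree ≤ d → phi A (y / x) p = 0 → ∀ i, p.coeff i ∈ maximalIdeal A := by
  have hx0 := h.x0
  induction d with
  | zero =>
    intro p hp h0 i
    rw [Polynomial.eq_C_of_natDegree_le_zero hp] at h0 ⊢
    have : p.coeff 0 = 0 := Subtype.ext (by simpa using h0)
    rw [this]; simp
  | succ d ih =>
    intro p hp h0 i
    set a := p.coeff (d + 1) with ha
    set q := p - Polynomial.C a * Polynomial.X ^ (d + 1) with hq
    have hqd : q.natDegree ≤ d := by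
      rw [Polynomial.natDegree_le_iff_coeff_eq_zero]
      intro N hN
      rw [hq, Polynomial.coeff_sub, Polynomial.coeff_C_mul_X_pow]
      split_ifs with h1
      · rw [h1, ← ha, sub_self]
      · rw [Polynomial.coeff_eq_zero_of_natDegree_lt (by omega), sub_zero]
    have e1 : phi A (y / x) q = - (a * (y / x) ^ (d + 1)) := by
      rw [hq, map_sub, h0, zero_sub]
      simp
    have h1 := phi_deg (y := y) hx0 d q hqd
    have hdvd : x ∣ a * y ^ (d + 1) := by
      refine ⟨- ⟨_, h1⟩, Subtype.ext ?_⟩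
      push_cast
      rw [e1, div_pow, pow_succ]; field_simp; ring
    have hxa : x ∣ a := (h.px.dvd_or_dvd hdvd).resolve_right fun h2 => h.nd (h.px.dvd_of_dvd_pow h2)
    obtain ⟨b, hb⟩ := hxa
    have h2 := ih (q + Polynomial.C (b * y) * Polynomial.X ^ d) (by
      refine (Polynomial.natDegree_add_le _ _).trans (max_le hqd (Polynomial.natDegree_C_mul_X_pow_le _ _))) (by
      rw [map_add, e1]
      simp only [Polynomial.coe_eval₂RingHom, Polynomial.eval₂_mul, Polynomial.eval₂_C, Polynomial.eval₂_X_pow]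
      rw [hb]; push_cast
      rw [pow_succ, div_pow]; simp; field_simp; ring) i
    have e3 : p.coeff i = (q + Polynomial.C (b * y) * Polynomial.X ^ d).coeff i + (Polynomial.C a * Polynomial.X ^ (d + 1) : Polynomial A).coeff i
       - (Polynomial.C (b * y) * Polynomial.X ^ d : Polynomial A).coeff i := by
      rw [← Polynomial.coeff_add, ← Polynomial.coeff_sub, hq]; congr 1; ring
    have ham : a ∈ maximalIdeal A := by rw [hb]; exact Ideal.mul_mem_right _ _ h.mem_x
    rw [e3]
    refine Ideal.sub_mem _ (Ideal.add_mem _ h2 ?_) ?_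
    · rw [Polynomial.coeff_C_mul]; exact Ideal.mul_mem_right _ _ ham
    · rw [Polynomial.coeff_C_mul]; exact Ideal.mul_mem_right _ _ (Ideal.mul_mem_left _ _ h.mem_y)

noncomputable abbrev psi (A : Subring K) [IsLocalRing A] : Polynomial A →+* Polynomial (ResidueField A) := Polynomial.mapRingHom (residue A)

theorem psi_zero {p : Polynomial A} : psi A p = 0 ↔ ∀ i, p.coeff i ∈ maximalIdeal A := by
  rw [Polynomial.ext_iff]
  simp [psi, Polynomial.coeff_map, residue_eq_zero_iff]

theorem RLR2.div_iff (h : RLR2 A x y) (p : Polynomial A) : phi A (y / x) p / x ∈ adj A (y / x : K) ↔ psi A p = 0 := by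
  constructor
  · rintro ⟨q, hq⟩
    have h0 : phi A (y / x) (p - Polynomial.C x * q) = 0 := by
      rw [map_sub, map_mul, hq]
      have : phi A (y / x) (Polynomial.C x) = x := by simp
      rw [this, mul_div_cancel₀ _ h.x0, sub_self]
    have := psi_zero.2 (h.ker_aux _ _ le_rfl h0)
    rw [map_sub, map_mul] at this
    have h3 : psi A (Polynomial.C x) = 0 := by
      rw [Polynomial.coe_mapRingHom, Polynomial.map_C, (residue_eq_zero_iff x).2 h.mem_x, map_zero]
    rwa [h3, zero_mul, sub_zero] at this
  · intro hp
    rw [psi_zero] at hp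
    rw [Polynomial.coe_eval₂RingHom, Polynomial.eval₂_eq_sum_range, Finset.sum_div]
    refine Subring.sum_mem _ fun i _ => ?_
    have := hp i
    rw [h.max, Ideal.mem_span_pair] at this
    obtain ⟨a, b, hab⟩ := this
    have e : A.subtype (p.coeff i) * (y / x : K) ^ i / x = (a + b * (y / x)) * (y / x) ^ i := by
      rw [← hab]; simp; field_simp [h.x0]
    rw [e]
    exact Subring.mul_mem _ (Subring.add_mem _ (le_adj _ a.2) (Subring.mul_mem _ (le_adj _ b.2) (self_adj _))) (Subring.pow_mem _ (self_adj _) _)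

theorem RLR2.pr1 (h : RLR2 A x y) : PR (adj A (y / x : K)) (x : K) := by
  refine ⟨h.x0, le_adj _ x.2, fun hi => ?_, ?_⟩
  · have := (h.div_iff 1).1 (by simpa using hi)
    simp at this
  · rintro _ ⟨p, rfl⟩ _ ⟨q, rfl⟩ hpq
    rw [← map_mul, h.div_iff, map_mul, mul_eq_zero] at hpq
    rwa [h.div_iff, h.div_iff]

theorem RLR2.t_div (h : RLR2 A x y) : (y / x : K) / x ∉ adj A (y / x : K) := by
  intro hi
  have := (h.div_iff Polynomial.X).1 (by simpa using hi)
  simp [psi] at this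

noncomputable abbrev A12 (x y : A) : Subring K := Away (adj A (y / x : K)) (y / x : K) (self_adj _)

theorem RLR2.pr12 (h : RLR2 A x y) : PR (A12 x y) (x : K) := h.pr1.Away _ h.t_div

theorem RLR2.x_pow (h : RLR2 A x y) {z : K} (hz : z ∈ adj A (y / x : K)) : ∃ N : ℕ, (x : K) ^ N * z ∈ A := by
  obtain ⟨p, rfl⟩ := hz
  exact ⟨_, phi_deg h.x0 _ _ le_rfl⟩

theorem RLR2.le1 (x y : A) : adj A (y / x : K) ≤ A12 x y := le_Away

theorem RLR2.le2 (h : RLR2 A x y) : adj A (x / y : K) ≤ A12 x y := by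
  refine adj_le _ ((le_adj _).trans le_Away) ⟨1, ?_⟩
  have : (y / x : K) ^ 1 * (x / y) = 1 := by have := h.x0; have := h.y0; field_simp
  rw [this]; exact Subring.one_mem _

theorem RLR2.split (h : RLR2 A x y) {z : K} (hz : z ∈ A12 x y) : ∃ a ∈ adj A (y / x : K), ∃ b ∈ adj A (x / y : K), z = a - b := by
  have hx := h.x0
  have hy := h.y0
  obtain ⟨N, p, hp⟩ := hz
  let T : AddSubgroup K := (adj A (y / x : K)).toAddSubgroup ⊔ (adj A (x / y : K)).toAddSubgroup
  have hz : z ∈ T := by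
    have e : z = ∑ i ∈ Finset.range (p.natDegree + 1), (p.coeff i : K) * ((y / x : K) ^ i * (x / y : K) ^ N) := by
      have : z = (x / y : K) ^ N * phi A (y / x) p := by
        rw [hp, ← mul_assoc, ← mul_pow]
        have : (x / y : K) * (y / x) = 1 := by field_simp
        rw [this, one_pow, one_mul]
      rw [this, Polynomial.coe_eval₂RingHom, Polynomial.eval₂_eq_sum_range, Finset.mul_sum]
      refine Finset.sum_congr rfl fun i _ => ?_
      simp only [Subring.subtype_apply]; ring
    rw [e]
    refine AddSubgroup.sum_mem _ fun i _ => ?_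
    rcases le_total N i with hi | hi
    · obtain ⟨e, rfl⟩ := Nat.exists_eq_add_of_le hi
      refine AddSubgroup.mem_sup_left ?_
      have : (p.coeff (N + e) : K) * ((y / x : K) ^ (N + e) * (x / y : K) ^ N) = p.coeff (N + e) * (y / x) ^ e := by
        rw [pow_add, div_pow, div_pow, div_pow]; field_simp
      rw [this]
      exact Subring.mul_mem _ (le_adj _ (p.coeff _).2) (Subring.pow_mem _ (self_adj _) _)
    · obtain ⟨f, rfl⟩ := Nat.exists_eq_add_of_le hi
      refine AddSubgroup.mem_sup_right ?_
      have : (p.coeff i : K) * ((y / x : K) ^ i * (x / y : K) ^ (i + f)) = p.coeff i * (x / y) ^ f := by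
        rw [pow_add, div_pow, div_pow, div_pow]; field_simp
      rw [this]
      exact Subring.mul_mem _ (le_adj _ (p.coeff _).2) (Subring.pow_mem _ (self_adj _) _)
  obtain ⟨a, ha, b, hb, rfl⟩ := AddSubgroup.mem_sup.1 hz
  exact ⟨a, ha, -b, Subring.neg_mem _ hb, by ring⟩

theorem RLR2.inter (h : RLR2 A x y) {z : K} (h1 : z ∈ adj A (y / x : K)) (h2 : z ∈ adj A (x / y : K)) : z ∈ A := by
  classical
  have hx := h.x_pow h1
  obtain ⟨M, hM⟩ := h.symm.x_pow h2
  by_contra hzA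
  have hk := Nat.find_spec hx
  have hk0 : Nat.find hx ≠ 0 := by
    intro h0; rw [h0] at hk; exact hzA (by simpa using hk)
  obtain ⟨k, hkk⟩ := Nat.exists_eq_succ_of_ne_zero hk0
  have hmin := Nat.find_min hx (m := k) (by omega)
  rw [hkk] at hk
  have hdvd : x ∣ y ^ M * (⟨_, hk⟩ : A) := by
    refine ⟨⟨_, hM⟩ * x ^ k, Subtype.ext ?_⟩
    push_cast; rw [Nat.succ_eq_add_one]; ring
  rcases h.px.dvd_or_dvd hdvd with h3 | h3
  · exact h.nd (h.px.dvd_of_dvd_pow h3)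
  · rw [dvd_iff_div h.x0] at h3
    apply hmin
    have : (x : K) ^ k.succ * z / x = x ^ k * z := by rw [pow_succ]; field_simp [h.x0]
    rwa [this] at h3

theorem RLR2.normal1 (h : RLR2 A x y) (hA : Normal A) : Normal (adj A (y / x : K)) :=
  normal_of hA h.pr1 (d := x) (fun _ hz => h.x_pow hz) x.2 (fun z hz N w hw => ⟨N, by rw [hw]; exact le_adj _ hz⟩)

theorem RLR2.normal12 (h : RLR2 A x y) (hA : Normal A) : Normal (A12 x y) := by
  have hx := h.x0
  have hy := h.y0
  refine normal_of hA h.pr12 (d := x * y) ?_ (x * y).2 ?_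
  · rintro z ⟨N, hz⟩
    obtain ⟨M, hM⟩ := h.x_pow hz
    refine ⟨N + M, ?_⟩
    have : (x * y : K) ^ (N + M) * z = x ^ (N + N) * y ^ M * (x ^ M * ((y / x) ^ N * z)) := by
      rw [div_pow]; field_simp; ring
    rw [this]
    exact A.mul_mem (x ^ (N + N) * y ^ M).2 hM
  · rintro z hz N w hw
    refine ⟨N + N, N, ?_⟩
    have : (y / x : K) ^ N * (x ^ (N + N) * w) = (x * y) ^ N * w := by
      rw [div_pow]; field_simp; ring
    rw [this, hw]; exact le_adj _ hz

theorem RLR2.max_gen (h : RLR2 A x y) (P : Ideal (adj A (y / x : K))) [P.IsMaximal] (hP : (⟨x, le_adj _ x.2⟩ : adj A (y / x : K)) ∈ P) :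
    ∃ y' : adj A (y / x : K), P = Ideal.span {⟨x, le_adj _ x.2⟩, y'} ∧ (y' : K) / x ∉ adj A (y / x : K) := by
  obtain ⟨φ, hφs, hφc⟩ : ∃ φ : Polynomial A →+* adj A (y / x : K), Function.Surjective φ ∧ ∀ p, (φ p : K) = phi A (y / x) p :=
    ⟨(phi A (y / x : K)).rangeRestrict, (phi A (y / x : K)).rangeRestrict_surjective, fun p => rfl⟩
  let 𝔞 : Ideal (Polynomial A) := P.comap φ
  obtain ⟨g0, hg0⟩ := (IsPrincipalIdealRing.principal (𝔞.map (psi A))).principal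
  have hψs : Function.Surjective (psi A) := Polynomial.map_surjective _ residue_surjective
  have hg0m : g0 ∈ 𝔞.map (psi A) := by rw [hg0]; exact Submodule.mem_span_singleton_self _
  obtain ⟨g, hg, rfl⟩ := (Ideal.mem_map_iff_of_surjective _ hψs).1 hg0m
  refine ⟨φ g, le_antisymm ?_ ?_, ?_⟩
  · intro z hz
    obtain ⟨p, rfl⟩ := hφs z
    have : psi A p ∈ 𝔞.map (psi A) := Ideal.mem_map_of_mem _ hz
    rw [hg0] at this
    obtain ⟨q, hq⟩ := Submodule.mem_span_singleton.1 this
    obtain ⟨q, rfl⟩ := hψs q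
    have h0 : psi A (p - q * g) = 0 := by rw [map_sub, map_mul, ← hq, smul_eq_mul, sub_self]
    rw [← h.div_iff] at h0
    rw [Ideal.mem_span_pair]
    refine ⟨⟨_, h0⟩, φ q, Subtype.ext ?_⟩
    push_cast
    rw [div_mul_cancel₀ _ h.x0, hφc, hφc, hφc, map_sub, map_mul]; ring
  · rw [Ideal.span_le]
    rintro z (rfl | rfl)
    · exact hP
    · exact hg
  · rw [hφc, h.div_iff]
    intro h0
    have hX : φ Polynomial.X ∉ P := by
      intro hX
      have : psi A Polynomial.X ∈ 𝔞.map (psi A) := Ideal.mem_map_of_mem _ hX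
      rw [hg0, h0] at this
      simp [psi] at this
    obtain ⟨b, hb⟩ := Ideal.IsMaximal.exists_inv ‹_› hX
    obtain ⟨i, hi, e⟩ := hb
    obtain ⟨b, rfl⟩ := hφs b
    have : (1 - b * Polynomial.X) ∈ 𝔞 := by
      change φ _ ∈ P
      rw [map_sub, map_mul, map_one, ← e]
      simpa using hi
    have h3 : psi A (1 - b * Polynomial.X) ∈ 𝔞.map (psi A) := Ideal.mem_map_of_mem _ this
    rw [hg0, h0] at h3
    have h4 : psi A (1 - b * Polynomial.X) = 0 := by simpa using h3
    have h5 := congrArg (Polynomial.coeff · 0) h4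
    simp [psi] at h5

theorem rlr2_Loc {R : Subring K} {x y : R} (hx : PR R (x : K)) (P : Ideal R) [P.IsPrime] (hP : P = Ideal.span {x, y})
    (hy : (y : K) / x ∉ R) : ∃ (_ : IsLocalRing (Loc R P)), RLR2 (Loc R P) ⟨x, le_Loc R P x.2⟩ ⟨y, le_Loc R P y.2⟩ := by
  have hl : IsLocalRing (Loc R P) := inferInstance
  have hxP : x ∈ P := by rw [hP]; exact Ideal.subset_span (by simp)
  refine ⟨hl, ?_, (hx.Loc P hxP).prime, ?_⟩
  · rw [← IsLocalization.AtPrime.map_eq_maximalIdeal P (Loc R P)]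
    have := congrArg (Ideal.map (algebraMap R (Loc R P))) hP
    rw [this, Ideal.map_span, Set.image_pair]
    rfl
  · exact fun h => hy (hx.div_Loc P hxP y.2 ((dvd_iff_div (a := (⟨x, le_Loc R P x.2⟩ : Loc R P)) hx.ne).1 h))

instance loc_noeth {R : Subring K} [IsNoetherianRing R] (P : Ideal R) [P.IsPrime] : IsNoetherianRing (Loc R P) :=
  IsLocalization.isNoetherianRing P.primeCompl _ inferInstance

end Core
end

section
set_option maxHeartbeats 1000000
set_option synthInstance.maxHeartbeats 400000
open MvPolynomial IsLocalRing

namespace Core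

variable {K : Type} [Field K] {n r : ℕ} {u : Fin n → Fin r → K} {c : Fin n → K}

def CI {R : Subring K} (hc : ∀ i, c i ∈ R) : Ideal R := Ideal.span (Set.range fun i => (⟨c i, hc i⟩ : R))

theorem mem_CI {R : Subring K} {hc : ∀ i, c i ∈ R} {z : R} : z ∈ CI hc ↔ ∃ p : Fin n → R, (z : K) = ∑ i, c i * p i := by
  rw [CI, Ideal.mem_span_range_iff_exists_fun]
  refine exists_congr fun p => ?_
  rw [Subtype.ext_iff, eq_comm]
  push_cast
  simp only [mul_comm]

theorem self_CI {R : Subring K} {hc : ∀ i, c i ∈ R} (i) : (⟨c i, hc i⟩ : R) ∈ CI hc := Ideal.subset_span ⟨i, rfl⟩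

theorem Rel.scale (hc : Rel u c) {g : K} (hg : g ≠ 0) : Rel u (fun i => c i / g) := by
  refine ⟨?_, ?_, ?_, hc.span⟩
  · intro h0
    apply hc.ne
    ext i
    have := congrFun h0 i
    simpa [hg] using this
  · have := congrArg (fun z => g⁻¹ • z) hc.rel
    simpa [Finset.smul_sum, smul_smul, div_eq_mul_inv, mul_comm] using this
  · intro l hl
    obtain ⟨t, ht⟩ := hc.ker l hl
    refine ⟨t * g, ?_⟩
    rw [ht]; ext i; simp; field_simp

theorem bd_mono {A : Type} [CommRing A] {I J : Ideal A} {n : ℕ} (h : I ≤ J) (hI : Bd I n) : Bd J n := by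
  rw [bd_iff] at *
  exact fun J' hJ => hI J' (h.trans_lt hJ)

/-- descent of chain bounds along a strictly monotone map -/
theorem bd_drop {A R : Type} [CommRing A] [CommRing R] (I0 : Ideal R) (Φ : Ideal R → Ideal A)
    (hm : ∀ I J, I0 ≤ I → I < J → Φ I < Φ J) (ht : Φ ⊤ ≠ ⊤) (n : ℕ) : ∀ I, I0 ≤ I → Bd (Φ I) n → ∃ k < n, Bd I k := by
  induction n using Nat.strong_induction_on with
  | _ n ih =>
    intro I hI h
    have hlt : Φ I < ⊤ := by
      rcases eq_or_lt_of_le (le_top : I ≤ ⊤) with h1 | h1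
      · rw [h1]; exact lt_top_iff_ne_top.2 ht
      · exact (hm I ⊤ hI h1).trans_le le_top
    obtain ⟨k, hk, _⟩ := bd_iff.1 h ⊤ hlt
    refine ⟨n - 1, by omega, bd_iff.2 fun J hJ => ?_⟩
    obtain ⟨k, hk, h2⟩ := bd_iff.1 h _ (hm I J hI hJ)
    obtain ⟨k', hk', h3⟩ := ih k hk J (hI.trans hJ.le) h2
    exact ⟨k', by omega, h3⟩

theorem clear_pow {A R : Subring K} {d : K} (hd : d ∈ A) (h1 : ∀ z ∈ R, ∃ N : ℕ, d ^ N * z ∈ A) {G : MvPolynomial (Fin n) K}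
    (hG : G ∈ CR R n) : ∃ N : ℕ, C (d ^ N) * G ∈ CR A n := by
  rw [mem_CR] at hG
  choose N hN using fun m => h1 _ (hG m)
  set L := ∑ i ∈ G.support, N i
  refine ⟨L, mem_CR.2 fun m => ?_⟩
  rw [coeff_C_mul]
  by_cases hm : m ∈ G.support
  · have : N m ≤ L := Finset.single_le_sum (f := N) (fun _ _ => Nat.zero_le _) hm
    obtain ⟨e, he⟩ := Nat.exists_eq_add_of_le this
    rw [he, pow_add, mul_right_comm, mul_comm]
    exact A.mul_mem (A.pow_mem hd _) (hN m)
  · rw [notMem_support_iff.1 hm, mul_zero]; exact A.zero_mem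

variable {A : Subring K} [IsLocalRing A] [IsNoetherianRing A] {x y : A}

theorem RLR2.xy_pow (h : RLR2 A x y) {z : K} (hz : z ∈ A12 x y) : ∃ N : ℕ, (x * y : K) ^ N * z ∈ A := by
  have hx := h.x0
  obtain ⟨N, hz⟩ := hz
  obtain ⟨M, hM⟩ := h.x_pow hz
  refine ⟨N + M, ?_⟩
  have : (x * y : K) ^ (N + M) * z = x ^ (N + N) * y ^ M * (x ^ M * ((y / x) ^ N * z)) := by
    rw [div_pow]; field_simp; ring
  rw [this]
  exact A.mul_mem (x ^ (N + N) * y ^ M).2 hM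

theorem RLR2.exists_e (h : RLR2 A x y) (hc : ∀ i, c i ∈ A) {N : ℕ} (hN : maximalIdeal A ^ N ≤ CI hc) :
    ∃ e : ℕ, (∀ i, c i / x ^ e ∈ adj A (y / x : K)) ∧ ∃ i, c i / x ^ e / x ∉ adj A (y / x : K) := by
  classical
  have hex : ∃ k : ℕ, ∃ i, c i / x ^ k ∉ adj A (y / x : K) := by
    by_contra! hcon
    obtain ⟨p, hp⟩ := mem_CI.1 (hN (Ideal.pow_mem_pow h.mem_x N))
    apply h.pr1.inv
    have : (x : K)⁻¹ = ∑ i, c i / x ^ (N + 1) * p i := by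
      have e : ∑ i, c i / (x : K) ^ (N + 1) * p i = (∑ i, c i * p i) / x ^ (N + 1) := by
        rw [Finset.sum_div]; exact Finset.sum_congr rfl fun i _ => by ring
      rw [e, ← hp]; push_cast; rw [pow_succ]; have := h.x0; field_simp
    rw [this]
    exact Subring.sum_mem _ fun i _ => Subring.mul_mem _ (hcon _ _) (le_adj _ (p i).2)
  have hk := Nat.find_spec hex
  have hk0 : Nat.find hex ≠ 0 := by
    intro h0; rw [h0] at hk
    obtain ⟨i, hi⟩ := hk
    exact hi (by simpa using le_adj _ (hc i))
  obtain ⟨k, hkk⟩ := Nat.exists_eq_succ_of_ne_zero hk0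
  have hmin := Nat.find_min hex (m := k) (by omega)
  rw [hkk] at hk
  refine ⟨k, by simpa using hmin, ?_⟩
  obtain ⟨i, hi⟩ := hk
  exact ⟨i, by rwa [div_div, ← pow_succ]⟩

theorem RLR2.prim12 (h : RLR2 A x y) (hF : ∀ z : K, ∃ a ∈ A, a ≠ 0 ∧ a * z ∈ A) (hc : ∀ i, c i ∈ A)
    {N : ℕ} (hN : maximalIdeal A ^ N ≤ CI hc) {e : ℕ} (he : ∀ i, c i / x ^ e ∈ adj A (y / x : K)) (he' : ∃ i, c i / x ^ e / x ∉ adj A (y / x : K))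
    (q) (hq : emb K n c * q ∈ CR (A12 x y) n) : C ((x : K) ^ e) * q ∈ CR (A12 x y) n := by
  have hx := h.x0
  have hy := h.y0
  have := h.ufd
  obtain ⟨L, hL⟩ := clear_pow (x * y).2 (fun z hz => h.xy_pow hz) hq
  have h1 : C ((x * y : K) ^ L) * q ∈ CR A n := by
    refine prim_ufd hF hc ?_ _ ?_
    · intro π hπ
      obtain ⟨a, ha, hd⟩ := h.no_prime _ hN _ hπ.prime
      by_contra! hcon
      apply hd
      obtain ⟨p, hp⟩ := mem_CI.1 ha
      rw [dvd_iff_div hπ.ne, hp, Finset.sum_div]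
      refine A.sum_mem fun i _ => ?_
      rw [mul_div_right_comm]
      exact A.mul_mem (hcon i) (p i).2
    · rw [mul_left_comm]; exact_mod_cast hL
  have hA : A ≤ A12 x y := (le_adj _).trans le_Away
  have h2 : C ((x : K) ^ (L + L)) * q ∈ CR (A12 x y) n := by
    have : C ((x : K) ^ (L + L)) * q = C ((x / y : K) ^ L) * (C ((x * y : K) ^ L) * q) := by
      rw [← mul_assoc, ← C_mul]; congr 2; rw [div_pow]; field_simp; ring
    rw [this]
    exact Subring.mul_mem _ (C_mem_CR.2 (Subring.pow_mem _ (h.le2 (self_adj _)) _)) (CR_mono hA h1)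
  have hf : ∀ q' : MvPolynomial (Fin n) K, emb K n (fun i => c i / (x : K) ^ e) * (C ((x : K) ^ e) * q') = emb K n c * q' := by
    intro q'
    have e1 : emb K n (fun i => c i / (x : K) ^ e) * C ((x : K) ^ e) = emb K n c := by
      simp only [emb, Fintype.linearCombination_apply, Finset.sum_mul, smul_eq_C_mul]
      refine Finset.sum_congr rfl fun i _ => ?_
      rw [mul_right_comm, ← C_mul, div_mul_cancel₀ _ (pow_ne_zero _ hx)]
    rw [← mul_assoc, e1]
  have key : ∀ k : ℕ, C ((x : K) ^ k) * (C ((x : K) ^ e) * q) ∈ CR (A12 x y) n → C ((x : K) ^ e) * q ∈ CR (A12 x y) n := by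
    intro k
    induction k with
    | zero => intro hh; simpa using hh
    | succ k ih =>
      intro hh
      apply ih
      refine prime_step (c := fun i => c i / (x : K) ^ e) h.pr12 (fun i => RLR2.le1 x y (he i)) ?_ ?_ ?_
      · obtain ⟨i, hi⟩ := he'
        exact ⟨i, fun h3 => hi (h.pr1.div_Away _ h.t_div (he i) h3)⟩
      · rw [mul_left_comm, hf]
        exact Subring.mul_mem _ (C_mem_CR.2 (hA (x ^ k).2)) hq
      · rw [← mul_assoc, ← C_mul, ← pow_succ']; exact hh
  refine key (L + L) ?_
  rw [mul_left_comm]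
  exact Subring.mul_mem _ (C_mem_CR.2 (hA (x ^ e).2)) h2

/-- subring plus ideal -/
def addI (S : Subring K) {R : Subring K} (hSR : S ≤ R) (J : Ideal R) : Subring K where
  carrier := {z | ∃ a ∈ S, ∃ b ∈ J, z = a + b}
  mul_mem' := by
    rintro _ _ ⟨a, ha, b, hb, rfl⟩ ⟨a', ha', b', hb', rfl⟩
    refine ⟨a * a', S.mul_mem ha ha', ⟨a, hSR ha⟩ * b' + ⟨a', hSR ha'⟩ * b + b * b', ?_, by push_cast; ring⟩
    exact J.add_mem (J.add_mem (J.mul_mem_left _ hb') (J.mul_mem_left _ hb)) (J.mul_mem_left _ hb')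
  one_mem' := ⟨1, S.one_mem, 0, J.zero_mem, by simp⟩
  add_mem' := by
    rintro _ _ ⟨a, ha, b, hb, rfl⟩ ⟨a', ha', b', hb', rfl⟩
    exact ⟨a + a', S.add_mem ha ha', b + b', J.add_mem hb hb', by push_cast; ring⟩
  zero_mem' := ⟨0, S.zero_mem, 0, J.zero_mem, by simp⟩
  neg_mem' := by
    rintro _ ⟨a, ha, b, hb, rfl⟩
    exact ⟨-a, S.neg_mem ha, -b, J.neg_mem hb, by push_cast; ring⟩

theorem mem_addI {S R : Subring K} {hSR : S ≤ R} {J : Ideal R} {z : K} : z ∈ addI S hSR J ↔ ∃ a ∈ S, ∃ b ∈ J, z = a + b := Iff.rfl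

theorem RLR2.fill (h : RLR2 A x y) {c' : Fin n → K} (hc' : ∀ i, c' i ∈ adj A (y / x : K)) (hc'' : ∀ i, c' i ∈ A12 x y)
    (hn : ∃ i, c' i / x ∉ adj A (y / x : K)) {N : ℕ} (hN : (⟨(x : K) ^ N, Subring.pow_mem _ h.pr12.mem N⟩ : A12 x y) ∈ CI hc'')
    {z : K} (hz : z ∈ A12 x y) : z ∈ addI (adj A (x / y : K)) h.le2 (CI hc'') := by
  have hx := h.x0
  have hy := h.y0
  have hA : A ≤ A12 x y := (le_adj _).trans le_Away
  set X : A12 x y := ⟨x, h.pr12.mem⟩ with hX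
  let T : ℕ → Subring K := fun k => addI (adj A (x / y : K)) h.le2 (CI hc'' ⊔ Ideal.span {X ^ k})
  have hS : ∀ k, adj A (x / y : K) ≤ T k := fun k z hz => ⟨z, hz, 0, Ideal.zero_mem _, by simp⟩
  have hJ : ∀ k, ∀ b ∈ CI hc'' ⊔ Ideal.span {X ^ k}, (b : K) ∈ T k := fun k b hb => ⟨0, Subring.zero_mem _, b, hb, by simp⟩
  have hst : (x / y : K) * (y / x) = 1 := by field_simp
  have ht12 : (y / x : K) ∈ A12 x y := RLR2.le1 x y (self_adj _)
  have hs12 : (x / y : K) ∈ A12 x y := h.le2 (self_adj _)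
  have hxT : ∀ w ∈ A12 x y, (x : K) * w ∈ T 1 := by
    intro w hw
    refine hJ 1 (X * ⟨w, hw⟩) (Ideal.mem_sup_right ?_)
    rw [pow_one]; exact Ideal.mul_mem_right _ _ (Ideal.mem_span_singleton_self _)
  have ht : (y / x : K) ∈ T 1 := by
    obtain ⟨i, hi⟩ := hn
    obtain ⟨p, hp⟩ := hc' i
    rw [← hp, h.div_iff] at hi
    set m := (psi A p).natDegree with hm
    have ham : IsUnit (p.coeff m) := by
      have h1 : (psi A p).coeff m ≠ 0 := by
        rw [hm, Polynomial.coeff_natDegree]; exact Polynomial.leadingCoeff_ne_zero.2 hi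
      rw [Polynomial.coe_mapRingHom, Polynomial.coeff_map, Ne, residue_eq_zero_iff] at h1
      exact not_not.1 h1
    obtain ⟨b, hb⟩ := ham.exists_left_inv
    have hbig : ∀ j, m < j → p.coeff j ∈ maximalIdeal A := by
      intro j hj
      have := Polynomial.coeff_eq_zero_of_natDegree_lt hj
      rw [Polynomial.coe_mapRingHom, Polynomial.coeff_map, residue_eq_zero_iff] at this
      exact this
    have htot : (y / x : K) * (x / y) ^ m * b * phi A (y / x) p ∈ T 1 := by
      have hmem : (y / x : K) * (x / y) ^ m * b ∈ A12 x y :=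
        Subring.mul_mem _ (Subring.mul_mem _ ht12 (Subring.pow_mem _ hs12 _)) (hA b.2)
      rw [hp]
      exact hJ 1 (⟨_, hmem⟩ * ⟨c' i, hc'' i⟩) (Ideal.mem_sup_left (Ideal.mul_mem_left _ _ (self_CI i)))
    have hexp : (y / x : K) * (x / y) ^ m * b * phi A (y / x) p =
        ∑ j ∈ Finset.range (p.natDegree ⊔ m + 1), (b * p.coeff j : K) * ((y / x) * (x / y) ^ m * (y / x) ^ j) := by
      rw [Polynomial.coe_eval₂RingHom, Polynomial.eval₂_eq_sum_range' _ (Nat.lt_succ_of_le (le_max_left _ m)), Finset.mul_sum]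
      refine Finset.sum_congr rfl fun j _ => ?_
      rw [Subring.subtype_apply]; ring
    rw [hexp, ← Finset.add_sum_erase _ _ (Finset.mem_range.2 (show m < p.natDegree ⊔ m + 1 by omega))] at htot
    have hrest : ∑ j ∈ (Finset.range (p.natDegree ⊔ m + 1)).erase m, (b * p.coeff j : K) * ((y / x) * (x / y) ^ m * (y / x) ^ j) ∈ T 1 := by
      refine Subring.sum_mem _ fun j hj => ?_
      rcases lt_or_gt_of_ne (Finset.ne_of_mem_erase hj) with h1 | h1
      · obtain ⟨f, hf⟩ := Nat.exists_eq_add_of_lt h1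
        have e1 : (y / x : K) * (x / y) ^ m * (y / x) ^ j = (x / y) ^ f := by
          rw [hf, show (y / x : K) * (x / y) ^ (j + f + 1) * (y / x) ^ j = (x / y * (y / x)) ^ (j + 1) * (x / y) ^ f by ring, hst]
          simp
        rw [e1]
        exact hS 1 (Subring.mul_mem _ (le_adj _ (b * p.coeff j).2) (Subring.pow_mem _ (self_adj _) _))
      · have := hbig j h1
        rw [h.max, Ideal.mem_span_pair] at this
        obtain ⟨a1, b1, hab⟩ := this
        have e1 : (b * p.coeff j : K) * ((y / x) * (x / y) ^ m * (y / x) ^ j) = x * (b * (a1 + b1 * (y / x)) * ((y / x) * (x / y) ^ m * (y / x) ^ j)) := by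
          rw [← hab]; push_cast
          have : (a1 * x + b1 * y : K) = x * (a1 + b1 * (y / x)) := by field_simp
          rw [this]; ring
        rw [e1]
        refine hxT _ ?_
        exact Subring.mul_mem _ (Subring.mul_mem _ (hA b.2) (Subring.add_mem _ (hA a1.2) (Subring.mul_mem _ (hA b1.2) ht12)))
          (Subring.mul_mem _ (Subring.mul_mem _ ht12 (Subring.pow_mem _ hs12 _)) (Subring.pow_mem _ ht12 _))
    have e2 : (b * p.coeff m : K) * ((y / x) * (x / y) ^ m * (y / x) ^ m) = y / x := by
      have h3 : (b * p.coeff m : K) = 1 := by exact_mod_cast congrArg Subtype.val hb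
      rw [h3, one_mul, mul_assoc, ← mul_pow, hst]; simp
    rw [e2] at htot
    simpa using Subring.sub_mem _ htot hrest
  have h12 : ∀ w ∈ A12 x y, w ∈ T 1 := by
    rintro w ⟨M, hw⟩
    have h1 : (y / x : K) ^ M * w ∈ T 1 := adj_le (T 1) ((le_adj _).trans (hS 1)) ht hw
    have e1 : w = (x / y : K) ^ M * ((y / x) ^ M * w) := by rw [← mul_assoc, ← mul_pow, hst]; simp
    rw [e1]
    exact Subring.mul_mem _ (Subring.pow_mem _ (hS 1 (self_adj _)) _) h1
  have hall : ∀ k, ∀ w ∈ A12 x y, w ∈ T k := by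
    intro k
    induction k with
    | zero =>
      intro w hw
      refine hJ 0 ⟨w, hw⟩ ?_
      rw [pow_zero, Ideal.span_singleton_one]; simp
    | succ k ih =>
      intro w hw
      obtain ⟨a, ha, b, hb, rfl⟩ := ih w hw
      refine Subring.add_mem _ (hS _ ha) ?_
      obtain ⟨b1, hb1, b2, hb2, rfl⟩ := Submodule.mem_sup.1 hb
      push_cast
      refine Subring.add_mem _ (hJ _ b1 (Ideal.mem_sup_left hb1)) ?_
      obtain ⟨d, rfl⟩ := Ideal.mem_span_singleton'.1 hb2
      obtain ⟨a', ha', b', hb', e'⟩ := h12 d d.2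
      push_cast
      rw [e', add_mul]
      refine Subring.add_mem _ (hS _ (Subring.mul_mem _ ha' (Subring.pow_mem _ (le_adj _ x.2) _))) ?_
      refine hJ (k + 1) (b' * X ^ k) ?_
      obtain ⟨b1, hb1, b2, hb2, rfl⟩ := Submodule.mem_sup.1 hb'
      rw [add_mul]
      refine Ideal.add_mem _ (Ideal.mem_sup_left (Ideal.mul_mem_right _ _ hb1)) (Ideal.mem_sup_right ?_)
      obtain ⟨d', rfl⟩ := Ideal.mem_span_singleton'.1 hb2
      exact Ideal.mem_span_singleton'.2 ⟨d', by ring⟩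
  have := hall N z hz
  have e : CI hc'' ⊔ Ideal.span {X ^ N} = CI hc'' := by
    rw [sup_eq_left, Ideal.span_singleton_le_iff_mem]; exact hN
  rwa [show T N = _ from congrArg (addI (adj A (x / y : K)) h.le2) e] at this

end Core
end

section
set_option maxHeartbeats 1000000
set_option synthInstance.maxHeartbeats 400000

open MvPolynomial IsLocalRing
namespace Core

variable {K : Type} [Field K] {n r : ℕ} {u : Fin n → Fin r → K} {c : Fin n → K}
variable {A : Subring K} [IsLocalRing A] [IsNoetherianRing A] {x y : A}

theorem RLR2.x_CI (h : RLR2 A x y) (hc : ∀ i, c i ∈ A) {N : ℕ} (hN : maximalIdeal A ^ N ≤ CI hc) {e : ℕ}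
    {R : Subring K} (hR : A ≤ R) (hc' : ∀ i, c i / x ^ e ∈ R) :
    (⟨(x : K) ^ N, Subring.pow_mem _ (hR x.2) N⟩ : R) ∈ CI hc' := by
  have := hN (Ideal.pow_mem_pow h.mem_x N)
  obtain ⟨p, hp⟩ := mem_CI.1 this
  have hx := h.x0
  refine mem_CI.2 ⟨fun i => ⟨(x : K) ^ e * p i, R.mul_mem (R.pow_mem (hR x.2) _) (hR (p i).2)⟩, ?_⟩
  push_cast at hp
  simp only
  rw [hp]
  refine Finset.sum_congr rfl fun i _ => ?_
  field_simp

theorem RLR2.locA (h : RLR2 A x y) (hc : ∀ i, c i ∈ A) {N : ℕ} (hN : maximalIdeal A ^ N ≤ CI hc) {e : ℕ}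
    (he : ∀ i, c i / x ^ e ∈ adj A (y / x : K)) (he' : ∃ i, c i / x ^ e / x ∉ adj A (y / x : K))
    (P : Ideal (adj A (y / x : K))) [P.IsMaximal] (hP : (⟨x, le_adj _ x.2⟩ : adj A (y / x : K)) ∈ P) :
    ∃ (_ : IsLocalRing (Loc _ P)) (x' y' : Loc _ P), RLR2 (Loc _ P) x' y' ∧ ∃ N',
      (maximalIdeal (Loc _ P)) ^ N' ≤ CI (c := fun i => c i / x ^ e) (R := Loc _ P) (fun i => le_Loc _ P (he i)) ∧
      ∀ w ∈ Loc _ P, ∃ z ∈ adj A (y / x : K), ∃ b ∈ CI (c := fun i => c i / x ^ e) (R := Loc _ P) (fun i => le_Loc _ P (he i)), w = z + b := by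
  obtain ⟨y', hP', hy'⟩ := h.max_gen P hP
  obtain ⟨hl, h'⟩ := rlr2_Loc (x := (⟨x, le_adj _ x.2⟩ : adj A (y / x : K))) h.pr1 P hP' hy'
  refine ⟨hl, _, _, h', ?_⟩
  set I := CI (c := fun i => c i / x ^ e) (R := Loc _ P) (fun i => le_Loc _ P (he i)) with hI
  obtain ⟨N', hN'⟩ := h'.pow_le' I (k := N) (h.x_CI hc hN (le_trans (le_adj _) (le_Loc _ P)) _) (by
    obtain ⟨i, hi⟩ := he'
    refine ⟨_, self_CI i, fun hd => hi ?_⟩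
    have hd := (dvd_iff_div (show ((⟨x, le_Loc _ P (le_adj _ x.2)⟩ : Loc _ P) : K) ≠ 0 from h.x0)).1 hd
    exact h.pr1.div_Loc P hP (he i) hd)
  refine ⟨N', hN', fun w hw => ?_⟩
  obtain ⟨s, hs, hsw⟩ := mem_Loc.1 hw
  have h1 : IsCoprime (Ideal.span {s}) P := by
    rw [Ideal.isCoprime_iff_sup_eq]
    by_contra hne
    have : P = Ideal.span {s} ⊔ P := Ideal.IsMaximal.eq_of_le ‹P.IsMaximal› hne le_sup_right
    apply hs
    rw [this]
    exact (le_sup_left : Ideal.span {s} ≤ _) (Ideal.mem_span_singleton_self s)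
  have h2 := (h1.pow_right (n := N'))
  rw [Ideal.isCoprime_iff_exists] at h2
  obtain ⟨a, ha, π, hπ, hs1⟩ := h2
  obtain ⟨b, rfl⟩ := Ideal.mem_span_singleton.1 ha
  have hle : (P.map (Subring.inclusion (le_Loc _ P))) ≤ maximalIdeal (Loc _ P) := by
    rw [h'.max, Ideal.map_le_iff_le_comap]
    intro q hq
    rw [hP', Ideal.mem_span_pair] at hq
    obtain ⟨a1, b1, rfl⟩ := hq
    rw [Ideal.mem_comap, map_add, map_mul, map_mul]
    exact Ideal.add_mem _ (Ideal.mul_mem_left _ _ (Ideal.subset_span (Or.inl rfl))) (Ideal.mul_mem_left _ _ (Ideal.subset_span (Or.inr rfl)))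
  have hπI : Subring.inclusion (le_Loc _ P) π ∈ I := by
    apply hN'
    apply Ideal.pow_right_mono hle
    rw [← Ideal.map_pow]
    exact Ideal.mem_map_of_mem _ hπ
  refine ⟨b * (s * w), Subring.mul_mem _ b.2 hsw, _, Ideal.mul_mem_left I ⟨w, hw⟩ hπI, ?_⟩
  have hs2 : (s * b + π : K) = 1 := by exact_mod_cast congrArg Subtype.val hs1
  have : (((⟨w, hw⟩ * Subring.inclusion (le_Loc _ P) π : Loc _ P)) : K) = w * π := rfl
  rw [this]
  linear_combination (-w) * hs2

theorem RLR2.claimD (h : RLR2 A x y) (hc : ∀ i, c i ∈ A) {N : ℕ} (hN : maximalIdeal A ^ N ≤ CI hc) {e : ℕ}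
    (he : ∀ i, c i / x ^ e ∈ adj A (y / x : K)) (he' : ∃ i, c i / x ^ e / x ∉ adj A (y / x : K))
    {z : K} (hz : z ∈ adj A (y / x : K)) : ∃ a ∈ A, ∃ p : Fin n → K, (∀ i, p i ∈ adj A (y / x : K)) ∧ a - x ^ e * z = ∑ i, c i * p i := by
  have hx := h.x0
  have hy := h.y0
  have hA1 : A ≤ A12 x y := le_trans (le_adj _) (RLR2.le1 x y)
  obtain ⟨z2, hz2, b, hb, e1⟩ := mem_addI.1 (h.fill he (fun i => RLR2.le1 x y (he i)) he' (h.x_CI hc hN hA1 _) (RLR2.le1 x y hz))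
  obtain ⟨p, hp⟩ := mem_CI.1 hb
  choose p1 hp1 p2 hp2 hp12 using fun i => h.split (p i).2
  refine ⟨x ^ e * z - ∑ i, c i * p1 i, h.inter ?_ ?_, fun i => - p1 i, fun i => Subring.neg_mem _ (hp1 i), ?_⟩
  · exact Subring.sub_mem _ (Subring.mul_mem _ (Subring.pow_mem _ (le_adj _ x.2) _) hz) (Subring.sum_mem _ fun i _ => Subring.mul_mem _ (le_adj _ (hc i)) (hp1 i))
  · have : x ^ e * z - ∑ i, c i * p1 i = x ^ e * z2 - ∑ i, c i * p2 i := by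
      rw [e1, hp, mul_add, Finset.mul_sum]
      have : ∀ i, (x : K) ^ e * (c i / x ^ e * p i) = c i * p1 i - c i * p2 i := by
        intro i; rw [hp12]; field_simp
      rw [Finset.sum_congr rfl fun i _ => this i, Finset.sum_sub_distrib]; ring
    rw [this]
    exact Subring.sub_mem _ (Subring.mul_mem _ (Subring.pow_mem _ (le_adj _ x.2) _) hz2) (Subring.sum_mem _ fun i _ => Subring.mul_mem _ (le_adj _ (hc i)) (hp2 i))
  · simp [mul_neg]

def PhiI (A R : Subring K) (x : K) (hAR : A ≤ R) (I : Ideal R) : Ideal A where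
  carrier := {a | ∃ h : (a : K) / x ∈ R, (⟨_, h⟩ : R) ∈ I}
  add_mem' := by
    rintro a b ⟨h, h'⟩ ⟨k, k'⟩
    have : ((a + b : A) : K) / x = a / x + b / x := by push_cast; ring
    exact ⟨by rw [this]; exact R.add_mem h k, by convert I.add_mem h' k'; exact this⟩
  zero_mem' := ⟨by simp, by convert I.zero_mem; simp⟩
  smul_mem' := by
    rintro a b ⟨h, h'⟩
    have : ((a • b : A) : K) / x = a * (b / x) := by simp [mul_div_assoc]
    exact ⟨by rw [this]; exact R.mul_mem (hAR a.2) h, by convert I.mul_mem_left ⟨a, hAR a.2⟩ h'; exact this⟩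

/-- The drop in length after one blowup. -/
theorem RLR2.drop (h : RLR2 A x y) (hc : ∀ i, c i ∈ A) {N : ℕ} (hN : maximalIdeal A ^ N ≤ CI hc) {e : ℕ}
    (he : ∀ i, c i / x ^ e ∈ adj A (y / x : K)) (he' : ∃ i, c i / x ^ e / x ∉ adj A (y / x : K))
    (hm : CI hc ≤ maximalIdeal A) {n0 : ℕ} (hB : Bd (CI hc) n0)
    (P : Ideal (adj A (y / x : K))) [P.IsMaximal] (hP : (⟨x, le_adj _ x.2⟩ : adj A (y / x : K)) ∈ P) :
    ∃ k < n0, Bd (CI (c := fun i => c i / x ^ e) (R := Loc _ P) (fun i => le_Loc _ P (he i))) k := by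
  have hx := h.x0
  obtain ⟨_, x', y', h', N', hN', hadd⟩ := h.locA hc hN he he' P hP
  set I0 := CI (c := fun i => c i / x ^ e) (R := Loc _ P) (fun i => le_Loc _ P (he i)) with hI0
  have hAR : A ≤ Loc _ P := le_trans (le_adj _) (le_Loc _ P)
  -- key
  have key : ∀ w ∈ Loc _ P, ∃ a ∈ A, ∃ b ∈ I0, a / x ^ e = w + b := by
    intro w hw
    obtain ⟨z, hz, b, hb, rfl⟩ := hadd w hw
    obtain ⟨a, ha, p, hp, e1⟩ := h.claimD hc hN he he' hz
    refine ⟨a, ha, (∑ i, ⟨c i / x ^ e, le_Loc _ P (he i)⟩ * ⟨p i, le_Loc _ P (hp i)⟩) - b, I0.sub_mem (Ideal.sum_mem _ fun i _ => Ideal.mul_mem_right _ _ (self_CI i)) hb, ?_⟩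
    push_cast
    have : ∑ i, c i / (x : K) ^ e * p i = (a - x ^ e * z) / x ^ e := by
      rw [e1, Finset.sum_div]; exact Finset.sum_congr rfl fun i _ => by ring
    rw [this]
    field_simp
    ring
  have he1 : e ≠ 0 := by
    rintro rfl
    obtain ⟨i, hi⟩ := he'
    apply hi
    have := hm (self_CI i)
    rw [h.max, Ideal.mem_span_pair] at this
    obtain ⟨a, b, hab⟩ := this
    have : (a * x + b * y : K) = c i := congrArg Subtype.val hab
    rw [← this]
    have : (a * x + b * y : K) / x ^ 0 / x = a + b * (y / x) := by field_simp
    rw [this]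
    exact Subring.add_mem _ (le_adj _ a.2) (Subring.mul_mem _ (le_adj _ b.2) (self_adj _))
  refine bd_drop I0 (PhiI A (Loc _ P) (x ^ e) hAR) ?_ ?_ n0 I0 le_rfl (bd_mono ?_ hB)
  · intro I J hI hIJ
    refine lt_of_le_of_ne (fun a ⟨h1, h2⟩ => ⟨h1, hIJ.le h2⟩) fun heq => ?_
    obtain ⟨w, hwJ, hwI⟩ := SetLike.exists_of_lt hIJ
    obtain ⟨a, ha, b, hb, e1⟩ := key w w.2
    have hmem : a / x ^ e ∈ Loc _ P := by rw [e1]; exact (w + b).2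
    have e2 : (⟨_, hmem⟩ : Loc _ P) = w + b := Subtype.ext e1
    have hJ : (⟨a, ha⟩ : A) ∈ PhiI A (Loc _ P) (x ^ e) hAR J := ⟨hmem, by rw [e2]; exact J.add_mem hwJ (hIJ.le (hI hb))⟩
    rw [← heq] at hJ
    obtain ⟨_, hJ⟩ := hJ
    simp only [e2] at hJ
    exact hwI ((I.add_mem_iff_left (hI hb)).1 hJ)
  · intro htop
    have : (1 : A) ∈ PhiI A (Loc _ P) (x ^ e) hAR ⊤ := by rw [htop]; trivial
    obtain ⟨h1, -⟩ := this
    have : ((1 : A) : K) / x ∈ Loc _ P := by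
      obtain ⟨f, rfl⟩ := Nat.exists_eq_succ_of_ne_zero he1
      have : ((1 : A) : K) / x = ((1 : A) : K) / x ^ (f + 1) * x ^ f := by field_simp; ring
      rw [this]
      exact Subring.mul_mem _ h1 (Subring.pow_mem _ (hAR x.2) _)
    have := h.pr1.div_Loc P hP (Subring.one_mem _) this
    exact h.pr1.inv (by simpa using this)
  · refine Ideal.span_le.2 ?_
    rintro _ ⟨i, rfl⟩
    exact ⟨le_Loc _ P (he i), self_CI i⟩

theorem RLR2.core (m : ℕ) : ∀ (A : Subring K) [IsLocalRing A] [IsNoetherianRing A] (x y : A) (c : Fin n → K),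
    RLR2 A x y → Normal A → (∀ z : K, ∃ a ∈ A, a ≠ 0 ∧ a * z ∈ A) → Rel u c → ∀ hc : ∀ i, c i ∈ A, ∀ N,
    maximalIdeal A ^ N ≤ CI hc → Bd (CI hc) m → Surj u A := by
  induction m using Nat.strong_induction_on with
  | _ m ih =>
  intro A _ _ x y c h hA hF hR hc N hN hB
  by_cases hm : CI hc ≤ maximalIdeal A
  swap
  · have : ∃ k, (⟨c k, hc k⟩ : A) ∉ maximalIdeal A := by
      by_contra! hcon
      exact hm (Ideal.span_le.2 (by rintro _ ⟨i, rfl⟩; exact hcon i))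
    obtain ⟨k, hk⟩ := this
    obtain ⟨b, hb⟩ := (not_not.1 hk : IsUnit _).exists_left_inv
    have hb' : (b * c k : K) = 1 := congrArg Subtype.val hb
    have hck : c k ≠ 0 := fun h0 => by simp [h0] at hb'
    refine hR.base hA k hck fun i => ?_
    have : c i / c k = c i * b := by field_simp; linear_combination (-(c i)) * hb'
    rw [this]; exact A.mul_mem (hc i) b.2
  have chart : ∀ x y : A, RLR2 A x y → Surj u (adj A (y / x : K)) := by
    intro x y h
    have hx := h.x0
    obtain ⟨e, he, he'⟩ := h.exists_e hc hN
    refine loc_glob fun P _ => ?_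
    have hsc : Rel u (fun i => c i / (x : K) ^ e) := hR.scale (pow_ne_zero _ hx)
    by_cases hP : (⟨x, le_adj _ x.2⟩ : adj A (y / x : K)) ∈ P
    · obtain ⟨_, x', y', h', N', hN', -⟩ := h.locA hc hN he he' P hP
      obtain ⟨k, hk, hBk⟩ := h.drop hc hN he he' hm hB P hP
      refine ih k hk (Loc _ P) x' y' _ h' (normal_Loc (h.normal1 hA) P) (fun z => ?_) hsc _ N' hN' hBk
      obtain ⟨a, ha, ha0, haz⟩ := hF z
      exact ⟨a, le_Loc _ P (le_adj _ ha), ha0, le_Loc _ P (le_adj _ haz)⟩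
    · have h1 := h.x_CI hc hN (le_adj _) he
      have : ∃ k, (⟨_, he k⟩ : adj A (y / x : K)) ∉ P := by
        by_contra! hcon
        apply hP
        have : CI he ≤ P := Ideal.span_le.2 (by rintro _ ⟨i, rfl⟩; exact hcon i)
        refine Ideal.IsPrime.mem_of_pow_mem inferInstance N ?_
        exact this h1
      obtain ⟨k, hk⟩ := this
      have hck : c k / (x : K) ^ e ≠ 0 := fun h0 => hk (by convert P.zero_mem; exact h0)
      refine hsc.base (normal_Loc (h.normal1 hA) P) k hck fun i => ?_
      refine mem_Loc.2 ⟨_, hk, ?_⟩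
      have : c k / (x : K) ^ e * (c i / (x : K) ^ e / (c k / (x : K) ^ e)) = c i / (x : K) ^ e := by
        rw [mul_div_cancel₀ _ hck]
      simp only
      rw [this]
      exact he i
  have hx := h.x0
  have hy := h.y0
  obtain ⟨e, he, he'⟩ := h.exists_e hc hN
  refine glue hR (RLR2.le1 x y) h.le2 (fun z hz => h.split hz) (fun z h1 h2 => h.inter h1 h2) (le_adj _) (le_adj _) (fun w => ?_)
    (chart x y h) (chart y x h.symm) (h.normal12 hA) (pow_ne_zero e hx) (fun i => RLR2.le1 x y (he i)) (fun q hq => h.prim12 hF hc hN he he' q hq)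
  refine B1_inter (y / x : K) (fun T h1 h2 => adj_le T h1 h2) (fun T h1 h2 => adj_le T h1 ?_)
  rw [← inv_div]; exact h2

end Core
end

section
set_option maxHeartbeats 1000000
set_option synthInstance.maxHeartbeats 400000

open MvPolynomial IsLocalRing
namespace Core
section
variable {A : Type} [CommRing A] [IsLocalRing A] [IsNoetherianRing A]

theorem no_pow (hdim : ringKrullDim A = 2) {x y z : A} (h : maximalIdeal A = Ideal.span {x, y}) (k : ℕ)
    (hx : z ∣ x) (hy : z ∣ y ^ k) (hz : z ∈ maximalIdeal A) : False := by
  have hmin : maximalIdeal A ∈ (Ideal.span {z}).minimalPrimes := by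
    refine ⟨⟨inferInstance, by rwa [Ideal.span_singleton_le_iff_mem]⟩, ?_⟩
    rintro q ⟨hq, hzq⟩ -
    rw [Ideal.span_singleton_le_iff_mem] at hzq
    rw [h, Ideal.span_le]
    rintro _ (rfl | rfl)
    · exact Ideal.mem_of_dvd _ hx hzq
    · exact hq.mem_of_pow_mem k (Ideal.mem_of_dvd _ hy hzq)
  have h1 := Ideal.height_le_one_of_isPrincipal_of_mem_minimalPrimes _ _ hmin
  have h2 := IsLocalRing.maximalIdeal_height_eq_ringKrullDim (R := A)
  rw [hdim] at h2
  have h3 : (maximalIdeal A).height = 2 := WithBot.coe_injective h2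
  rw [h3] at h1
  exact absurd h1 (by decide)

theorem span_prime (hdim : ringKrullDim A = 2) {x y : A} (h : maximalIdeal A = Ideal.span {x, y}) : (Ideal.span {x}).IsPrime := by
  have hxm : x ∈ maximalIdeal A := by rw [h]; exact Ideal.subset_span (by simp)
  have key : ∀ a, a ∉ Ideal.span {x} → ∃ n, ∃ v, IsUnit v ∧ x ∣ a - y ^ n * v := by
    intro a ha
    have hne : Ideal.span {x} ≠ ⊤ := fun ht => by
      have : Ideal.span {x} ≤ maximalIdeal A := by rwa [Ideal.span_singleton_le_iff_mem]
      rw [ht] at this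
      exact (maximalIdeal.isMaximal A).ne_top (top_le_iff.1 this)
    have : Nontrivial (A ⧸ Ideal.span {x}) := Ideal.Quotient.nontrivial_iff.2 hne
    have : IsLocalRing (A ⧸ Ideal.span {x}) := IsLocalRing.of_surjective' _ Ideal.Quotient.mk_surjective
    have hinf := Ideal.iInf_pow_eq_bot_of_isLocalRing (maximalIdeal (A ⧸ Ideal.span {x})) (maximalIdeal.isMaximal _).ne_top
    have hmem : ∀ n, y ^ n ∣ a → True := fun _ _ => trivial
    by_contra! hcon
    apply ha
    rw [← Ideal.Quotient.eq_zero_iff_mem, ← Ideal.mem_bot, ← hinf, Ideal.mem_iInf]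
    have : ∀ n, ∃ v, x ∣ a - y ^ n * v := by
      intro n
      induction n with
      | zero => exact ⟨a, by simp⟩
      | succ n ih =>
        obtain ⟨v, hv⟩ := ih
        have hvm : v ∈ maximalIdeal A := fun hu => hcon n v hu hv
        rw [h, Ideal.mem_span_pair] at hvm
        obtain ⟨p, q, rfl⟩ := hvm
        refine ⟨q, ?_⟩
        have : a - y ^ (n + 1) * q = (a - y ^ n * (p * x + q * y)) + x * (y ^ n * p) := by ring
        rw [this]
        exact dvd_add hv (dvd_mul_right _ _)
    intro n
    obtain ⟨v, hv⟩ := this n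
    have hy : Ideal.Quotient.mk (Ideal.span {x}) y ∈ maximalIdeal (A ⧸ Ideal.span {x}) := by
      intro hu
      have hyu : IsUnit y := by
        obtain ⟨b, hb⟩ := hu.exists_right_inv
        obtain ⟨b, rfl⟩ := Ideal.Quotient.mk_surjective b
        rw [← map_mul, ← map_one (Ideal.Quotient.mk (Ideal.span {x})), Ideal.Quotient.eq] at hb
        have h1 : y * b - 1 ∈ maximalIdeal A := (Ideal.span_singleton_le_iff_mem _).2 hxm hb
        by_contra hy
        have h2 : y * b ∈ maximalIdeal A := Ideal.mul_mem_right _ _ hy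
        have := (Ideal.sub_mem _ h2 h1)
        rw [sub_sub_cancel] at this
        exact this isUnit_one
      have : y ∈ maximalIdeal A := by rw [h]; exact Ideal.subset_span (by simp)
      exact this hyu
    have e1 : Ideal.Quotient.mk (Ideal.span {x}) a = Ideal.Quotient.mk (Ideal.span {x}) (y ^ n * v) :=
      Ideal.Quotient.eq.2 (Ideal.mem_span_singleton.2 hv)
    rw [e1, map_mul, map_pow]
    exact Ideal.mul_mem_right _ _ (Ideal.pow_mem_pow hy n)
  refine ⟨fun ht => ?_, fun {a b} hab => ?_⟩
  · have : Ideal.span {x} ≤ maximalIdeal A := by rwa [Ideal.span_singleton_le_iff_mem]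
    rw [ht] at this
    exact (maximalIdeal.isMaximal A).ne_top (top_le_iff.1 this)
  · by_contra! hcon
    obtain ⟨n, v, hv, p, hp⟩ := key a hcon.1
    obtain ⟨k, w, hw, q, hq⟩ := key b hcon.2
    obtain ⟨s, hs⟩ := Ideal.mem_span_singleton.1 hab
    refine no_pow hdim h (n + k) dvd_rfl ?_ hxm
    have hu := hv.mul hw
    rw [← hu.dvd_mul_right]
    refine ⟨s - p * b - (a - x * p) * q, ?_⟩
    have ea : y ^ n * v = a - x * p := by linear_combination (-1) * hp
    have eb : y ^ k * w = b - x * q := by linear_combination (-1) * hq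
    have : y ^ (n + k) * (v * w) = (y ^ n * v) * (y ^ k * w) := by ring
    rw [this, ea, eb]
    linear_combination hs

theorem exists_rlr2 (hdim : ringKrullDim A = 2) (hreg : ∃ x y : A, Ideal.span {x, y} = maximalIdeal A) :
    IsDomain A ∧ ∃ x y : A, RLR2 A x y := by
  obtain ⟨x, y, h⟩ := hreg
  have hy : y ∈ maximalIdeal A := by rw [← h]; exact Ideal.subset_span (by simp)
  have hx : x ∈ maximalIdeal A := by rw [← h]; exact Ideal.subset_span (by simp)
  have hgen : ∀ n : ℕ, maximalIdeal A = Ideal.span {x + y ^ (n + 1), y} := by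
    intro n
    rw [← h]
    apply le_antisymm <;> rw [Ideal.span_le] <;> rintro _ (rfl | rfl)
    · exact Ideal.mem_span_pair.2 ⟨1, - y ^ n, by ring⟩
    · exact Ideal.subset_span (by simp)
    · exact Ideal.mem_span_pair.2 ⟨1, y ^ n, by ring⟩
    · exact Ideal.subset_span (by simp)
  have hinj : Function.Injective fun n : ℕ => Ideal.span {x + y ^ (n + 1)} := by
    have : ∀ n k : ℕ, n < k → Ideal.span {x + y ^ (n + 1)} ≠ Ideal.span {x + y ^ (k + 1)} := by
      intro n k hnk heq
      obtain ⟨d, rfl⟩ := Nat.exists_eq_add_of_lt hnk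
      have h1 : x + y ^ (n + 1) ∣ x + y ^ (n + d + 1 + 1) := by
        rw [← Ideal.mem_span_singleton, heq]; exact Ideal.mem_span_singleton_self _
      have hu : IsUnit (1 - y ^ (d + 1)) := by
        by_contra hcon
        have := Ideal.add_mem (maximalIdeal A) (show 1 - y ^ (d + 1) ∈ maximalIdeal A from hcon) (Ideal.pow_mem_of_mem _ hy (d + 1) (by omega))
        rw [sub_add_cancel] at this
        exact this isUnit_one
      have h2 : x + y ^ (n + 1) ∣ y ^ (n + 1) := by
        rw [← hu.dvd_mul_right]
        have : y ^ (n + 1) * (1 - y ^ (d + 1)) = (x + y ^ (n + 1)) - (x + y ^ (n + d + 1 + 1)) := by ring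
        rw [this]; exact dvd_sub dvd_rfl h1
      exact no_pow hdim (hgen n) (n + 1) dvd_rfl h2 (by rw [hgen n]; exact Ideal.subset_span (by simp))
    intro n k hnk
    by_contra hne
    rcases lt_or_gt_of_ne hne with h1 | h1
    · exact this n k h1 hnk
    · exact this k n h1 hnk.symm
  have hex : ∃ n : ℕ, Ideal.span {x + y ^ (n + 1)} ∉ minimalPrimes A := by
    by_contra! hcon
    exact Set.infinite_of_injective_forall_mem hinj hcon (minimalPrimes.finite_of_isNoetherianRing A)
  obtain ⟨n, hn⟩ := hex
  set x' := x + y ^ (n + 1) with hx'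
  have hp := span_prime hdim (hgen n)
  have hx'm : x' ∈ maximalIdeal A := by rw [hgen n]; exact Ideal.subset_span (by simp [hx'])
  obtain ⟨q, hq, hqp⟩ := Ideal.exists_minimalPrimes_le (I := (⊥ : Ideal A)) (J := Ideal.span {x'}) bot_le
  have hqp' : q < Ideal.span {x'} := lt_of_le_of_ne hqp fun he => hn (he ▸ hq)
  have hqpr : q.IsPrime := hq.1.1
  have hxq : x' ∉ q := fun hh => hqp'.not_ge ((Ideal.span_singleton_le_iff_mem _).2 hh)
  have hq0 : q = ⊥ := by
    refine Submodule.eq_bot_of_le_smul_of_le_jacobson_bot (Ideal.span {x'}) q (IsNoetherian.noetherian q) ?_ ?_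
    · intro a ha
      obtain ⟨b, rfl⟩ := Ideal.mem_span_singleton.1 (hqp ha)
      rw [Ideal.smul_eq_mul]
      exact Ideal.mul_mem_mul (Ideal.mem_span_singleton_self _) ((hqpr.mem_or_mem ha).resolve_left hxq)
    · rw [Ideal.span_singleton_le_iff_mem, IsLocalRing.jacobson_eq_maximalIdeal _ bot_ne_top]
      exact hx'm
  have hdom : IsDomain A := by
    rw [hq0] at hqpr
    exact (IsDomain.of_bot_isPrime A)
  have hx0 : x' ≠ 0 := fun h0 => hxq (by rw [h0]; exact q.zero_mem)
  refine ⟨hdom, x', y, hgen n, (Ideal.span_singleton_prime hx0).1 hp, fun hd => ?_⟩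
  exact no_pow hdim (hgen n) 1 dvd_rfl (by simpa using hd) hx'm

end
end Core
end

section
set_option maxHeartbeats 1000000
set_option synthInstance.maxHeartbeats 400000

open MvPolynomial IsLocalRing
namespace Core
section
variable {A : Type} [CommRing A] 

noncomputable def evA {n r : ℕ} (u : Fin n → Fin r → A) : MvPolynomial (Fin n) A →ₐ[A] MvPolynomial (Fin r) A :=
  aeval (fun j => emb A r (u j))

theorem evA_emb {n r : ℕ} (u : Fin n → Fin r → A) (a : Fin n → A) : evA u (emb A n a) = emb A r (∑ j, a j • u j) := by
  simp only [emb, evA, Fintype.linearCombination_apply, map_sum, map_smul, aeval_X]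

theorem coeff_emb {r : ℕ} (w : Fin r → A) (i : Fin r) : coeff (Finsupp.single i 1) (emb A r w) = w i := by
  classical
  rw [emb, Fintype.linearCombination_apply, coeff_sum, Finset.sum_eq_single i]
  · simp
  · intro j _ hj
    rw [coeff_smul, coeff_X, if_neg, smul_zero]
    intro h
    exact hj ((Finsupp.single_left_inj one_ne_zero).1 h)
  · simp

theorem embA_inj {r : ℕ} : Function.Injective (emb A r) := fun w w' h => by
  ext i; rw [← coeff_emb w, h, coeff_emb]

theorem emb_hom {r : ℕ} (w : Fin r → A) : (emb A r w).IsHomogeneous 1 := by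
  rw [emb, Fintype.linearCombination_apply]
  refine IsHomogeneous.sum _ _ _ fun i _ => ?_
  rw [smul_eq_C_mul]
  simpa using (isHomogeneous_C (Fin r) (w i)).mul (isHomogeneous_X A i)

theorem evA_hom {n r : ℕ} (u : Fin n → Fin r → A) {G : MvPolynomial (Fin n) A} {d : ℕ} (hG : G.IsHomogeneous d) : (evA u G).IsHomogeneous d := by
  have := hG.aeval (fun j => emb A r (u j)) (fun i => emb_hom (u i))
  rwa [one_mul] at this

theorem evA_comp {n r : ℕ} (u : Fin n → Fin r → A) (G : MvPolynomial (Fin n) A) (d : ℕ) :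
    evA u (homogeneousComponent d G) = homogeneousComponent d (evA u G) := by
  conv_rhs => rw [← sum_homogeneousComponent G, map_sum, map_sum]
  have : ∀ i, homogeneousComponent d (evA u (homogeneousComponent i G)) = if i = d then evA u (homogeneousComponent d G) else 0 := by
    intro i
    rw [homogeneousComponent_of_mem (evA_hom u (homogeneousComponent_isHomogeneous i G))]
    split_ifs with h1 h2 h2
    · rw [h1]
    · exact absurd h1.symm h2
    · exact absurd h2.symm h1
    · rfl
  rw [Finset.sum_congr rfl fun i _ => this i, Finset.sum_ite_eq']
  split_ifs with h
  · rfl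
  · rw [homogeneousComponent_eq_zero, map_zero]
    simpa using h

variable [IsLocalRing A] [IsNoetherianRing A] [IsDomain A]  

theorem RLR2.exists_unit {x y : A} (h : RLR2 A x y) {n r : ℕ} (hn : r + 2 ≤ n) (u : Fin n → Fin r → A) :
    ∃ d, 0 < d ∧ ∃ H : MvPolynomial (Fin n) A, H.IsHomogeneous d ∧ evA u H = 0 ∧ ∃ m, IsUnit (coeff m H) := by
  obtain ⟨a, ha, i0, hi0⟩ : ∃ g : Fin n → A, ∑ i, g i • u i = 0 ∧ ∃ i, g i ≠ 0 := by
    rw [← Fintype.not_linearIndependent_iff]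
    intro hl
    have := hl.fintype_card_le_finrank
    simp at this
    omega
  let u' : Fin n → Fin (r + 1) → A := fun j => Fin.cons ((Pi.single i0 1 : Fin n → A) j) (u j)
  obtain ⟨b, hb, j0, hj0⟩ : ∃ g : Fin n → A, ∑ i, g i • u' i = 0 ∧ ∃ i, g i ≠ 0 := by
    rw [← Fintype.not_linearIndependent_iff]
    intro hl
    have := hl.fintype_card_le_finrank
    simp at this
    omega
  let q1 := RingHom.ker (evA u')
  let q := RingHom.ker (evA u)
  have hq1 : q1.IsPrime := RingHom.ker_isPrime _
  have hq : q.IsPrime := RingHom.ker_isPrime _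
  let mm := RingHom.ker (MvPolynomial.map (σ := Fin n) (residue A))
  have hmm : mm.IsPrime := RingHom.ker_isPrime _
  have hle : q1 ≤ q := by
    intro G hG
    have e : (aeval (Fin.cons 0 X : Fin (r + 1) → MvPolynomial (Fin r) A)).comp (evA u') = evA u := by
      ext1 j
      simp only [evA, AlgHom.comp_apply, aeval_X, u', emb, Fintype.linearCombination_apply, Fin.sum_univ_succ,
        Fin.cons_zero, Fin.cons_succ]
      rw [map_add, map_smul, map_sum]
      simp only [map_smul, aeval_X, Fin.cons_zero, Fin.cons_succ, smul_zero, zero_add]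
    rw [RingHom.mem_ker, ← e, AlgHom.comp_apply, (RingHom.mem_ker.1 hG), map_zero]
  have hlt1 : ⊥ < q1 := by
    rw [bot_lt_iff_ne_bot]
    intro h0
    have : emb A n b ∈ q1 := by rw [RingHom.mem_ker, evA_emb, hb, map_zero]
    rw [h0, Ideal.mem_bot] at this
    exact hj0 (congrFun (embA_inj (this.trans (map_zero _).symm)) j0)
  have hlt2 : q1 < q := by
    refine lt_of_le_of_ne hle fun heq => ?_
    have : emb A n a ∈ q := by rw [RingHom.mem_ker, evA_emb, ha, map_zero]
    rw [← heq, RingHom.mem_ker, evA_emb] at this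
    have := congrFun (embA_inj (this.trans (map_zero _).symm)) 0
    simp only [u', Finset.sum_apply, Pi.smul_apply, Fin.cons_zero, smul_eq_mul, Pi.zero_apply] at this
    rw [Finset.sum_eq_single i0 (fun j _ hj => by simp [hj]) (by simp)] at this
    simp at this
    exact hi0 this
  have hht : mm.height ≤ 2 := by
    have e : mm = Ideal.span {C x, C y} := by
      simp only [mm]
      rw [MvPolynomial.ker_map, IsLocalRing.ker_residue, h.max, Ideal.map_span, Set.image_pair]
    have := Ideal.height_le_card_of_mem_minimalPrimes_span (p := mm) (s := {C x, C y}) (Set.toFinite _) (by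
      rw [← e]
      rw [Ideal.minimalPrimes_eq_subsingleton_self]; rfl)
    refine this.trans ?_
    have h2 : ({C x, C y} : Set (MvPolynomial (Fin n) A)).ncard ≤ 2 := (Set.ncard_insert_le _ _).trans (by rw [Set.ncard_singleton])
    exact_mod_cast h2
  have hnle : ¬ q ≤ mm := by
    intro hle
    have hlt3 : q < mm := by
      refine lt_of_le_of_ne hle fun heq => ?_
      have : C x ∈ mm := by
        rw [RingHom.mem_ker, MvPolynomial.map_C, (residue_eq_zero_iff x).2 h.mem_x, C_0]
      rw [← heq, RingHom.mem_ker, evA, aeval_C, algebraMap_eq, C_eq_zero] at this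
      exact h.px.ne_zero this
    have := Ideal.height_add_one_le_of_lt_of_isPrime hlt1
    have h2 := Ideal.height_add_one_le_of_lt_of_isPrime hlt2
    have h3 := Ideal.height_add_one_le_of_lt_of_isPrime hlt3
    have h4 : (0 : ℕ∞) + 1 + 1 + 1 ≤ 2 := 
      le_trans (add_le_add_left (le_trans (add_le_add_left (le_trans (add_le_add_left zero_le 1) this) 1) h2) 1) (le_trans h3 hht)
    exact absurd h4 (by decide)
  obtain ⟨G, hG, hGm⟩ := SetLike.not_le_iff_exists.1 hnle
  have : ∃ m, IsUnit (coeff m G) := by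
    by_contra! hcon
    apply hGm
    rw [RingHom.mem_ker]
    ext m
    rw [coeff_map, coeff_zero, residue_eq_zero_iff]
    exact hcon m
  obtain ⟨m, hm⟩ := this
  have hH : evA u (homogeneousComponent m.degree G) = 0 := by
    rw [evA_comp, (RingHom.mem_ker.1 hG), map_zero]
  have hcm : coeff m (homogeneousComponent m.degree G) = coeff m G := by
    rw [coeff_homogeneousComponent, if_pos rfl]
  refine ⟨m.degree, Nat.pos_of_ne_zero fun h0 => ?_, _, homogeneousComponent_isHomogeneous _ G, hH, m, by rwa [hcm]⟩
  rw [Finsupp.degree_eq_zero_iff] at h0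
  subst h0
  simp only [map_zero, homogeneousComponent_zero, evA, aeval_C, algebraMap_eq, C_eq_zero] at hH
  rw [hH] at hm
  exact not_isUnit_zero hm

end
end Core
end

section
set_option maxHeartbeats 1000000
set_option synthInstance.maxHeartbeats 400000

open MvPolynomial IsLocalRing
namespace Core
section
variable {A : Type} [CommRing A] 

theorem isInt_trans {S : Type*} [CommRing S] {D D' : Subring S} (h : ∀ d ∈ D, IsIntegral D' d) {s : S} (hs : IsIntegral D s) :
    IsIntegral D' s := by
  have h1 : D ≤ (integralClosure D' S).toSubring := fun d hd => h d hd
  have h2 := isInt_mono h1 hs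
  exact isIntegral_trans (A := integralClosure D' S) s h2

noncomputable def DA {n r : ℕ} (u : Fin n → Fin r → A) : Subring (MvPolynomial (Fin r) A) :=
  (evA u : MvPolynomial (Fin n) A →+* MvPolynomial (Fin r) A).range

theorem mem_DA {n r : ℕ} {u : Fin n → Fin r → A} {s} : s ∈ DA u ↔ ∃ G, evA u G = s := Iff.rfl

theorem u_mem_DA {n r : ℕ} (u : Fin n → Fin r → A) (j) : emb A r (u j) ∈ DA u := ⟨X j, by simp [evA]⟩
theorem C_mem_DA {n r : ℕ} (u : Fin n → Fin r → A) (a) : C a ∈ DA u := ⟨C a, by simp [evA]⟩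

theorem DA_ind {n r : ℕ} {u : Fin n → Fin r → A} (T : Subring (MvPolynomial (Fin r) A)) (hC : ∀ a, C a ∈ T) (hu : ∀ j, emb A r (u j) ∈ T) :
    DA u ≤ T := by
  rintro _ ⟨p, rfl⟩
  induction p using MvPolynomial.induction_on with
  | C a => simpa [evA] using hC a
  | add p q hp hq => rw [map_add]; exact T.add_mem hp hq
  | mul_X p i hp => rw [map_mul]; exact T.mul_mem hp (by simpa [evA] using hu i)

theorem DA_int {n r : ℕ} {u : Fin n → Fin r → A} (D : Subring (MvPolynomial (Fin r) A)) (hC : ∀ a, C a ∈ D) (hu : ∀ j, IsIntegral D (emb A r (u j))) :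
    ∀ d ∈ DA u, IsIntegral D d := 
  fun d hd => DA_ind (integralClosure D (MvPolynomial (Fin r) A)).toSubring (fun a => isInt_self (hC a)) hu hd

/-- degree and top coefficient of a homogeneous polynomial evaluated at linear polynomials -/
theorem hom_eval_top {n : ℕ} {S : Type} [CommRing S] [Algebra A S] {H : MvPolynomial (Fin n) A} {d : ℕ} (hH : H.IsHomogeneous d)
    (p : Fin n → Polynomial S) (hp : ∀ i, (p i).natDegree ≤ 1) :
    (aeval p H).natDegree ≤ d ∧ (aeval p H).coeff d = aeval (fun i => (p i).coeff 1) H := by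
  have hmon : ∀ m : Fin n →₀ ℕ, m.degree = d → (∏ i, p i ^ m i).natDegree ≤ d ∧ (∏ i, p i ^ m i).coeff d = ∏ i, (p i).coeff 1 ^ m i := by
    intro m hm
    have key : ∀ s : Finset (Fin n), (∏ i ∈ s, p i ^ m i).natDegree ≤ ∑ i ∈ s, m i ∧ (∏ i ∈ s, p i ^ m i).coeff (∑ i ∈ s, m i) = ∏ i ∈ s, (p i).coeff 1 ^ m i := by
      intro s
      induction s using Finset.induction_on with
      | empty => simp
      | insert i s hi ih =>
        rw [Finset.prod_insert hi, Finset.sum_insert hi, Finset.prod_insert hi]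
        have h1 : (p i ^ m i).natDegree ≤ m i := by
          have := Polynomial.natDegree_pow_le_of_le (m i) (hp i)
          simpa using this
        refine ⟨Polynomial.natDegree_mul_le_of_le h1 ih.1, ?_⟩
        rw [Polynomial.coeff_mul_add_eq_of_natDegree_le h1 ih.1, ih.2]
        congr 1
        simpa using Polynomial.coeff_pow_of_natDegree_le (m := m i) (hp i)
    have := key Finset.univ
    rw [Finsupp.degree_eq_sum] at hm
    rwa [hm] at this
  rw [aeval_def, aeval_def, eval₂_eq', eval₂_eq']
  have hd : ∀ m ∈ H.support, m.degree = d := fun m hm => by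
    have := hH (mem_support_iff.1 hm)
    rw [← this, Finsupp.degree_eq_weight_one]
    rfl
  constructor
  · refine Polynomial.natDegree_sum_le_of_forall_le _ _ fun m hm => ?_
    rw [Polynomial.algebraMap_apply]
    exact (Polynomial.natDegree_C_mul_le _ _).trans (hmon m (hd m hm)).1
  · rw [Polynomial.finset_sum_coeff]
    refine Finset.sum_congr rfl fun m hm => ?_
    rw [Polynomial.algebraMap_apply, Polynomial.coeff_C_mul, (hmon m (hd m hm)).2]

variable [IsLocalRing A] [IsNoetherianRing A] [IsDomain A]  

/-- good tuples -/
def Good {r : ℕ} (M : Submodule A (Fin r → A)) {n : ℕ} (u : Fin n → Fin r → A) : Prop :=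
  (∀ i, u i ∈ M) ∧ ∀ w ∈ M, IsIntegral (DA u) (emb A r w)

theorem RLR2.step {x y : A} (h : RLR2 A x y) (hres : Infinite (ResidueField A)) {n r : ℕ} (hn : r + 1 ≤ n) {M : Submodule A (Fin r → A)} {u : Fin (n + 1) → Fin r → A}
    (hu : Good M u) : ∃ u' : Fin n → Fin r → A, Good M u' := by
  obtain ⟨d, hd, H, hH, hev, m, hm⟩ := h.exists_unit (by omega) u
  have hH0 : MvPolynomial.map (residue A) H ≠ 0 := by
    intro h0
    have : coeff m (MvPolynomial.map (residue A) H) = 0 := by rw [h0, coeff_zero]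
    rw [coeff_map, residue_eq_zero_iff] at this
    exact this hm
  have : ∃ l : Fin (n + 1) → A, IsUnit (aeval l H) := by
    have : ∃ l : Fin (n + 1) → ResidueField A, eval l (MvPolynomial.map (residue A) H) ≠ 0 := by
      by_contra! hcon
      exact hH0 (MvPolynomial.funext fun l => by rw [hcon l, map_zero])
    obtain ⟨l, hl⟩ := this
    choose l' hl' using fun i => residue_surjective (l i)
    refine ⟨l', ?_⟩
    by_contra hcon
    have := (residue_eq_zero_iff (aeval l' H)).2 hcon
    apply hl
    rw [← this, eval_map, aeval_def, hom_eval₂]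
    congr 1
    ext i; simp [hl']
  obtain ⟨l, hl⟩ := this
  have : ∃ j, IsUnit (l j) := by
    by_contra! hcon
    have hmem : ∀ i, l i ∈ maximalIdeal A := hcon
    apply (mem_maximalIdeal _).1 _ hl
    rw [aeval_def, eval₂_eq']
    refine Ideal.sum_mem _ fun k hk => Ideal.mul_mem_left _ _ ?_
    have hk1 : k.degree = d := by
      have := hH (mem_support_iff.1 hk)
      rw [← this, Finsupp.degree_eq_weight_one]
      rfl
    have : ∃ i, k i ≠ 0 := by
      by_contra! h0
      have : k = 0 := Finsupp.ext h0
      rw [this, map_zero] at hk1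
      omega
    obtain ⟨i, hi⟩ := this
    rw [← Finset.mul_prod_erase _ _ (Finset.mem_univ i)]
    exact Ideal.mul_mem_right _ _ (Ideal.pow_mem_of_mem _ (hmem i) _ (Nat.pos_of_ne_zero hi))
  obtain ⟨j, hj⟩ := this
  let w : Fin (n + 1) → Fin r → A := fun i => l j • u i - l i • u j
  have hwj : w j = 0 := by simp [w]
  let u' : Fin n → Fin r → A := fun i => w (j.succAbove i)
  refine ⟨u', fun i => M.sub_mem (M.smul_mem _ (hu.1 _)) (M.smul_mem _ (hu.1 _)), ?_⟩
  have hwD : ∀ i, emb A r (w i) ∈ DA u' := by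
    intro i
    rcases Fin.eq_self_or_eq_succAbove j i with rfl | ⟨i', rfl⟩
    · rw [hwj, map_zero]; exact Subring.zero_mem _
    · exact u_mem_DA u' i'
  letI : Algebra A (DA u') := RingHom.toAlgebra ((C : A →+* MvPolynomial (Fin r) A).codRestrict (DA u') (C_mem_DA u'))
  let p : Fin (n + 1) → Polynomial (DA u') := fun i => Polynomial.C ⟨_, hwD i⟩ + Polynomial.C (algebraMap A (DA u') (l i)) * Polynomial.X
  have hp1 : ∀ i, (p i).natDegree ≤ 1 := fun i => by
    simp only [p]
    compute_degree
  obtain ⟨hP1, hP2⟩ := hom_eval_top hH p hp1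
  have hc1 : (fun i => (p i).coeff 1) = fun i => algebraMap A (DA u') (l i) := by
    ext1 i; simp [p, Polynomial.coeff_C]
  rw [hc1] at hP2
  have hP2' : (aeval p H).coeff d = algebraMap A (DA u') (aeval l H) := by
    rw [hP2, aeval_def, aeval_def, hom_eval₂]; rfl
  have huj : IsIntegral (DA u') (emb A r (u j)) := by
    obtain ⟨b, hb⟩ := hl.exists_left_inv
    let P := Polynomial.C (algebraMap A (DA u') b) * aeval p H
    refine ⟨P, Polynomial.monic_of_natDegree_le_of_coeff_eq_one d ((Polynomial.natDegree_C_mul_le _ _).trans hP1) ?_, ?_⟩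
    · rw [Polynomial.coeff_C_mul, hP2', ← map_mul, hb, map_one]
    · have e1 : Polynomial.eval₂ (algebraMap (DA u') (MvPolynomial (Fin r) A)) (emb A r (u j)) (aeval p H) = 0 := by
        have e2 : ∀ i, Polynomial.eval₂ (algebraMap (DA u') (MvPolynomial (Fin r) A)) (emb A r (u j)) (p i) = C (l j) * emb A r (u i) := by
          intro i
          have : algebraMap (DA u') (MvPolynomial (Fin r) A) (algebraMap A (DA u') (l i)) = C (l i) := rfl
          simp only [p, Polynomial.eval₂_add, Polynomial.eval₂_mul, Polynomial.eval₂_C, Polynomial.eval₂_X]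
          rw [this]
          change emb A r (w i) + _ = _
          simp only [w, map_sub, map_smul, smul_eq_C_mul]
          ring
        have e3 : Polynomial.eval₂ (algebraMap (DA u') (MvPolynomial (Fin r) A)) (emb A r (u j)) (aeval p H) = 
            aeval (fun i => C (l j) * emb A r (u i)) H := by
          rw [← Polynomial.coe_eval₂RingHom, aeval_def, hom_eval₂, aeval_def]
          congr 1
          · ext1 a
            rw [RingHom.comp_apply, Polynomial.algebraMap_apply, Polynomial.coe_eval₂RingHom, Polynomial.eval₂_C]
            rfl
          · ext1 i; exact e2 i
        have e4 : aeval (fun i => C (l j) * emb A r (u i)) H = C (l j) ^ d * evA u H := by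
          rw [evA, aeval_def, aeval_def, eval₂_eq', eval₂_eq', Finset.mul_sum]
          refine Finset.sum_congr rfl fun k hk => ?_
          have hk1 : ∑ i, k i = d := by
            rw [← Finsupp.degree_eq_sum]
            have := hH (mem_support_iff.1 hk)
            rw [← this, Finsupp.degree_eq_weight_one]
            rfl
          simp only [mul_pow]
          rw [Finset.prod_mul_distrib, Finset.prod_pow_eq_pow_sum, hk1]
          ring
        rw [e3, e4, hev, mul_zero]
      rw [Polynomial.eval₂_mul, e1, mul_zero]
  have hall : ∀ i, IsIntegral (DA u') (emb A r (u i)) := by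
    intro i
    obtain ⟨b, hb⟩ := hj.exists_left_inv
    have : emb A r (u i) = C b * (emb A r (w i) + C (l i) * emb A r (u j)) := by
      simp only [w, map_sub, map_smul, smul_eq_C_mul]
      have : (C b * C (l j) : MvPolynomial (Fin r) A) = 1 := by rw [← C_mul, hb, C_1]
      linear_combination (-(emb A r (u i))) * this
    rw [this]
    exact (isInt_self (C_mem_DA _ _)).mul ((isInt_self (hwD i)).add ((isInt_self (C_mem_DA _ _)).mul huj))
  intro v hv
  exact isInt_trans (DA_int _ (C_mem_DA _) hall) (hu.2 v hv)

theorem RLR2.exists_good {x y : A} (h : RLR2 A x y) (hres : Infinite (ResidueField A)) {r : ℕ} (M : Submodule A (Fin r → A)) :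
    ∃ u : Fin (r + 1) → Fin r → A, Good M u := by
  obtain ⟨k, g, hg⟩ := (Submodule.fg_iff_exists_fin_generating_family).1 (IsNoetherian.noetherian M)
  have start : Good M g := by
    refine ⟨fun i => by rw [← hg]; exact Submodule.subset_span ⟨i, rfl⟩, fun w hw => ?_⟩
    apply isInt_self
    rw [← hg, Submodule.mem_span_range_iff_exists_fun] at hw
    obtain ⟨a, rfl⟩ := hw
    rw [map_sum]
    refine Subring.sum_mem _ fun i _ => ?_
    rw [map_smul, smul_eq_C_mul]
    exact Subring.mul_mem _ (C_mem_DA _ _) (u_mem_DA _ _)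
  have up : ∀ n, (∃ u : Fin n → Fin r → A, Good M u) → ∃ u : Fin (n + 1) → Fin r → A, Good M u := by
    rintro n ⟨u, hu⟩
    refine ⟨Fin.cons 0 u, fun i => ?_, fun w hw => ?_⟩
    · refine Fin.cases ?_ (fun i => ?_) i
      · exact M.zero_mem
      · exact hu.1 i
    · refine isInt_mono (DA_ind _ (C_mem_DA _) fun j => ?_) (hu.2 w hw)
      have := u_mem_DA (Fin.cons 0 u : Fin (n + 1) → Fin r → A) j.succ
      simpa only [Fin.cons_succ] using this
  have down : ∀ d, (∃ u : Fin (r + 1 + d) → Fin r → A, Good M u) → ∃ u : Fin (r + 1) → Fin r → A, Good M u := by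
    intro d
    induction d with
    | zero => exact id
    | succ d ih =>
      rintro ⟨u, hu⟩
      exact ih (h.step hres (n := r + 1 + d) (by omega) (u := u) hu)
  apply down k
  have : ∀ d, ∃ u : Fin (k + d) → Fin r → A, Good M u := by
    intro d
    induction d with
    | zero => exact ⟨g, start⟩
    | succ d ih => exact up _ ih
  rw [Nat.add_comm]
  exact this (r + 1)

end
end Core
end

section
set_option maxHeartbeats 1000000
set_option synthInstance.maxHeartbeats 400000

open MvPolynomial IsLocalRing
namespace Core
section
variable {A : Type} [CommRing A]

theorem split_const {n : ℕ} (G : MvPolynomial (Fin n) A) : ∃ q : Fin n → MvPolynomial (Fin n) A, G = C (constantCoeff G) + ∑ j, X j * q j := by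
  induction G using MvPolynomial.induction_on with
  | C a => exact ⟨0, by simp⟩
  | add p q hp hq =>
    obtain ⟨f, hf⟩ := hp
    obtain ⟨g, hg⟩ := hq
    refine ⟨f + g, ?_⟩
    conv_lhs => rw [hf, hg]
    simp only [map_add, Pi.add_apply, mul_add, Finset.sum_add_distrib]
    ring
  | mul_X p i hp =>
    refine ⟨fun j => if j = i then p else 0, ?_⟩
    simp [mul_comm]

theorem hom_int {n r : ℕ} (u : Fin n → Fin r → A) (w : Fin r → A) (hw : IsIntegral (DA u) (emb A r w))
    (T : Subring (MvPolynomial (Fin r) A)) (hT : DA u ≤ T) (hs : emb A r w ∈ T) :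
    ∃ k, ∃ q : Fin n → MvPolynomial (Fin r) A, (∀ j, q j ∈ T) ∧ emb A r w ^ k = ∑ j, emb A r (u j) * q j := by
  obtain ⟨p, hp, hpe⟩ := hw
  set s := emb A r w with hsdef
  set k := p.natDegree with hk
  have h1 : ∀ i, ∃ G, evA u G = (p.coeff i : MvPolynomial (Fin r) A) := fun i => mem_DA.1 (p.coeff i).2
  choose G hG using h1
  have hsk : ∀ i, (s ^ i).IsHomogeneous i := fun i => by simpa using (emb_hom w).pow i
  -- homogeneous component of degree k
  have h2 : ∀ i ≤ k, homogeneousComponent k (evA u (G i) * s ^ i) = evA u (homogeneousComponent (k - i) (G i)) * s ^ i := by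
    intro i hi
    rw [evA_comp]
    conv_lhs => rw [← sum_homogeneousComponent (evA u (G i)), Finset.sum_mul, map_sum]
    have h3 : ∀ j, homogeneousComponent k (homogeneousComponent j (evA u (G i)) * s ^ i) =
        if j = k - i then homogeneousComponent (k - i) (evA u (G i)) * s ^ i else 0 := by
      intro j
      have h4 : (homogeneousComponent j (evA u (G i)) * s ^ i).IsHomogeneous (j + i) :=
        (homogeneousComponent_isHomogeneous j _).mul (hsk i)
      rw [homogeneousComponent_of_mem h4]
      by_cases h5 : j = k - i
      · rw [if_pos (by omega), if_pos h5, h5]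
      · rw [if_neg (by omega), if_neg h5]
    simp only [h3]
    rw [Finset.sum_ite_eq']
    split_ifs with h6
    · rfl
    · rw [homogeneousComponent_eq_zero _ _ (by simp at h6; omega), zero_mul]
  rw [Polynomial.eval₂_eq_sum_range, Finset.sum_range_succ] at hpe
  have h7 : (algebraMap (DA u) (MvPolynomial (Fin r) A)) (p.coeff p.natDegree) = 1 := by
    rw [hp.coeff_natDegree, map_one]
  rw [h7, one_mul] at hpe
  have h8 := congrArg (homogeneousComponent k) hpe
  rw [map_zero, map_add, map_sum, homogeneousComponent_of_mem (hsk k), if_pos rfl] at h8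
  have h9 : ∀ i ∈ Finset.range p.natDegree, homogeneousComponent k ((algebraMap (DA u) (MvPolynomial (Fin r) A)) (p.coeff i) * s ^ i)
     = evA u (homogeneousComponent (k - i) (G i)) * s ^ i := by
    intro i hi
    rw [← h2 i (by simp at hi; omega), hG]
    rfl
  rw [Finset.sum_congr rfl h9] at h8
  have h10 : ∀ i, ∃ q : Fin n → MvPolynomial (Fin n) A, homogeneousComponent (k - i) (G i) = C (constantCoeff (homogeneousComponent (k - i) (G i))) + ∑ j, X j * q j :=
    fun i => split_const _
  choose q hq using h10
  refine ⟨k, fun j => - ∑ i ∈ Finset.range p.natDegree, evA u (q i j) * s ^ i, fun j => ?_, ?_⟩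
  · exact T.neg_mem (T.sum_mem fun i _ => T.mul_mem (hT (mem_DA.2 ⟨_, rfl⟩)) (T.pow_mem hs i))
  · rw [eq_neg_of_add_eq_zero_right h8]
    simp only [mul_neg, Finset.sum_neg_distrib, Finset.mul_sum]
    rw [Finset.sum_comm]
    congr 1
    refine Finset.sum_congr rfl fun i hi => ?_
    have : constantCoeff (homogeneousComponent (k - i) (G i)) = 0 := by
      rw [constantCoeff_eq, coeff_homogeneousComponent, if_neg]
      simp at hi ⊢; omega
    have h11 := hq i
    rw [this, map_zero, zero_add] at h11
    rw [h11, map_sum, Finset.sum_mul]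
    refine Finset.sum_congr rfl fun j _ => ?_
    rw [map_mul]
    simp only [evA, aeval_X]
    ring
end
end Core
end

section
set_option maxHeartbeats 1000000
set_option synthInstance.maxHeartbeats 400000

open MvPolynomial IsLocalRing
namespace Core
section
variable {A : Type} [CommRing A] [IsLocalRing A] [IsNoetherianRing A] 

theorem pow_of_len {r : ℕ} (M : Submodule A (Fin r → A)) (hlen : ∃ n : ℕ, modLength A ((Fin r → A) ⧸ M) = (n : WithBot ℕ∞)) :
    ∃ N : ℕ, ∀ a ∈ maximalIdeal A ^ N, ∀ w : Fin r → A, a • w ∈ M := by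
  obtain ⟨n, hn⟩ := hlen
  have h1 : Module.length A ((Fin r → A) ⧸ M) ≠ ⊤ := by
    intro h
    have := Module.coe_length A ((Fin r → A) ⧸ M)
    rw [h] at this
    unfold modLength at hn
    rw [hn] at this
    exact absurd this (by 
      intro h
      have h2 := WithBot.coe_inj.1 h
      exact ENat.natCast_ne_top n h2.symm)
  have h2 : IsFiniteLength A ((Fin r → A) ⧸ M) := Module.length_ne_top_iff.1 h1
  have h3 := (isFiniteLength_iff_isNoetherian_isArtinian.1 h2)
  have := h3.1
  have := h3.2
  let f : ℕ →o (Submodule A ((Fin r → A) ⧸ M))ᵒᵈ := 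
    ⟨fun k => OrderDual.toDual ((maximalIdeal A ^ k) • ⊤), fun i j hij => by
      change (maximalIdeal A ^ j) • (⊤ : Submodule A ((Fin r → A) ⧸ M)) ≤ (maximalIdeal A ^ i) • (⊤ : Submodule A ((Fin r → A) ⧸ M))
      exact Submodule.smul_mono_left (Ideal.pow_le_pow_right hij)⟩
  obtain ⟨N, hN⟩ := IsArtinian.monotone_stabilizes f
  have h4 : (maximalIdeal A ^ N) • (⊤ : Submodule A ((Fin r → A) ⧸ M)) = (maximalIdeal A ^ (N + 1)) • ⊤ := hN (N + 1) (by omega)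
  have h5 : (maximalIdeal A ^ N) • (⊤ : Submodule A ((Fin r → A) ⧸ M)) = ⊥ := by
    refine Submodule.eq_bot_of_le_smul_of_le_jacobson_bot (maximalIdeal A) _ (IsNoetherian.noetherian _) ?_ ?_
    · rw [← mul_smul, ← pow_succ', ← h4]
    · rw [IsLocalRing.jacobson_eq_maximalIdeal _ bot_ne_top]
  refine ⟨N, fun a ha w => ?_⟩
  have h6 : a • (Submodule.Quotient.mk w : (Fin r → A) ⧸ M) ∈ (maximalIdeal A ^ N) • (⊤ : Submodule A ((Fin r → A) ⧸ M)) :=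
    Submodule.smul_mem_smul ha trivial
  rw [h5, Submodule.mem_bot, ← Submodule.Quotient.mk_smul, Submodule.Quotient.mk_eq_zero] at h6
  exact h6

variable [IsDomain A]

/-- primitive relation -/
theorem exists_prim [UniqueFactorizationMonoid A] {r : ℕ} (u : Fin (r + 1) → Fin r → A) : ∃ c : Fin (r + 1) → A, c ≠ 0 ∧ ∑ j, c j • u j = 0 ∧
    ∀ g, Prime g → ∃ i, ¬ g ∣ c i := by
  classical
  obtain ⟨a, ha, i0, hi0⟩ : ∃ g : Fin (r + 1) → A, ∑ i, g i • u i = 0 ∧ ∃ i, g i ≠ 0 := by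
    rw [← Fintype.not_linearIndependent_iff]
    intro hl
    have := hl.fintype_card_le_finrank
    simp at this
  let _ : StrongNormalizationMonoid A := UniqueFactorizationMonoid.strongNormalizationMonoid
  let _ : NormalizedGCDMonoid A := UniqueFactorizationMonoid.toNormalizedGCDMonoid A
  obtain ⟨c, hc, hg⟩ := Finset.extract_gcd a (Finset.univ_nonempty (α := Fin (r + 1)))
  set d := Finset.univ.gcd a
  have hd : d ≠ 0 := by
    intro h0
    apply hi0; rw [hc i0 (Finset.mem_univ _), h0, zero_mul]
  refine ⟨c, ?_, ?_, fun g hgp => ?_⟩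
  · rintro rfl
    apply hi0; rw [hc i0 (Finset.mem_univ _)]; simp
  · have h1 : d • ∑ j, c j • u j = 0 := by
      rw [← ha, Finset.smul_sum]
      refine Finset.sum_congr rfl fun i _ => ?_
      rw [hc i (Finset.mem_univ _), mul_smul]
    exact (smul_eq_zero.1 h1).resolve_left hd
  · by_contra! hall
    have := Finset.dvd_gcd (s := Finset.univ) (f := c) (fun i _ => hall i)
    rw [hg] at this
    exact hgp.not_isUnit (isUnit_of_dvd_one this)

/-- spanning over the fraction field. -/
theorem span_K {r : ℕ} {M : Submodule A (Fin r → A)} {n : ℕ} {u : Fin n → Fin r → A} (hu : Good M u)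
    {a : A} (ha : a ≠ 0) (haM : ∀ w : Fin r → A, a • w ∈ M) (w : Fin r → FractionRing A) :
    ∃ v : Fin n → FractionRing A, ∑ j, v j • (fun i => algebraMap A (FractionRing A) (u j i)) = w := by
  classical
  rw [← Submodule.mem_span_range_iff_exists_fun]
  by_contra hw
  obtain ⟨f, hf, hf2⟩ := Submodule.exists_le_ker_of_notMem hw
  apply hf
  have key : ∀ i, f (Pi.single i 1) = 0 := by
    intro i
    let Λ : MvPolynomial (Fin r) A →ₐ[A] FractionRing A := aeval (fun i => f (Pi.single i 1))
    have hΛ : ∀ v : Fin r → A, Λ (emb A r v) = f (fun i => algebraMap A (FractionRing A) (v i)) := by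
      intro v
      have e1 : (fun i => algebraMap A (FractionRing A) (v i)) = ∑ i, algebraMap A (FractionRing A) (v i) • (Pi.single i 1 : Fin r → FractionRing A) := by
        ext j; simp [Finset.sum_apply, Pi.single_apply, Algebra.smul_def]
      rw [e1, map_sum, emb, Fintype.linearCombination_apply, map_sum]
      refine Finset.sum_congr rfl fun i _ => ?_
      rw [map_smul, map_smul, aeval_X, algebraMap_smul]
    obtain ⟨k, q, -, hq⟩ := hom_int u (a • Pi.single i 1) (hu.2 _ (haM _)) ⊤ le_top trivial
    have h1 := congrArg Λ hq
    rw [map_pow, map_sum] at h1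
    have h2 : ∀ j, Λ (emb A r (u j) * q j) = 0 := by
      intro j
      have h3 : f (fun i => algebraMap A (FractionRing A) (u j i)) = 0 := hf2 (Submodule.subset_span ⟨j, rfl⟩)
      rw [map_mul, hΛ, h3, zero_mul]
    simp only [h2, Finset.sum_const_zero] at h1
    have h4 := eq_zero_of_pow_eq_zero h1
    rw [map_smul, map_smul, smul_eq_zero] at h4
    have h5 := h4.resolve_left ha
    rw [hΛ] at h5
    convert h5 using 2
    ext j
    by_cases hj : j = i
    · subst hj; simp
    · simp [hj]
  have e1 : w = ∑ i, w i • (Pi.single i 1 : Fin r → FractionRing A) := by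
    ext j; simp [Finset.sum_apply, Pi.single_apply]
  rw [e1, map_sum]
  simp [key]

theorem exists_rel {r : ℕ} {u : Fin (r + 1) → Fin r → A}
   (hs : ∀ w : Fin r → FractionRing A, ∃ v : Fin (r + 1) → FractionRing A, ∑ j, v j • (fun i => algebraMap A (FractionRing A) (u j i)) = w)
   {c : Fin (r + 1) → A} (hc : c ≠ 0) (hrel : ∑ j, c j • u j = 0) :
   Rel (fun j i => algebraMap A (FractionRing A) (u j i)) (fun j => algebraMap A (FractionRing A) (c j)) := by
  set K := FractionRing A
  have hne : (fun j => algebraMap A K (c j)) ≠ 0 := by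
    intro h
    apply hc
    ext j
    have := congrFun h j
    simpa using this
  have hr0 : ∑ j, (fun j => algebraMap A K (c j)) j • (fun j i => algebraMap A K (u j i)) j = 0 := by
    ext i
    have := congrArg (algebraMap A K) (congrFun hrel i)
    simpa [Finset.sum_apply, Algebra.smul_def] using this
  refine ⟨hne, hr0, ?_, hs⟩
  intro v hv
  let f : (Fin (r + 1) → K) →ₗ[K] (Fin r → K) := Fintype.linearCombination K (fun j i => algebraMap A K (u j i))
  have hf : Function.Surjective f := fun w => hs w
  have h1 := f.finrank_range_add_finrank_ker
  rw [LinearMap.range_eq_top.2 hf, finrank_top, Module.finrank_fin_fun, Module.finrank_fin_fun] at h1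
  have h2 : Module.finrank K (LinearMap.ker f) = 1 := by omega
  have h3 := (finrank_eq_one_iff_of_nonzero' (⟨_, hr0⟩ : LinearMap.ker f) (by
    intro h; exact hne (congrArg Subtype.val h))).1 h2 ⟨v, hv⟩
  obtain ⟨μ, hμ⟩ := h3
  exact ⟨μ, (congrArg Subtype.val hμ).symm⟩
end
end Core
end

section
set_option maxHeartbeats 1000000
set_option synthInstance.maxHeartbeats 400000
set_option linter.unusedSectionVars false

open MvPolynomial IsLocalRing
namespace Core
section
variable {A : Type} [CommRing A] {n r : ℕ}

def VA (u : Fin n → Fin r → A) (v : Fin r → MvPolynomial (Fin n) A) : Prop :=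
  ∀ m, IsIntegral (DA u) (emb A r (fun i => coeff m (v i)))

noncomputable def EvA (u : Fin n → Fin r → A) (v : Fin r → MvPolynomial (Fin n) A) : MvPolynomial (Fin r) A :=
  ∑ i, evA u (v i) * X i

noncomputable def combA (u : Fin n → Fin r → A) (p : Fin n → MvPolynomial (Fin n) A) : Fin r → MvPolynomial (Fin n) A :=
  fun i => ∑ j, p j * C (u j i)

structure Pres (u : Fin n → Fin r → A) (c : Fin n → A) : Prop where
  rel : ∑ j, c j • u j = 0
  surj : ∀ s, IsIntegral (DA u) s → ∃ G v, VA u v ∧ s = evA u G + EvA u v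
  inj : ∀ v G, VA u v → EvA u v = evA u G → ∃ p, v = combA u p ∧ G = ∑ j, p j * X j
  ker : ∀ l : Fin n → A, ∑ j, l j • u j = 0 → ∀ i j, l i * c j = l j * c i
  delta : ∀ a : A, a ≠ 0 → ∀ w (l : Fin n → A), IsIntegral (DA u) (emb A r w) → ∑ j, l j • u j = a • w →
    ∀ i j, a ∣ c j * l i - c i * l j

variable (A) in
abbrev KK := FractionRing A
variable (A) in
noncomputable abbrev ph : A →+* FractionRing A := algebraMap A (FractionRing A)
noncomputable abbrev phv {α : Type} (w : α → A) : α → FractionRing A := fun i => ph A (w i)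
noncomputable abbrev phu {α β : Type} (w : α → β → A) : α → β → FractionRing A := fun j i => ph A (w j i)

variable [IsDomain A]

theorem map_inj : Function.Injective (MvPolynomial.map (σ := Fin n) (ph A)) :=
  MvPolynomial.map_injective _ (IsFractionRing.injective A (FractionRing A))

theorem ph_inj : Function.Injective (ph A) := IsFractionRing.injective A (FractionRing A)

theorem map_emb (w : Fin r → A) : MvPolynomial.map (ph A) (emb A r w) = emb (FractionRing A) r (phv w) := by
  simp only [emb, Fintype.linearCombination_apply, map_sum, smul_eq_C_mul, map_mul, map_C, map_X]

theorem ev_map (u : Fin n → Fin r → A) (G : MvPolynomial (Fin n) A) : ev (phu u) (MvPolynomial.map (ph A) G) = MvPolynomial.map (ph A) (evA u G) := by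
  induction G using MvPolynomial.induction_on with
  | C a => simp [evA]
  | add p q hp hq => simp only [map_add, hp, hq]
  | mul_X p i hp =>
    rw [map_mul, map_mul, map_mul, map_mul, hp, map_X, ev_X]
    congr 1
    rw [evA, aeval_X, map_emb]

theorem CR_iff {G : MvPolynomial (Fin n) (FractionRing A)} : G ∈ CR (ph A).range n ↔ ∃ G0, MvPolynomial.map (ph A) G0 = G := by
  constructor
  · rintro ⟨G1, rfl⟩
    have hs : Function.Surjective (ph A).rangeRestrict := (ph A).rangeRestrict_surjective
    obtain ⟨G0, rfl⟩ := MvPolynomial.map_surjective (σ := Fin n) _ hs G1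
    refine ⟨G0, ?_⟩
    change _ = MvPolynomial.map _ (MvPolynomial.map _ G0)
    rw [MvPolynomial.map_map]
    rfl
  · rintro ⟨G0, rfl⟩
    rw [mem_CR]
    intro m
    rw [coeff_map]
    exact ⟨_, rfl⟩

theorem DD_eq (u : Fin n → Fin r → A) : DD (phu u) (ph A).range = (DA u).map (MvPolynomial.map (ph A)) := by
  ext s
  rw [mem_DD]
  constructor
  · rintro ⟨G, hG, rfl⟩
    obtain ⟨G0, rfl⟩ := CR_iff.1 hG
    exact ⟨evA u G0, ⟨G0, rfl⟩, (ev_map u G0).symm⟩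
  · rintro ⟨_, ⟨G0, rfl⟩, rfl⟩
    exact ⟨_, CR_iff.2 ⟨G0, rfl⟩, ev_map u G0⟩

theorem int_iff {u : Fin n → Fin r → A} {s : MvPolynomial (Fin r) A} : IsIntegral (DD (phu u) (ph A).range) (MvPolynomial.map (ph A) s) ↔ IsIntegral (DA u) s := by
  rw [DD_eq]
  constructor
  · exact isInt_comap _ map_inj _
  · exact isInt_map (MvPolynomial.map (ph A)) _ _ (fun d hd => Subring.mem_map.2 ⟨d, hd, rfl⟩)

theorem B1_iff (hN : Normal (ph A).range) {u : Fin n → Fin r → A} {w : Fin r → FractionRing A} : B1 (phu u) (ph A).range w ↔ ∃ w0, w = phv w0 ∧ IsIntegral (DA u) (emb A r w0) := by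
  constructor
  · intro h
    have h1 : IsIntegral (CR (ph A).range r) (emb (FractionRing A) r w) := by
      refine isInt_mono ?_ h
      rw [DD_eq]
      rintro _ ⟨s, -, rfl⟩
      exact CR_iff.2 ⟨s, rfl⟩
    have h2 := normal_CR hN h1
    rw [mem_CR] at h2
    have h3 : ∀ i, ∃ a, ph A a = w i := fun i => by
      have := h2 (Finsupp.single i 1)
      rwa [coeff_emb] at this
    choose w0 hw0 using h3
    have h4 : w = phv w0 := funext fun i => (hw0 i).symm
    refine ⟨w0, h4, ?_⟩
    rw [B1, h4, ← map_emb] at h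
    exact int_iff.1 h
  · rintro ⟨w0, rfl, h⟩
    rw [B1, ← map_emb]
    exact int_iff.2 h

theorem VB_iff (hN : Normal (ph A).range) {u : Fin n → Fin r → A} {v : Fin r → MvPolynomial (Fin n) (FractionRing A)} :
    VB (phu u) (ph A).range v ↔ ∃ v0, v = (fun i => MvPolynomial.map (ph A) (v0 i)) ∧ VA u v0 := by
  constructor
  · intro h
    have h0 : ∀ i, ∃ G0, MvPolynomial.map (ph A) G0 = v i := by
      intro i
      rw [← CR_iff, mem_CR]
      intro m
      obtain ⟨w0, hw0, -⟩ := (B1_iff hN).1 (h m)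
      exact ⟨w0 i, (congrFun hw0 i).symm⟩
    choose v0 hv0 using h0
    refine ⟨v0, funext fun i => (hv0 i).symm, fun m => ?_⟩
    obtain ⟨w0, hw0, h1⟩ := (B1_iff hN).1 (h m)
    convert h1 using 3
    apply ph_inj
    have := congrFun hw0 ‹_›
    rw [← coeff_map, hv0]
    exact this
  · rintro ⟨v0, rfl, h⟩ m
    refine (B1_iff hN).2 ⟨_, ?_, h m⟩
    funext i
    simp [coeff_map]

theorem map_EvA (u : Fin n → Fin r → A) (v0 : Fin r → MvPolynomial (Fin n) A) :
    Ev (phu u) (fun i => MvPolynomial.map (ph A) (v0 i)) = MvPolynomial.map (ph A) (EvA u v0) := by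
  rw [Ev, EvA, map_sum]
  refine Finset.sum_congr rfl fun i _ => ?_
  rw [map_mul, map_X, ev_map]

variable [IsLocalRing A] [IsNoetherianRing A] {x y : A}

theorem RLR2.pres (h : RLR2 A x y) {u : Fin n → Fin r → A} {c : Fin n → A} (hrel : ∑ j, c j • u j = 0)
    (hR : Rel (phu u) (phv c)) (hprim : ∀ g, Prime g → ∃ i, ¬ g ∣ c i) : Pres u c := by
  have hufd := h.ufd
  let e : A ≃+* (ph A).range := RingEquiv.ofBijective (ph A).rangeRestrict
    ⟨fun a b hab => ph_inj (congrArg Subtype.val hab), (ph A).rangeRestrict_surjective⟩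
  have he : ∀ a, (e a : FractionRing A) = ph A a := fun a => rfl
  have hesymm : ∀ a, ph A (e.symm a) = (a : FractionRing A) := fun a => by rw [← he, e.apply_symm_apply]
  have i1 : IsLocalRing (ph A).range := IsLocalRing.of_surjective' (ph A).rangeRestrict (ph A).rangeRestrict_surjective
  have i2 : IsNoetherianRing (ph A).range := isNoetherianRing_range _
  have hRL : RLR2 (ph A).range (e x) (e y) := by
    refine ⟨?_, (MulEquiv.prime_iff e).2 h.px, fun hd => h.nd ?_⟩
    · ext z
      rw [mem_maximalIdeal, mem_nonunits_iff, Ideal.mem_span_pair]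
      have h1 : e.symm z ∈ maximalIdeal A ↔ ¬ IsUnit z := by
        rw [mem_maximalIdeal, mem_nonunits_iff, MulEquiv.isUnit_map]
      rw [← h1, h.max, Ideal.mem_span_pair]
      constructor
      · rintro ⟨a, b, hab⟩
        exact ⟨e a, e b, by rw [← map_mul, ← map_mul, ← map_add, hab, e.apply_symm_apply]⟩
      · rintro ⟨a, b, hab⟩
        exact ⟨e.symm a, e.symm b, by rw [← hab]; simp⟩
    · have := map_dvd e.symm hd
      simpa using this
  have hufd' := hRL.ufd
  have hN : Normal (ph A).range := by
    intro z hz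
    have : IsIntegrallyClosed A := inferInstance
    have h2 : IsIntegral A z := by
      obtain ⟨p, hp, hpz⟩ := hz
      refine ⟨p.map e.symm.toRingHom, hp.map _, ?_⟩
      rw [Polynomial.eval₂_map, ← hpz]
      congr 1
      ext a
      exact hesymm a
    exact (IsIntegrallyClosed.isIntegral_iff.1 h2)
  have hF : ∀ z : FractionRing A, ∃ a ∈ (ph A).range, a ≠ 0 ∧ a * z ∈ (ph A).range := by
    intro z
    obtain ⟨a, b, hb, rfl⟩ := IsFractionRing.div_surjective (A := A) z
    have hb0 : ph A b ≠ 0 := by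
      simpa using nonZeroDivisors.ne_zero hb
    refine ⟨ph A b, ⟨b, rfl⟩, hb0, ⟨a, ?_⟩⟩
    rw [mul_div_cancel₀ _ hb0]
  have hc : ∀ i, phv c i ∈ (ph A).range := fun i => ⟨c i, rfl⟩
  have hdv : ∀ a b : A, e a ∣ e b → a ∣ b := fun a b hab => by simpa using map_dvd e.symm hab
  obtain ⟨N, hNle⟩ : ∃ N, maximalIdeal (ph A).range ^ N ≤ CI hc := by
    refine hRL.pow_le _ ?_ ?_
    · intro h0
      apply hR.ne
      funext i
      have := self_CI (hc := hc) i
      rw [h0, Submodule.mem_bot] at this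
      exact congrArg Subtype.val this
    · intro g hg
      obtain ⟨i, hi⟩ := hprim (e.symm g) ((MulEquiv.prime_iff e.symm).2 hg)
      refine ⟨_, self_CI i, fun hd => hi ?_⟩
      apply hdv
      rw [e.apply_symm_apply]
      exact hd
  obtain ⟨m, hm⟩ := RLR2.bd _ hNle
  have hS := RLR2.core m (ph A).range (e x) (e y) (phv c) hRL hN hF hR hc N hNle hm
  have hpr : ∀ q, emb (FractionRing A) n (phv c) * q ∈ CR (ph A).range n → q ∈ CR (ph A).range n := by
    intro q hq
    refine prim_ufd hF hc (fun π hπ => ?_) q hq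
    obtain ⟨i, hi⟩ := hprim (e.symm ⟨π, hπ.mem⟩) ((MulEquiv.prime_iff e.symm).2 hπ.prime)
    refine ⟨i, fun hd => hi ?_⟩
    apply hdv
    rw [e.apply_symm_apply, dvd_iff_div hπ.ne]
    exact hd
  refine ⟨hrel, ?_, ?_, ?_, ?_⟩
  · intro s hs
    obtain ⟨G, hG, v, hv, hs⟩ := hS _ (int_iff.2 hs)
    obtain ⟨G0, rfl⟩ := CR_iff.1 hG
    obtain ⟨v0, rfl, hv0⟩ := (VB_iff hN).1 hv
    refine ⟨G0, v0, hv0, map_inj ?_⟩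
    rw [hs, map_EvA, ev_map, map_add]
  · intro v G hv hE
    have hE' : Ev (phu u) (fun i => MvPolynomial.map (ph A) (v i)) = ev (phu u) (MvPolynomial.map (ph A) G) := by
      rw [map_EvA, hE, ev_map]
    obtain ⟨p, hp, hvp⟩ := hR.inj hN (g := 1) one_ne_zero (fun i => by simpa using hc i) (fun q hq => by simpa using hpr q hq)
      ((VB_iff hN).2 ⟨v, rfl, hv⟩) (CR_iff.2 ⟨G, rfl⟩) hE'
    choose p0 hp0 using fun j => CR_iff.1 (hp j)
    rw [hvp, Ev_comb, ← sub_eq_zero, ← map_sub] at hE'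
    obtain ⟨q, hq⟩ := hR.ker_ev hE'
    have hqC : q ∈ CR (ph A).range n := by
      apply hpr
      rw [← hq]
      exact Subring.sub_mem _ (Subring.sum_mem _ fun j _ => Subring.mul_mem _ (hp j) (X_mem_CR j)) (CR_iff.2 ⟨G, rfl⟩)
    obtain ⟨q0, rfl⟩ := CR_iff.1 hqC
    refine ⟨fun j => p0 j - C (c j) * q0, ?_, ?_⟩
    · funext i
      have h1 : v i = ∑ j, p0 j * C (u j i) := by
        apply map_inj
        have := congrFun hvp i
        simp only [comb] at this
        rw [this, map_sum]
        refine Finset.sum_congr rfl fun j _ => ?_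
        rw [map_mul, hp0, map_C]
      have h2 : ∑ j, c j * u j i = 0 := by
        have := congrFun hrel i
        simpa [Finset.sum_apply] using this
      have h3 : ∑ j, C (c j) * q0 * C (u j i) = q0 * C (∑ j, c j * u j i) := by
        rw [map_sum, Finset.mul_sum]
        refine Finset.sum_congr rfl fun j _ => ?_
        rw [map_mul]; ring
      simp only [combA, sub_mul, Finset.sum_sub_distrib]
      rw [h3, h2, h1]; simp
    · apply map_inj
      have e1 : MvPolynomial.map (ph A) G = ∑ j, p j * X j - emb (FractionRing A) n (phv c) * MvPolynomial.map (ph A) q0 := by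
        rw [← hq]; ring
      rw [e1, ← map_emb, ← map_mul, map_sum, emb, Fintype.linearCombination_apply, Finset.sum_mul, map_sum, ← Finset.sum_sub_distrib]
      refine Finset.sum_congr rfl fun j _ => ?_
      rw [← hp0, map_mul (MvPolynomial.map (ph A)) _ (X j), map_X, map_sub, sub_mul, smul_eq_C_mul]
      congr 1
      simp only [map_mul, map_X]; ring
  · intro l hl i j
    have h1 : ∑ j, phv l j • phu u j = 0 := by
      funext i
      have := congrArg (ph A) (congrFun hl i)
      simpa [Finset.sum_apply, Algebra.smul_def] using this
    obtain ⟨μ, hμ⟩ := hR.ker _ h1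
    apply ph_inj
    have hi := congrFun hμ i
    have hj := congrFun hμ j
    simp only [Pi.smul_apply, smul_eq_mul] at hi hj
    rw [map_mul, map_mul]
    change phv l i * phv c j = phv l j * phv c i
    rw [hi, hj]
    ring
  · intro a ha w l hw hl i j
    have ha' : ph A a ≠ 0 := by simpa using ha
    have h1 : ∑ j, (phv l j / ph A a) • phu u j = phv w := by
      funext i
      have := congrArg (ph A) (congrFun hl i)
      simp only [Finset.sum_apply, Pi.smul_apply, smul_eq_mul, map_sum, map_mul] at this ⊢
      rw [← mul_right_inj' ha', ← this, Finset.mul_sum]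
      refine Finset.sum_congr rfl fun j _ => ?_
      field_simp
    obtain ⟨b, hb⟩ := hR.delta hN (g := 1) (fun i => by simpa using hc i) (l := fun j => phv l j / ph A a) (by
      rw [h1]; exact (B1_iff hN).2 ⟨w, rfl, hw⟩) i j
    refine ⟨b, ph_inj ?_⟩
    rw [map_mul, hb]
    simp only [map_sub, map_mul]
    field_simp
end
end Core
end

section
set_option maxHeartbeats 1000000
set_option synthInstance.maxHeartbeats 400000
set_option linter.unusedSectionVars false

open MvPolynomial IsLocalRing
namespace Core
section
theorem wreg_iff {P N : Type*} [CommRing P] [AddCommGroup N] [Module P N] (rs : List P) :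
    RingTheory.Sequence.IsWeaklyRegular N rs ↔ ∀ i (h : i < rs.length), ∀ x : N,
      rs[i] • x ∈ (Ideal.ofList (rs.take i) • ⊤ : Submodule P N) → x ∈ (Ideal.ofList (rs.take i) • ⊤ : Submodule P N) := by
  rw [RingTheory.Sequence.isWeaklyRegular_iff]
  refine forall_congr' fun i => forall_congr' fun h => ?_
  rw [isSMulRegular_on_quot_iff_lsmul_comap_le]
  rfl

theorem wreg_quot {P L N B : Type*} [CommRing P] [AddCommGroup L] [Module P L] [AddCommGroup N] [Module P N] [AddCommGroup B] [Module P B]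
    (ψ : L →ₗ[P] N) (π : N →ₗ[P] B) (hπ : Function.Surjective π) (h0 : ∀ l, π (ψ l) = 0) (hex : ∀ x, π x = 0 → ∃ l, ψ l = x)
    (rs : List P) (hN : RingTheory.Sequence.IsWeaklyRegular N rs)
    (hinj : ∀ i ≤ rs.length, ∀ l, ψ l ∈ (Ideal.ofList (rs.take i) • ⊤ : Submodule P N) → l ∈ (Ideal.ofList (rs.take i) • ⊤ : Submodule P L)) :
    RingTheory.Sequence.IsWeaklyRegular B rs := by
  rw [wreg_iff] at hN ⊢
  intro i hi b hb
  have hmap : ∀ I : Ideal P, (I • ⊤ : Submodule P B) = (I • ⊤ : Submodule P N).map π := fun I => by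
    rw [Submodule.map_smul'', Submodule.map_top, LinearMap.range_eq_top.2 hπ]
  rw [hmap] at hb ⊢
  obtain ⟨x, rfl⟩ := hπ b
  obtain ⟨y, hy, hxy⟩ := hb
  obtain ⟨l, hl⟩ := hex (rs[i] • x - y) (by rw [map_sub, map_smul, hxy, sub_self])
  have htake : Ideal.ofList (rs.take (i + 1)) = Ideal.ofList (rs.take i) ⊔ Ideal.span {rs[i]} := by
    rw [List.take_succ_eq_append_getElem hi, Ideal.ofList_append, Ideal.ofList_singleton]
  have h1 : ψ l ∈ (Ideal.ofList (rs.take (i + 1)) • ⊤ : Submodule P N) := by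
    rw [hl, htake]
    refine Submodule.sub_mem _ ?_ ?_
    · exact Submodule.smul_mem_smul (Ideal.mem_sup_right (Ideal.mem_span_singleton_self _)) trivial
    · exact Submodule.smul_mono_left le_sup_left hy
  have h2 := hinj (i + 1) hi l h1
  rw [htake, Submodule.sup_smul, Submodule.mem_sup] at h2
  obtain ⟨l1, hl1, l2, hl2, rfl⟩ := h2
  rw [Submodule.ideal_span_singleton_smul] at hl2
  obtain ⟨l3, -, rfl⟩ := hl2
  have h3 : x - ψ l3 ∈ (Ideal.ofList (rs.take i) • ⊤ : Submodule P N) := by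
    apply hN i hi
    have : rs[i] • (x - ψ l3) = y + ψ l1 := by
      rw [map_add] at hl
      have h4 : ψ ((DistribSMul.toLinearMap P L rs[i]) l3) = rs[i] • ψ l3 := map_smul ψ _ _
      rw [h4] at hl
      rw [smul_sub]
      have := congrArg (· + y) hl
      simp only [sub_add_cancel] at this
      rw [← this]; abel
    rw [this]
    refine Submodule.add_mem _ hy ?_
    have : (Ideal.ofList (rs.take i) • ⊤ : Submodule P L).map ψ ≤ (Ideal.ofList (rs.take i) • ⊤ : Submodule P N) := by
      rw [Submodule.map_smul'']; exact smul_mono_right _ le_top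
    exact this ⟨l1, hl1, rfl⟩
  refine ⟨_, h3, ?_⟩
  rw [map_sub, h0, sub_zero]
end

section
variable {A : Type} [CommRing A] {n r : ℕ}

/-- polynomials with coefficients in `W`. -/
noncomputable def PM {ι : Type} (n : ℕ) (W : Submodule A (ι → A)) : Submodule (MvPolynomial (Fin n) A) (ι → MvPolynomial (Fin n) A) where
  carrier := {v | ∀ m, (fun i => coeff m (v i)) ∈ W}
  add_mem' := fun {a b} ha hb m => by
    have := W.add_mem (ha m) (hb m)
    convert this using 1
    ext i; simp
  zero_mem' := fun m => by
    convert W.zero_mem using 1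
    ext i; simp
  smul_mem' := fun p v hv m => by
    classical
    have : (fun i => coeff m ((p • v) i)) = ∑ x ∈ Finset.HasAntidiagonal.antidiagonal m, coeff x.1 p • (fun i => coeff x.2 (v i)) := by
      ext i
      simp only [Pi.smul_apply, smul_eq_mul, coeff_mul, Finset.sum_apply]
    rw [this]
    exact W.sum_mem fun x _ => W.smul_mem _ (hv _)

noncomputable def eps (a : Fin n → A) (j : ℕ) : MvPolynomial (Fin n) A →ₐ[A] MvPolynomial (Fin n) A :=
  aeval (fun i => if i.val < j then C (a i) else X i)

noncomputable def IT (a : Fin n → A) (j : ℕ) : Ideal (MvPolynomial (Fin n) A) :=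
  Ideal.span {p | ∃ i : Fin n, i.val < j ∧ p = X i - C (a i)}

theorem eps_sub (a : Fin n → A) (j : ℕ) (p) : p - eps a j p ∈ IT a j := by
  induction p using MvPolynomial.induction_on with
  | C b => simp [eps]
  | add p q hp hq =>
    have : p + q - eps a j (p + q) = (p - eps a j p) + (q - eps a j q) := by rw [map_add]; ring
    rw [this]; exact Ideal.add_mem _ hp hq
  | mul_X p i hp =>
    have : p * X i - eps a j (p * X i) = (p - eps a j p) * X i + eps a j p * (X i - eps a j (X i)) := by rw [map_mul]; ring
    rw [this]
    refine Ideal.add_mem _ (Ideal.mul_mem_right _ _ hp) (Ideal.mul_mem_left _ _ ?_)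
    rw [eps, aeval_X]
    split_ifs with h
    · exact Ideal.subset_span ⟨i, h, rfl⟩
    · simp

theorem eps_kill (a : Fin n → A) (j : ℕ) {p} (hp : p ∈ IT a j) : eps a j p = 0 := by
  have : IT a j ≤ RingHom.ker (eps a j) := by
    refine Ideal.span_le.2 ?_
    rintro _ ⟨i, hi, rfl⟩
    simp [eps, hi]
  exact this hp

theorem PM_sub {ι : Type} [Finite ι] (W : Submodule A (ι → A)) (a : Fin n → A) (j : ℕ) {v} (hv : v ∈ PM n W) :
    v - (fun i => eps a j (v i)) ∈ IT a j • PM n W := by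
  classical
  have := Fintype.ofFinite ι
  let s : Finset (Fin n →₀ ℕ) := Finset.univ.biUnion (fun i => (v i).support)
  have h1 : ∀ i, v i = ∑ m ∈ s, monomial m 1 * C (coeff m (v i)) := by
    intro i
    conv_lhs => rw [(v i).as_sum]
    have : (v i).support ⊆ s := Finset.subset_biUnion_of_mem (fun i => (v i).support) (Finset.mem_univ i)
    rw [Finset.sum_subset this]
    · refine Finset.sum_congr rfl fun m _ => ?_
      rw [mul_comm, C_mul_monomial, mul_one]
    · intro m _ hm
      rw [notMem_support_iff.1 hm]; simp
  have h2 : v - (fun i => eps a j (v i)) = ∑ m ∈ s, (monomial m 1 - eps a j (monomial m 1)) • (fun i => C (coeff m (v i))) := by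
    funext i
    simp only [Pi.sub_apply, Finset.sum_apply, Pi.smul_apply, smul_eq_mul, sub_mul, Finset.sum_sub_distrib]
    rw [← h1]
    congr 1
    conv_lhs => rw [h1, map_sum]
    refine Finset.sum_congr rfl fun m _ => ?_
    rw [map_mul]
    congr 1
    simp [eps]
  rw [h2]
  refine Submodule.sum_mem _ fun m _ => Submodule.smul_mem_smul (eps_sub _ _ _) ?_
  intro m'
  by_cases h : m' = 0
  · subst h
    simpa using hv m
  · convert W.zero_mem using 1
    ext i
    simp [coeff_C, Ne.symm h]

theorem PM_kill {ι : Type} (W : Submodule A (ι → A)) (a : Fin n → A) (j : ℕ) {v} (hv : v ∈ IT a j • PM n W) (i : ι) : eps a j (v i) = 0 := by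
  apply eps_kill
  refine Submodule.smul_induction_on hv ?_ ?_
  · intro p hp w _
    exact Ideal.mul_mem_right _ _ hp
  · intro x y hx hy
    exact Ideal.add_mem _ hx hy

theorem PM_ker {ι : Type} [Finite ι] (W : Submodule A (ι → A)) (a : Fin n → A) (j : ℕ) {v} (hv : v ∈ PM n W) (h : ∀ i, eps a j (v i) = 0) :
    v ∈ IT a j • PM n W := by
  have := PM_sub W a j hv
  simp only [h] at this
  convert this using 1
  ext i; simp

theorem eps_PM {ι : Type} [Finite ι] (W : Submodule A (ι → A)) (a : Fin n → A) (j : ℕ) {v} (hv : v ∈ PM n W) :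
    (fun i => eps a j (v i)) ∈ PM n W := by
  have h1 : IT a j • PM n W ≤ PM n W := Submodule.smul_le_right
  have := Submodule.sub_mem _ hv (h1 (PM_sub W a j hv))
  rwa [sub_sub_cancel] at this

/-- the sequence of parameters in the polynomial ring -/
noncomputable def th (a : Fin n → A) (z : A) : List (MvPolynomial (Fin n) A) :=
  List.ofFn (fun i => X i - C (a i)) ++ [C z]

theorem th_length (a : Fin n → A) (z : A) : (th a z).length = n + 1 := by simp [th]

theorem th_take (a : Fin n → A) (z : A) {j : ℕ} (hj : j ≤ n) : Ideal.ofList ((th a z).take j) = IT a j := by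
  rw [th, List.take_append_of_le_length (by simpa using hj)]
  rw [Ideal.ofList, IT]
  congr 1
  ext p
  simp only [Set.mem_ofPred_eq, List.mem_take_iff_getElem, List.getElem_ofFn, List.length_ofFn]
  constructor
  · rintro ⟨i, hi, rfl⟩
    exact ⟨⟨i, by omega⟩, by simp; omega, rfl⟩
  · rintro ⟨i, hi, rfl⟩
    exact ⟨i, by omega, rfl⟩

theorem th_take' (a : Fin n → A) (z : A) : Ideal.ofList ((th a z).take (n + 1)) = IT a n ⊔ Ideal.span {C z} := by
  rw [← th_take a z le_rfl]
  rw [List.take_succ_eq_append_getElem (by rw [th_length]; omega), Ideal.ofList_append, Ideal.ofList_singleton]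
  simp [th]

theorem th_get (a : Fin n → A) (z : A) {j : ℕ} (hj : j < n) (h' : j < (th a z).length) : (th a z)[j] = X ⟨j, hj⟩ - C (a ⟨j, hj⟩) := by
  simp [th, List.getElem_append, hj]

theorem th_get' (a : Fin n → A) (z : A) (h' : n < (th a z).length) : (th a z)[n] = C z := by
  simp [th, List.getElem_append]

theorem smul_sub_iff {P Q : Type*} [CommRing P] [AddCommGroup Q] [Module P Q] (N : Submodule P Q) (I : Ideal P) (x : N) :
    x ∈ (I • ⊤ : Submodule P N) ↔ (x : Q) ∈ I • N := by
  have : I • N = (I • ⊤ : Submodule P N).map N.subtype := by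
    rw [Submodule.map_smul'', Submodule.map_subtype_top]
  rw [this]
  constructor
  · intro h; exact ⟨x, h, rfl⟩
  · rintro ⟨y, hy, hxy⟩
    rwa [← Subtype.ext hxy]

theorem PM_reg [IsDomain A] {ι : Type} [Finite ι] (W : Submodule A (ι → A)) (a : Fin n → A) {z : A} (hz : z ≠ 0) :
    RingTheory.Sequence.IsWeaklyRegular (PM n W) (th a z) := by
  rw [wreg_iff]
  intro j hj x hx
  have hj' : j ≤ n := by rw [th_length] at hj; omega
  rw [smul_sub_iff, th_take _ _ hj'] at hx ⊢
  refine PM_ker W a j x.2 fun i => ?_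
  have h1 := PM_kill W a j hx i
  have h2 : eps a j ((th a z)[j] * x.1 i) = 0 := h1
  rw [map_mul] at h2
  refine (mul_eq_zero.1 h2).resolve_left ?_
  rcases hj'.lt_or_eq with h3 | h3
  · rw [th_get _ _ h3]
    simp [eps]
    rw [sub_eq_zero]
    intro h4
    have := congrArg (coeff (Finsupp.single ⟨j, h3⟩ 1)) h4
    rw [coeff_X, if_pos rfl, coeff_C, if_neg (by
      rw [eq_comm, Finsupp.single_eq_zero]; exact one_ne_zero)] at this
    exact one_ne_zero this
  · subst h3
    rw [th_get']
    simpa [eps] using hz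
end
end Core
end

section
set_option maxHeartbeats 1000000
set_option synthInstance.maxHeartbeats 400000
set_option linter.unusedSectionVars false

open MvPolynomial IsLocalRing
namespace Core
section
variable {A : Type} [CommRing A] {n r : ℕ}

noncomputable def psiA (u : Fin n → Fin r → A) : (Fin n → MvPolynomial (Fin n) A) →ₗ[MvPolynomial (Fin n) A] (Option (Fin r) → MvPolynomial (Fin n) A) where
  toFun p := fun o => o.elim (∑ j, p j * X j) (fun i => - ∑ j, p j * C (u j i))
  map_add' p q := by
    funext o
    cases o with
    | none => simp [add_mul, Finset.sum_add_distrib]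
    | some i => simp [add_mul, Finset.sum_add_distrib]; ring
  map_smul' s p := by
    funext o
    cases o with
    | none => simp [mul_assoc, Finset.mul_sum]
    | some i => simp [mul_assoc, Finset.mul_sum]

noncomputable def WN (u : Fin n → Fin r → A) : Submodule A (Option (Fin r) → A) where
  carrier := {w | IsIntegral (DA u) (emb A r (fun i => w (some i)))}
  add_mem' := fun {v w} hv hw => by
    have e : (fun i => (v + w) (some i)) = (fun i => v (some i)) + (fun i => w (some i)) := rfl
    change IsIntegral _ _
    rw [e, map_add]
    exact IsIntegral.add hv hw
  zero_mem' := by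
    have e : (fun i : Fin r => (0 : Option (Fin r) → A) (some i)) = 0 := rfl
    change IsIntegral _ _
    rw [e, map_zero]
    exact isIntegral_zero
  smul_mem' := fun s w hw => by
    have e : (fun i => (s • w) (some i)) = s • (fun i => w (some i)) := rfl
    change IsIntegral _ _
    rw [e, map_smul, smul_eq_C_mul]
    exact (isInt_self (C_mem_DA u s)).mul hw

theorem mem_WN {u : Fin n → Fin r → A} {w} : w ∈ WN u ↔ IsIntegral (DA u) (emb A r (fun i => w (some i))) := Iff.rfl

theorem psiA_mem (u : Fin n → Fin r → A) (p) : psiA u p ∈ PM n (WN u) := by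
  intro m
  rw [mem_WN]
  have e : (fun i : Fin r => coeff m (psiA u p (some i))) = - ∑ j, coeff m (p j) • u j := by
    ext i
    simp only [psiA, LinearMap.coe_mk, AddHom.coe_mk, Option.elim_some, coeff_neg, coeff_sum, Pi.neg_apply, Finset.sum_apply, Pi.smul_apply, smul_eq_mul]
    congr 1
    refine Finset.sum_congr rfl fun j _ => ?_
    rw [mul_comm, coeff_C_mul, mul_comm]
  change IsIntegral _ (emb A r (fun i : Fin r => coeff m (psiA u p (some i))))
  rw [e, map_neg, map_sum]
  refine (IsIntegral.sum _ fun j _ => ?_).neg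
  rw [map_smul, smul_eq_C_mul]
  exact (isInt_self (C_mem_DA u _)).mul (isInt_self (u_mem_DA u j))

variable [IsDomain A]

theorem Pres.kerP {u : Fin n → Fin r → A} {c : Fin n → A} (h : Pres u c) (p : Fin n → MvPolynomial (Fin n) A)
    (hp : ∀ i, ∑ j, p j * C (u j i) = 0) (i j) : p i * C (c j) = p j * C (c i) := by
  ext m
  rw [mul_comm, coeff_C_mul, mul_comm (p j), coeff_C_mul, mul_comm, mul_comm (c i)]
  refine h.ker (fun j => coeff m (p j)) ?_ i j
  ext i
  have := congrArg (coeff m) (hp i)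
  rw [coeff_sum, coeff_zero] at this
  rw [Finset.sum_apply, Pi.zero_apply, ← this]
  refine Finset.sum_congr rfl fun j _ => ?_
  rw [mul_comm, coeff_C_mul, mul_comm]; rfl

theorem eps_psiA (u : Fin n → Fin r → A) (a : Fin n → A) (j : ℕ) (p) (i : Fin r) :
    eps a j (psiA u p (some i)) = - ∑ k, eps a j (p k) * C (u k i) := by
  simp only [psiA, LinearMap.coe_mk, AddHom.coe_mk, Option.elim_some, map_neg, map_sum, map_mul]
  congr 1
  refine Finset.sum_congr rfl fun k _ => ?_
  simp [eps]

theorem Pres.stage {u : Fin n → Fin r → A} {c : Fin n → A} (h : Pres u c) {a : Fin n → A} (hca : ∑ k, c k * a k ≠ 0) {j : ℕ}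
    {p} (hp : psiA u p ∈ IT a j • PM n (WN u)) (i) : eps a j (p i) = 0 := by
  have h1 := fun o => PM_kill _ a j hp o
  have h2 : ∑ k, eps a j (p k) * eps a j (X k) = 0 := by
    have := h1 none
    simpa only [psiA, LinearMap.coe_mk, AddHom.coe_mk, Option.elim_none, map_sum, map_mul] using this
  have h3 : ∀ i, ∑ k, eps a j (p k) * C (u k i) = 0 := by
    intro i
    have := h1 (some i)
    rwa [eps_psiA, neg_eq_zero] at this
  have h4 := h.kerP _ h3
  have h5 : eps a j (p i) * ∑ k, C (c k) * eps a j (X k) = 0 := by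
    rw [Finset.mul_sum]
    have : ∀ k ∈ Finset.univ, eps a j (p i) * (C (c k) * eps a j (X k)) = C (c i) * (eps a j (p k) * eps a j (X k)) := by
      intro k _
      rw [← mul_assoc, h4 i k]; ring
    rw [Finset.sum_congr rfl this, ← Finset.mul_sum, h2, mul_zero]
  refine (mul_eq_zero.1 h5).resolve_right fun h6 => hca ?_
  have h7 := congrArg (MvPolynomial.aeval a) h6
  rw [map_sum, map_zero] at h7
  rw [← h7]
  refine Finset.sum_congr rfl fun k _ => ?_
  rw [map_mul, eps, aeval_X]
  split_ifs <;> simp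

theorem eps_const (a : Fin n → A) (p) : ∃ b, eps a n p = C b := by
  induction p using MvPolynomial.induction_on with
  | C b => exact ⟨b, by simp [eps]⟩
  | add p q hp hq =>
    obtain ⟨b, hb⟩ := hp
    obtain ⟨d, hd⟩ := hq
    exact ⟨b + d, by rw [map_add, hb, hd, map_add]⟩
  | mul_X p i hp =>
    obtain ⟨b, hb⟩ := hp
    exact ⟨b * a i, by rw [map_mul, hb, eps, aeval_X, if_pos i.2, map_mul]⟩

theorem Pres.last {u : Fin n → Fin r → A} {c : Fin n → A} (h : Pres u c) {a : Fin n → A} {k : Fin n} {a0 z : A} (hak : a = Pi.single k a0)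
    (hz : z ≠ 0) (hz1 : ∀ b, z ∣ a0 * b → z ∣ b) (hz2 : ∀ b, z ∣ c k * b → z ∣ b)
    {p} (hp : psiA u p ∈ (IT a n ⊔ Ideal.span {C z}) • PM n (WN u)) (i) : C z ∣ eps a n (p i) := by
  rw [Submodule.sup_smul, Submodule.mem_sup] at hp
  obtain ⟨v1, hv1, v2, hv2, hv⟩ := hp
  rw [Submodule.ideal_span_singleton_smul] at hv2
  obtain ⟨v, hvN, rfl⟩ := (Submodule.mem_smul_pointwise_iff_exists _ _ _).1 hv2
  have h1 := fun o => PM_kill _ a n hv1 o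
  have h2 : ∀ o, eps a n (psiA u p o) = C z * eps a n (v o) := by
    intro o
    rw [← hv]
    rw [Pi.add_apply, Pi.smul_apply, smul_eq_mul, map_add, h1, zero_add, map_mul]
    congr 1
    simp [eps]
  choose b hb using fun i => eps_const a (p i)
  choose w hw using fun o => eps_const a (v o)
  have hwN : IsIntegral (DA u) (emb A r (fun i => w (some i))) := by
    have := eps_PM _ a n hvN 0
    simp only [hw, coeff_zero_C] at this
    exact this
  have h3 : ∑ j, b j • u j = (- z) • (fun i => w (some i)) := by
    ext i
    have := h2 (some i)
    rw [eps_psiA, hw, ← map_mul] at this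
    simp only [hb, ← map_mul, ← map_sum, ← map_neg] at this
    have := C_injective _ _ this
    simp only [Finset.sum_apply, Pi.smul_apply, smul_eq_mul]
    rw [neg_mul, ← this, neg_neg]
  have h4 : b k * a0 = z * w none := by
    have := h2 none
    simp only [psiA, LinearMap.coe_mk, AddHom.coe_mk, Option.elim_none, map_sum, map_mul, hb, hw] at this
    have h5 : ∀ j, eps a n (X j) = C (a j) := fun j => by rw [eps, aeval_X, if_pos j.2]
    simp only [h5, ← map_mul, ← map_sum] at this
    have := C_injective _ _ this
    rw [← this, hak, Finset.sum_eq_single k]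
    · simp
    · intro j _ hj; simp [hj]
    · simp
  have h5 : z ∣ b k := hz1 _ ⟨w none, by rw [mul_comm]; exact h4⟩
  have h6 := h.delta (-z) (neg_ne_zero.2 hz) _ _ hwN h3 i k
  rw [neg_dvd] at h6
  have h7 : z ∣ b i := hz2 _ ((dvd_sub_left (h5.mul_left _)).1 h6)
  rw [hb]
  exact map_dvd C h7

theorem Pres.reg {u : Fin n → Fin r → A} {c : Fin n → A} (h : Pres u c) {a : Fin n → A} {k : Fin n} {a0 z : A} (hak : a = Pi.single k a0)
    (ha0 : a0 ≠ 0) (hck : c k ≠ 0)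
    (hz : z ≠ 0) (hz1 : ∀ b, z ∣ a0 * b → z ∣ b) (hz2 : ∀ b, z ∣ c k * b → z ∣ b)
    (Bs : Subalgebra A (MvPolynomial (Fin r) A)) (hB : ∀ s, s ∈ Bs ↔ IsIntegral (DA u) s)
    (f : MvPolynomial (Fin n) A →+* Bs) (hf : ∀ p, (f p : MvPolynomial (Fin r) A) = evA u p) :
    RingTheory.Sequence.IsWeaklyRegular Bs ((th a z).map f) := by
  let _ : Algebra (MvPolynomial (Fin n) A) Bs := f.toAlgebra
  have hsm : ∀ p (b : Bs), ((p • b : Bs) : MvPolynomial (Fin r) A) = evA u p * b := fun p b => by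
    rw [← hf]; rfl
  have hca : ∑ k, c k * a k ≠ 0 := by
    rw [hak, Finset.sum_eq_single k]
    · simp [ha0, hck]
    · intro j _ hj; simp [hj]
    · simp
  refine (RingTheory.Sequence.isWeaklyRegular_map_algebraMap_iff Bs Bs (th a z)).2 ?_
  let ψ : (Fin n → MvPolynomial (Fin n) A) →ₗ[MvPolynomial (Fin n) A] PM n (WN u) := (psiA u).codRestrict _ (psiA_mem u)
  have hcoef : ∀ v : Fin r → MvPolynomial (Fin n) A, VA u v → IsIntegral (DA u) (EvA u v) := by
    intro v hv
    have e : EvA u v = ∑ i, ∑ m ∈ (v i).support, evA u (monomial m 1) * (C (coeff m (v i)) * X i) := by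
      rw [EvA]
      refine Finset.sum_congr rfl fun i _ => ?_
      conv_lhs => rw [(v i).as_sum, map_sum, Finset.sum_mul]
      refine Finset.sum_congr rfl fun m _ => ?_
      rw [← mul_assoc]
      congr 1
      have : monomial m (coeff m (v i)) = monomial m 1 * C (coeff m (v i)) := by
        rw [mul_comm, C_mul_monomial, mul_one]
      rw [this, map_mul]
      congr 1
      simp [evA]
    classical
    let s : Finset (Fin n →₀ ℕ) := Finset.univ.biUnion (fun i => (v i).support)
    have e2 : EvA u v = ∑ m ∈ s, evA u (monomial m 1) * emb A r (fun i => coeff m (v i)) := by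
      rw [e]
      have : ∀ m, evA u (monomial m 1) * emb A r (fun i => coeff m (v i)) = ∑ i, evA u (monomial m 1) * (C (coeff m (v i)) * X i) := by
        intro m
        rw [emb, Fintype.linearCombination_apply, Finset.mul_sum]
        simp only [smul_eq_C_mul]
      simp only [this]
      rw [Finset.sum_comm]
      refine Finset.sum_congr rfl fun i _ => ?_
      refine Finset.sum_subset (Finset.subset_biUnion_of_mem (fun i => (v i).support) (Finset.mem_univ i)) ?_
      intro m _ hm
      rw [notMem_support_iff.1 hm]; simp
    rw [e2]
    exact IsIntegral.sum _ fun m _ => (isInt_self (mem_DA.2 ⟨_, rfl⟩)).mul (hv m)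
  let π : PM n (WN u) →ₗ[MvPolynomial (Fin n) A] Bs := 
    { toFun := fun v => ⟨evA u (v.1 none) + EvA u (fun i => v.1 (some i)), (hB _).2 
        ((isInt_self (mem_DA.2 ⟨_, rfl⟩)).add (hcoef _ fun m => v.2 m))⟩
      map_add' := fun v w => by
        apply Subtype.ext
        simp only [EvA, Submodule.coe_add, Pi.add_apply, map_add, add_mul, Finset.sum_add_distrib]
        change _ = (_ + _) + (_ + _)
        ring
      map_smul' := fun q v => by
        apply Subtype.ext
        rw [RingHom.id_apply, hsm]
        simp only [EvA, Submodule.coe_smul, Pi.smul_apply, smul_eq_mul, map_mul, mul_add, Finset.mul_sum, mul_assoc] }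
  have hπ : ∀ v, (π v : MvPolynomial (Fin r) A) = evA u (v.1 none) + EvA u (fun i => v.1 (some i)) := fun v => rfl
  refine wreg_quot ψ π ?_ ?_ ?_ (th a z) (PM_reg _ a hz) ?_
  · intro b
    obtain ⟨G, v, hv, hs⟩ := h.surj b.1 ((hB _).1 b.2)
    refine ⟨⟨fun o => o.elim G v, fun m => hv m⟩, Subtype.ext ?_⟩
    rw [hπ, hs]
    rfl
  · intro p
    apply Subtype.ext
    rw [hπ]
    change evA u (∑ j, p j * X j) + ∑ i, evA u (- ∑ j, p j * C (u j i)) * X i = 0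
    simp only [map_neg, neg_mul, Finset.sum_neg_distrib, map_sum, map_mul, Finset.sum_mul]
    rw [Finset.sum_comm, ← sub_eq_add_neg, ← Finset.sum_sub_distrib]
    refine Finset.sum_eq_zero fun j _ => ?_
    simp only [evA, aeval_X, aeval_C, emb, Fintype.linearCombination_apply]
    rw [Finset.mul_sum, sub_eq_zero]
    refine Finset.sum_congr rfl fun i _ => ?_
    rw [Algebra.smul_def, mul_assoc]
  · intro v hv
    have hv' := congrArg Subtype.val hv
    rw [hπ] at hv'
    change _ = 0 at hv'
    have hE : EvA u (fun i => - v.1 (some i)) = evA u (v.1 none) := by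
      rw [← sub_eq_zero, ← neg_eq_zero, ← hv']
      simp only [EvA, map_neg, neg_mul, Finset.sum_neg_distrib]
      ring
    obtain ⟨p, hp1, hp2⟩ := h.inj _ _ (fun m => by
      have e : (fun i => coeff m (- v.1 (some i))) = - fun i => coeff m (v.1 (some i)) := by ext i; simp
      rw [e, map_neg]
      exact IsIntegral.neg (v.2 m)) hE
    refine ⟨p, Subtype.ext (funext fun o => ?_)⟩
    change psiA u p o = _
    cases o with
    | none => exact hp2.symm
    | some i =>
      have := congrFun hp1 i
      change - combA u p i = _
      rw [← this, neg_neg]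
  · intro j hj l hl
    rw [smul_sub_iff] at hl
    change psiA u l ∈ _ at hl
    have htop : (⊤ : Submodule (MvPolynomial (Fin n) A) (Fin n → MvPolynomial (Fin n) A)) = PM n (⊤ : Submodule A (Fin n → A)) := by
      rw [eq_comm, eq_top_iff]; intro v _ m; trivial
    rw [htop]
    rw [th_length] at hj
    rcases Nat.lt_or_ge j (n + 1) with h1 | h1
    · rw [th_take _ _ (by omega)] at hl ⊢
      exact PM_ker _ a j (fun m => trivial) (fun i => h.stage hca hl i)
    · obtain rfl : j = n + 1 := by omega
      rw [th_take'] at hl ⊢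
      have h2 := fun i => h.last hak hz hz1 hz2 hl i
      choose q hq using h2
      have h3 : l = (l - fun i => eps a n (l i)) + (C z : MvPolynomial (Fin n) A) • q := by
        funext i
        simp [hq]
      rw [h3]
      refine Submodule.add_mem _ (Submodule.smul_mono_left le_sup_left (PM_sub _ a n (fun m => trivial))) ?_
      exact Submodule.smul_mem_smul (Ideal.mem_sup_right (Ideal.mem_span_singleton_self _)) (fun m => trivial)
end
end Core
end

section
set_option maxHeartbeats 1000000
set_option synthInstance.maxHeartbeats 400000
set_option linter.unusedSectionVars false

open MvPolynomial IsLocalRing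
namespace Core
section
variable {A : Type} [CommRing A] [IsLocalRing A] [IsNoetherianRing A] [IsDomain A] {x y : A} {r : ℕ}

structure Setup (x : A) (M : Submodule A (Fin r → A)) (u : Fin (r + 1) → Fin r → A) (c : Fin (r + 1) → A)
    (k : Fin (r + 1)) (z : A) : Prop where
  good : Good M u
  pres : Pres u c
  x0 : x ≠ 0
  xm : x ∈ maximalIdeal A
  ck : c k ≠ 0
  zm : z ∈ maximalIdeal A
  z0 : z ≠ 0
  z1 : ∀ b, z ∣ x * b → z ∣ b
  z2 : ∀ b, z ∣ c k * b → z ∣ b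
  pow : ∃ N, maximalIdeal A ^ N ≤ Ideal.span {c k * x, z}

theorem RLR2.setup (h : RLR2 A x y) (hres : Infinite (ResidueField A)) (M : Submodule A (Fin r → A))
    {N : ℕ} (hN : ∀ a ∈ maximalIdeal A ^ N, ∀ w : Fin r → A, a • w ∈ M) :
    ∃ u c k z, Setup x M u c k z := by
  have hufd := h.ufd
  obtain ⟨u, hu⟩ := h.exists_good hres M
  obtain ⟨c, hc, hrel, hprim⟩ := exists_prim u
  have hx0 := h.px.ne_zero
  have hs := span_K hu (pow_ne_zero N hx0) (hN _ (Ideal.pow_mem_pow h.mem_x N))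
  have hP := h.pres hrel (exists_rel hs hc hrel) hprim
  obtain ⟨k, hk⟩ : ∃ k, c k ≠ 0 := by
    by_contra! h0
    exact hc (funext h0)
  have hd : c k * x ≠ 0 := mul_ne_zero hk hx0
  obtain ⟨e, d0, hd0, hde⟩ := WfDvdMonoid.max_power_factor hd h.px.irreducible
  have hxz : ¬ x ∣ x + y * d0 := fun h1 => by
    rw [dvd_add_right dvd_rfl] at h1
    rcases h.px.dvd_or_dvd h1 with h2 | h2
    · exact h.nd h2
    · exact hd0 h2
  have hcop : ∀ g, Prime g → g ∣ c k * x → ¬ g ∣ x + y * d0 := by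
    intro g hg hgd hgz
    rw [hde] at hgd
    have hgx : g ∣ x → False := fun h1 => hxz (by
      have := (hg.irreducible.associated_of_dvd h.px.irreducible h1)
      exact this.dvd_iff_dvd_left.1 hgz)
    rcases hg.dvd_or_dvd hgd with h1 | h1
    · exact hgx (hg.dvd_of_dvd_pow h1)
    · exact hgx ((dvd_add_left (h1.mul_left _)).1 hgz)
  have hz0 : x + y * d0 ≠ 0 := fun h0 => hxz (by rw [h0]; exact dvd_zero _)
  have hrp : IsRelPrime (x + y * d0) (c k * x) := by
    rw [UniqueFactorizationMonoid.isRelPrime_iff_no_prime_factors hz0]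
    intro g h1 h2 hg
    exact hcop g hg h2 h1
  refine ⟨u, c, k, x + y * d0, hu, hP, hx0, h.mem_x, hk, ?_, hz0, fun b hb => ?_, fun b hb => ?_, ?_⟩
  · exact Ideal.add_mem _ h.mem_x (Ideal.mul_mem_right _ _ h.mem_y)
  · exact (hrp.of_mul_right_right).dvd_of_dvd_mul_left hb
  · exact (hrp.of_mul_right_left).dvd_of_dvd_mul_left hb
  · refine h.pow_le _ ?_ ?_
    · intro h0
      apply hd
      have : c k * x ∈ (⊥ : Ideal A) := by rw [← h0]; exact Ideal.subset_span (by simp)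
      simpa using this
    · intro g hg
      by_cases h1 : g ∣ c k * x
      · exact ⟨_, Ideal.subset_span (by simp), hcop g hg h1⟩
      · exact ⟨_, Ideal.subset_span (by simp), h1⟩

end
section
variable {A : Type} [CommRing A] {r : ℕ} {M : Submodule A (Fin r → A)}

theorem emb_mem_rees {w : Fin r → A} (hw : w ∈ M) : emb A r w ∈ reesAlg A r M :=
  Algebra.subset_adjoin ⟨w, hw, rfl⟩

theorem DA_le_rees {n : ℕ} {u : Fin n → Fin r → A} (hu : ∀ i, u i ∈ M) : DA u ≤ (reesAlg A r M).toSubring :=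
  DA_ind _ (fun a => (reesAlg A r M).algebraMap_mem a) (fun j => emb_mem_rees (hu j))

theorem rees_int {n : ℕ} {u : Fin n → Fin r → A} (hu : Good M u) {s} (hs : s ∈ reesAlg A r M) : IsIntegral (DA u) s := by
  let T : Subalgebra A (MvPolynomial (Fin r) A) :=
    { (integralClosure (DA u) (MvPolynomial (Fin r) A)).toSubring with
      algebraMap_mem' := fun a => isInt_self (C_mem_DA u a) }
  have : reesAlg A r M ≤ T := by
    refine Algebra.adjoin_le ?_
    rintro _ ⟨w, hw, rfl⟩
    exact hu.2 w hw
  exact this hs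

theorem intCl_iff {s} : s ∈ intClAlg A r M ↔ IsIntegral (reesAlg A r M).toSubring s := Iff.rfl

theorem intCl_iff_DA {n : ℕ} {u : Fin n → Fin r → A} (hu : Good M u) {s} : s ∈ intClAlg A r M ↔ IsIntegral (DA u) s := by
  rw [intCl_iff]
  constructor
  · intro h
    exact isInt_trans (fun d hd => rees_int hu hd) h
  · intro h
    exact isInt_mono (DA_le_rees hu.1) h

theorem rees_le_intCl : reesAlg A r M ≤ intClAlg A r M := fun s hs => by
  rw [intCl_iff]; exact isInt_self hs

noncomputable def toRees {n : ℕ} (u : Fin n → Fin r → A) (hu : ∀ i, u i ∈ M) : MvPolynomial (Fin n) A →+* reesAlg A r M :=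
  (evA u : MvPolynomial (Fin n) A →+* MvPolynomial (Fin r) A).codRestrict (reesAlg A r M)
    (fun p => DA_le_rees hu (mem_DA.2 ⟨p, rfl⟩))

theorem coe_toRees {n : ℕ} {u : Fin n → Fin r → A} (hu : ∀ i, u i ∈ M) (p) :
    (toRees u hu p : MvPolynomial (Fin r) A) = evA u p := rfl

/-- `R(M)`-algebra structure on the integral closure -/
noncomputable abbrev incl (A : Type) [CommRing A] {r : ℕ} (M : Submodule A (Fin r → A)) : reesAlg A r M →ₐ[A] intClAlg A r M :=
  Subalgebra.inclusion rees_le_intCl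

theorem rees_sub [IsLocalRing A] (s : reesAlg A r M) (Q : Ideal (reesAlg A r M))
    (hw : ∀ w (hw : w ∈ M), (⟨emb A r w, emb_mem_rees hw⟩ : reesAlg A r M) ∈ Q) :
    s - algebraMap A _ (constantCoeff (s : MvPolynomial (Fin r) A)) ∈ Q := by
  obtain ⟨s, hs⟩ := s
  induction hs using Algebra.adjoin_induction with
  | mem s hs =>
    obtain ⟨w, hwM, rfl⟩ := hs
    have : constantCoeff (emb A r w) = 0 := by
      simp [emb, Fintype.linearCombination_apply, smul_eq_C_mul]
    change _ - algebraMap A _ (constantCoeff (emb A r w)) ∈ Q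
    rw [this, map_zero, sub_zero]
    exact hw w hwM
  | algebraMap a =>
    have : constantCoeff (algebraMap A (MvPolynomial (Fin r) A) a) = a := by simp
    change _ - algebraMap A _ (constantCoeff (algebraMap A (MvPolynomial (Fin r) A) a)) ∈ Q
    rw [this]
    convert Q.zero_mem
    rw [sub_eq_zero]; rfl
  | add s t hs ht h1 h2 =>
    convert Q.add_mem h1 h2 using 1
    apply Subtype.ext
    simp
    ring
  | mul s t hs ht h1 h2 =>
    convert Q.add_mem (Q.mul_mem_left ⟨s, hs⟩ h2) (Q.mul_mem_left (algebraMap A _ (constantCoeff t)) h1) using 1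
    apply Subtype.ext
    simp
    ring
end
end Core
end

section
set_option maxHeartbeats 1000000
set_option synthInstance.maxHeartbeats 400000
set_option linter.unusedSectionVars false

open MvPolynomial IsLocalRing
namespace Core
section
variable {A : Type} [CommRing A] {r : ℕ} {M : Submodule A (Fin r → A)}

noncomputable instance algB : Algebra (reesAlg A r M) (intClAlg A r M) := (incl A M).toRingHom.toAlgebra

theorem smulB (s : reesAlg A r M) (b : intClAlg A r M) : ((s • b : intClAlg A r M) : MvPolynomial (Fin r) A) = s * b := rfl

theorem algB_coe (s : reesAlg A r M) : ((algebraMap (reesAlg A r M) (intClAlg A r M) s : intClAlg A r M) : MvPolynomial (Fin r) A) = s := rfl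

noncomputable def RS {n : ℕ} (u : Fin n → Fin r → A) (hu : ∀ i, u i ∈ M) (k : Fin n) (x z : A) : List (reesAlg A r M) :=
  (th (Pi.single k x) z).map (toRees u hu)

theorem rees_noeth [IsNoetherianRing A] : IsNoetherianRing (reesAlg A r M) := by
  have hfg : (sub1 A r M).FG := (IsNoetherian.noetherian M).map _
  obtain ⟨s, hs⟩ := hfg
  have : (reesAlg A r M).FG := by
    refine ⟨s, ?_⟩
    rw [reesAlg, ← hs, Algebra.adjoin_span]
  exact Algebra.FiniteType.isNoetherianRing A _ (h := (Subalgebra.fg_iff_finiteType _).1 this)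

variable [IsLocalRing A] [IsNoetherianRing A] [IsDomain A] {x : A} {u : Fin (r + 1) → Fin r → A} {c : Fin (r + 1) → A} {k : Fin (r + 1)} {z : A}

theorem Setup.reg (h : Setup x M u c k z) : RingTheory.Sequence.IsWeaklyRegular (intClAlg A r M) (RS u h.good.1 k x z) := by
  have := h.pres.reg (a := Pi.single k x) rfl h.x0 h.ck h.z0 h.z1 h.z2 (intClAlg A r M) (fun s => intCl_iff_DA h.good)
    ((algebraMap (reesAlg A r M) (intClAlg A r M)).comp (toRees u h.good.1)) (fun p => rfl)
  rw [RingHom.coe_comp, ← List.map_map] at this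
  exact (RingTheory.Sequence.isWeaklyRegular_map_algebraMap_iff (intClAlg A r M) (intClAlg A r M) _).1 this

theorem Setup.len (h : Setup x M u c k z) : (RS u h.good.1 k x z).length = r + 2 := by
  rw [RS, List.length_map, th_length]

theorem cc_emb (w : Fin r → A) : constantCoeff (emb A r w) = 0 := by
  simp [emb, Fintype.linearCombination_apply, smul_eq_C_mul]

theorem mem_gradedMax (s : reesAlg A r M) : s ∈ gradedMax A r M ↔ constantCoeff (s : MvPolynomial (Fin r) A) ∈ maximalIdeal A := Iff.rfl

theorem Setup.mem (h : Setup x M u c k z) : ∀ s ∈ RS u h.good.1 k x z, s ∈ gradedMax A r M := by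
  intro s hs
  rw [RS, List.mem_map] at hs
  obtain ⟨p, hp, rfl⟩ := hs
  rw [mem_gradedMax, coe_toRees]
  rw [th, List.mem_append, List.mem_ofFn, List.mem_singleton] at hp
  rcases hp with ⟨i, rfl⟩ | rfl
  · rw [map_sub, map_sub, evA, aeval_X, aeval_C, cc_emb, zero_sub]
    apply (maximalIdeal A).neg_mem
    simp only [algebraMap_eq, constantCoeff_C]
    by_cases hi : i = k
    · subst hi; simpa using h.xm
    · simp [hi]
  · simpa [evA] using h.zm

theorem Setup.rad (h : Setup x M u c k z) : gradedMax A r M ≤ (Ideal.ofList (RS u h.good.1 k x z)).radical := by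
  rw [Ideal.radical_eq_sInf]
  refine le_sInf ?_
  rintro Q ⟨hQ, hQp⟩
  have hmem : ∀ p ∈ th (Pi.single k x) z, toRees u h.good.1 p ∈ Q := fun p hp =>
    hQ (Ideal.subset_span (List.mem_map_of_mem hp))
  have hz : algebraMap A (reesAlg A r M) z ∈ Q := by
    convert hmem (C z) (by simp [th])
    apply Subtype.ext
    rw [coe_toRees]; simp [evA]
  let U : Fin (r + 1) → reesAlg A r M := fun j => ⟨emb A r (u j), emb_mem_rees (h.good.1 j)⟩
  have hU : ∀ j, U j - algebraMap A (reesAlg A r M) (Pi.single (M := fun _ => A) k x j) ∈ Q := by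
    intro j
    convert hmem (X j - C (Pi.single (M := fun _ => A) k x j)) (by
      rw [th, List.mem_append, List.mem_ofFn]; exact Or.inl ⟨j, rfl⟩)
    apply Subtype.ext
    rw [coe_toRees]; simp [evA, U]
  have hUj : ∀ j, j ≠ k → U j ∈ Q := fun j hj => by
    have := hU j
    rwa [Pi.single_eq_of_ne hj, map_zero, sub_zero] at this
  have hUk := hU k
  rw [Pi.single_eq_same] at hUk
  have hrel : ∑ j, algebraMap A (reesAlg A r M) (c j) * U j = 0 := by
    apply Subtype.ext
    have := congrArg (emb A r) h.pres.rel
    rw [map_sum, map_zero] at this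
    simp only [map_smul, smul_eq_C_mul] at this
    rw [AddSubmonoidClass.coe_finsetSum]
    exact this
  have h1 : algebraMap A (reesAlg A r M) (c k) * U k ∈ Q := by
    rw [Finset.sum_eq_add_sum_sdiff_singleton_of_mem (Finset.mem_univ k), add_eq_zero_iff_eq_neg] at hrel
    rw [hrel]
    refine Q.neg_mem (Q.sum_mem fun j hj => Q.mul_mem_left _ (hUj j ?_))
    simpa using hj
  have h2 : algebraMap A (reesAlg A r M) (c k * x) ∈ Q := by
    have := Q.sub_mem h1 (Q.mul_mem_left (algebraMap A (reesAlg A r M) (c k)) hUk)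
    rw [map_mul]
    convert this using 1
    ring
  obtain ⟨N, hN⟩ := h.pow
  have h3 : maximalIdeal A ≤ Q.comap (algebraMap A (reesAlg A r M)) := by
    have h4 : Ideal.span {c k * x, z} ≤ Q.comap (algebraMap A (reesAlg A r M)) := by
      rw [Ideal.span_le]
      rintro _ (rfl | rfl)
      · exact h2
      · exact hz
    have : (Q.comap (algebraMap A (reesAlg A r M))).IsPrime := inferInstance
    exact this.le_of_pow_le (hN.trans h4)
  have hU' : ∀ j, U j ∈ Q := by
    intro j
    by_cases hj : j = k
    · subst hj
      have := Q.add_mem hUk (h3 h.xm)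
      simpa using this
    · exact hUj j hj
  have hw : ∀ w (hw : w ∈ M), (⟨emb A r w, emb_mem_rees hw⟩ : reesAlg A r M) ∈ Q := by
    intro w hw
    obtain ⟨e, q, hq, he⟩ := hom_int u w (h.good.2 w hw) (reesAlg A r M).toSubring (DA_le_rees h.good.1) (emb_mem_rees hw)
    refine hQp.mem_of_pow_mem e ?_
    have : (⟨emb A r w, emb_mem_rees hw⟩ : reesAlg A r M) ^ e = ∑ j, U j * ⟨q j, hq j⟩ := by
      apply Subtype.ext
      rw [AddSubmonoidClass.coe_finsetSum]
      exact he
    rw [this]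
    exact Q.sum_mem fun j _ => Q.mul_mem_right _ (hU' j)
  intro s hs
  have := Q.add_mem (rees_sub s Q hw) (h3 hs)
  simpa using this

theorem Setup.pow_le (h : Setup x M u c k z) : ∃ N, gradedMax A r M ^ N ≤ Ideal.ofList (RS u h.good.1 k x z) := by
  have := rees_noeth (A := A) (M := M)
  exact Ideal.exists_pow_le_of_le_radical_of_fg h.rad (IsNoetherian.noetherian _)

end
end Core
end

section
set_option maxHeartbeats 1000000
set_option synthInstance.maxHeartbeats 400000
set_option linter.unusedSectionVars false

open MvPolynomial IsLocalRing
namespace Core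
section
variable {A : Type} [CommRing A] {r : ℕ} {M : Submodule A (Fin r → A)}

theorem EvA_eq {n : ℕ} (u : Fin n → Fin r → A) (v : Fin r → MvPolynomial (Fin n) A) :
    ∃ s : Finset (Fin n →₀ ℕ), EvA u v = ∑ m ∈ s, evA u (monomial m 1) * emb A r (fun i => coeff m (v i)) := by
  have e : EvA u v = ∑ i, ∑ m ∈ (v i).support, evA u (monomial m 1) * (C (coeff m (v i)) * X i) := by
    rw [EvA]
    refine Finset.sum_congr rfl fun i _ => ?_
    conv_lhs => rw [(v i).as_sum, map_sum, Finset.sum_mul]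
    refine Finset.sum_congr rfl fun m _ => ?_
    rw [← mul_assoc]
    congr 1
    have : monomial m (coeff m (v i)) = monomial m 1 * C (coeff m (v i)) := by
      rw [mul_comm, C_mul_monomial, mul_one]
    rw [this, map_mul]
    congr 1
    simp [evA]
  classical
  refine ⟨Finset.univ.biUnion (fun i => (v i).support), ?_⟩
  rw [e]
  have : ∀ m, evA u (monomial m 1) * emb A r (fun i => coeff m (v i)) = ∑ i, evA u (monomial m 1) * (C (coeff m (v i)) * X i) := by
    intro m
    rw [emb, Fintype.linearCombination_apply, Finset.mul_sum]
    simp only [smul_eq_C_mul]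
  simp only [this]
  rw [Finset.sum_comm]
  refine Finset.sum_congr rfl fun i _ => ?_
  refine Finset.sum_subset (Finset.subset_biUnion_of_mem (fun i => (v i).support) (Finset.mem_univ i)) ?_
  intro m _ hm
  rw [notMem_support_iff.1 hm]; simp

variable [IsLocalRing A] [IsNoetherianRing A] [IsDomain A] {x : A} {u : Fin (r + 1) → Fin r → A} {c : Fin (r + 1) → A} {k : Fin (r + 1)} {z : A}

theorem Setup.B_ind (h : Setup x M u c k z) (P : Submodule (reesAlg A r M) (intClAlg A r M)) (h1 : 1 ∈ P)
    (hw : ∀ w (hw : emb A r w ∈ intClAlg A r M), (⟨emb A r w, hw⟩ : intClAlg A r M) ∈ P) : P = ⊤ := by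
  rw [eq_top_iff]
  rintro ⟨s, hs⟩ -
  obtain ⟨G, v, hv, hsv⟩ := h.pres.surj s ((intCl_iff_DA h.good).1 hs)
  obtain ⟨t, ht⟩ := EvA_eq u v
  have : (⟨s, hs⟩ : intClAlg A r M) = toRees u h.good.1 G • 1 +
      ∑ m ∈ t, toRees u h.good.1 (monomial m 1) • ⟨emb A r (fun i => coeff m (v i)), (intCl_iff_DA h.good).2 (hv m)⟩ := by
    apply Subtype.ext
    rw [AddMemClass.coe_add, AddSubmonoidClass.coe_finsetSum]
    simp only [smulB, coe_toRees]
    rw [← ht]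
    change s = _ * 1 + _
    rw [mul_one, hsv]
  rw [this]
  exact P.add_mem (P.smul_mem _ h1) (P.sum_mem fun m _ => P.smul_mem _ (hw _ _))

theorem Setup.B_fin (h : Setup x M u c k z) : Module.Finite (reesAlg A r M) (intClAlg A r M) := by
  let W : Submodule A (Fin r → A) := (Subalgebra.toSubmodule (intClAlg A r M)).comap (emb A r)
  obtain ⟨s, hs⟩ := IsNoetherian.noetherian W
  classical
  have hsW : ∀ w ∈ s, emb A r w ∈ intClAlg A r M := fun w hw => by
    have : w ∈ W := by rw [← hs]; exact Submodule.subset_span hw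
    exact this
  let S : Set (intClAlg A r M) := insert 1 (Set.range fun w : s => ⟨emb A r w.1, hsW w.1 w.2⟩)
  have hfin : S.Finite := (Set.finite_range _).insert _
  refine ⟨⟨hfin.toFinset, ?_⟩⟩
  rw [Set.Finite.coe_toFinset]
  refine h.B_ind _ (Submodule.subset_span (Set.mem_insert _ _)) ?_
  intro w hw
  have hwW : w ∈ Submodule.span A (s : Set (Fin r → A)) := by rw [hs]; exact hw
  induction hwW using Submodule.span_induction with
  | mem w hws =>
    exact Submodule.subset_span (Set.mem_insert_of_mem _ ⟨⟨w, hws⟩, rfl⟩)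
  | zero =>
    convert Submodule.zero_mem _ using 1
    apply Subtype.ext
    simp
  | add v w hv hw' h1 h2 =>
    rw [hs] at hv hw'
    convert Submodule.add_mem _ (h1 hv) (h2 hw') using 1
    apply Subtype.ext
    simp
  | smul a w hw' h1 =>
    rw [hs] at hw'
    convert Submodule.smul_mem _ (algebraMap A (reesAlg A r M) a) (h1 hw') using 1
    apply Subtype.ext
    rw [smulB]
    simp [smul_eq_C_mul, algebraMap_eq]

theorem rr_mem (h1 : ratliffRush A r (freeSub A r) (sub1 A r M) = barPow A r M 1) {w : Fin r → A} (hw : emb A r w ∈ intClAlg A r M) :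
    ∃ l, ∀ s ∈ sub1 A r M ^ l, emb A r w * s ∈ reesAlg A r M := by
  have hle : ∀ n, sub1 A r M ^ n ≤ Subalgebra.toSubmodule (reesAlg A r M) := by
    intro n
    have h0 : sub1 A r M ≤ Subalgebra.toSubmodule (reesAlg A r M) := fun s hs => Algebra.subset_adjoin hs
    induction n with
    | zero => rw [pow_zero, Submodule.one_le]; exact one_mem (reesAlg A r M)
    | succ n ih =>
      rw [pow_succ]
      refine (Submodule.mul_le.2 fun a ha b hb => ?_)
      exact mul_mem (S := Subalgebra A (MvPolynomial (Fin r) A)) (ih ha) (h0 hb)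
  have hb : emb A r w ∈ barPow A r M 1 := ⟨by rw [pow_one]; exact ⟨w, trivial, rfl⟩, hw⟩
  rw [← h1, ratliffRush, Submodule.mem_iSup_of_directed] at hb
  · obtain ⟨l, -, hl⟩ := hb
    refine ⟨l + 1, fun s hs => hle (l + 2) (Submodule.mem_div_iff_forall_mul_mem.1 hl s hs)⟩
  · refine Monotone.directed_le (monotone_nat_of_le_succ fun l => ?_)
    refine inf_le_inf_left _ fun s hs => ?_
    rw [Submodule.mem_div_iff_forall_mul_mem] at hs ⊢
    intro t ht
    rw [pow_succ (n := l + 1)] at ht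
    rw [pow_succ (n := l + 1 + 1)]
    refine Submodule.mul_induction_on ht ?_ ?_
    · intro p hp q hq
      rw [← mul_assoc]
      exact Submodule.mul_mem_mul (hs p hp) hq
    · intro p q hp hq
      rw [mul_add]; exact add_mem hp hq

theorem Setup.tors (h : Setup x M u c k z) {N : ℕ} (hN : ∀ a ∈ maximalIdeal A ^ N, ∀ w : Fin r → A, a • w ∈ M)
    (h1 : ratliffRush A r (freeSub A r) (sub1 A r M) = barPow A r M 1) (s : intClAlg A r M) :
    ∃ k, ∀ b ∈ gradedMax A r M ^ k, ((b • s : intClAlg A r M) : MvPolynomial (Fin r) A) ∈ reesAlg A r M := by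
  let P : Submodule (reesAlg A r M) (intClAlg A r M) :=
    { carrier := {s | ∃ k, ∀ b ∈ gradedMax A r M ^ k, ((b • s : intClAlg A r M) : MvPolynomial (Fin r) A) ∈ reesAlg A r M}
      add_mem' := by
        rintro s t ⟨k, hk⟩ ⟨l, hl⟩
        refine ⟨max k l, fun b hb => ?_⟩
        rw [smul_add]
        exact add_mem (hk b (Ideal.pow_le_pow_right (le_max_left _ _) hb)) (hl b (Ideal.pow_le_pow_right (le_max_right _ _) hb))
      zero_mem' := ⟨0, fun b _ => by rw [smul_zero]; exact zero_mem (reesAlg A r M)⟩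
      smul_mem' := by
        rintro a s ⟨k, hk⟩
        refine ⟨k, fun b hb => ?_⟩
        rw [smul_comm, smulB]
        exact mul_mem a.2 (hk b hb) }
  have hP : P = ⊤ := by
    refine h.B_ind P ⟨0, fun b _ => ?_⟩ ?_
    · rw [smulB]
      exact mul_mem b.2 (one_mem _)
    · intro w hw
      let I : Ideal (reesAlg A r M) :=
        { carrier := {b | (b : MvPolynomial (Fin r) A) * emb A r w ∈ reesAlg A r M}
          add_mem' := fun {a b} ha hb => by
            change _ ∈ reesAlg A r M
            rw [AddMemClass.coe_add, add_mul]; exact add_mem ha hb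
          zero_mem' := by
            change _ ∈ reesAlg A r M
            rw [ZeroMemClass.coe_zero, zero_mul]; exact zero_mem (reesAlg A r M)
          smul_mem' := fun a b hb => by
            change _ ∈ reesAlg A r M
            rw [smul_eq_mul, MulMemClass.coe_mul, mul_assoc]; exact mul_mem a.2 hb }
      have hrad : gradedMax A r M ≤ I.radical := by
        rw [Ideal.radical_eq_sInf]
        refine le_sInf ?_
        rintro Q ⟨hQ, hQp⟩
        have hm : ∀ a ∈ maximalIdeal A, algebraMap A (reesAlg A r M) a ∈ Q := by
          intro a ha
          refine hQp.mem_of_pow_mem N (hQ ?_)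
          change _ ∈ reesAlg A r M
          have := emb_mem_rees (hN _ (Ideal.pow_mem_pow ha N) w)
          rw [map_smul, smul_eq_C_mul] at this
          rw [← map_pow]
          exact this
        obtain ⟨l, hl⟩ := rr_mem h1 hw
        have hw' : ∀ w (hw : w ∈ M), (⟨emb A r w, emb_mem_rees hw⟩ : reesAlg A r M) ∈ Q := by
          intro v hv
          refine hQp.mem_of_pow_mem l (hQ ?_)
          change _ ∈ reesAlg A r M
          rw [mul_comm]
          have hv1 : emb A r v ∈ sub1 A r M := ⟨v, hv, rfl⟩
          exact hl _ (Submodule.pow_mem_pow _ hv1 l)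
        intro s hs
        have := Q.add_mem (rees_sub s Q hw') (hm _ hs)
        simpa using this
      have := rees_noeth (A := A) (M := M)
      obtain ⟨e, he⟩ := Ideal.exists_pow_le_of_le_radical_of_fg hrad (IsNoetherian.noetherian _)
      exact ⟨e, fun b hb => he hb⟩
  have : s ∈ P := by rw [hP]; trivial
  exact this

end
end Core
end

section
set_option maxHeartbeats 1000000
set_option synthInstance.maxHeartbeats 400000
set_option linter.unusedSectionVars false

open MvPolynomial IsLocalRing
namespace Core
section
variable {A : Type} [CommRing A] {r : ℕ} {M : Submodule A (Fin r → A)}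

noncomputable abbrev iotaB (A : Type) [CommRing A] {r : ℕ} (M : Submodule A (Fin r → A)) : reesAlg A r M →ₗ[reesAlg A r M] intClAlg A r M :=
  Algebra.linearMap (reesAlg A r M) (intClAlg A r M)

theorem mem_range_iotaB (s : intClAlg A r M) : s ∈ LinearMap.range (iotaB A M) ↔ (s : MvPolynomial (Fin r) A) ∈ reesAlg A r M := by
  constructor
  · rintro ⟨t, rfl⟩; exact t.2
  · intro h
    exact ⟨⟨s.1, h⟩, rfl⟩

variable [IsLocalRing A] [IsNoetherianRing A] [IsDomain A] {x : A} {u : Fin (r + 1) → Fin r → A} {c : Fin (r + 1) → A} {k : Fin (r + 1)} {z : A}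

theorem Setup.lc (h : Setup x M u c k z) {N : ℕ} (hN : ∀ a ∈ maximalIdeal A ^ N, ∀ w : Fin r → A, a • w ∈ M)
    (h1 : ratliffRush A r (freeSub A r) (sub1 A r M) = barPow A r M 1) :
    ((∀ i : ℕ, i ≠ r + 2 → Module.Finite ↥(reesAlg A r M) (lcMod A r M i)) ∧
      (∀ p : ℕ, p ≠ 1 → p ≠ r + 2 → Subsingleton (lcMod A r M p))) ∧
    Nonempty ((intClAlg A r M ⧸ LinearMap.range (iotaB A M)) ≃ₗ[reesAlg A r M] lcMod A r M 1) := by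
  have := rees_noeth (A := A) (M := M)
  have := h.B_fin
  obtain ⟨K, hK⟩ := h.pow_le
  have hmain := LC.main (J := gradedMax A r M) (intClAlg A r M) (iotaB A M) (fun a b hab => Subtype.ext (congrArg (fun t : intClAlg A r M => (t : MvPolynomial (Fin r) A)) hab))
    (by
      intro s
      obtain ⟨s, rfl⟩ := Submodule.Quotient.mk_surjective _ s
      obtain ⟨k, hk⟩ := h.tors hN h1 s
      refine ⟨k, fun b hb => ?_⟩
      rw [← Submodule.Quotient.mk_smul, Submodule.Quotient.mk_eq_zero, mem_range_iotaB]
      exact hk b hb)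
    (RS u h.good.1 k x z) h.mem (by rw [h.len]; omega) h.reg
    (fun s => ⟨K, fun b hb => Submodule.smul_mem_smul (hK hb) trivial⟩)
  rw [h.len] at hmain
  obtain ⟨hm1, ⟨e⟩⟩ := hmain
  refine ⟨⟨fun i hi => ?_, hm1⟩, ⟨e⟩⟩
  by_cases h1 : i = 1
  · subst h1
    exact Module.Finite.equiv e
  · have := hm1 i h1 hi
    exact Module.Finite.of_surjective (0 : reesAlg A r M →ₗ[reesAlg A r M] _) (fun y => ⟨0, Subsingleton.elim _ _⟩)
end
end Core
end

section
set_option maxHeartbeats 1000000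
set_option synthInstance.maxHeartbeats 400000
set_option linter.unusedSectionVars false

open MvPolynomial IsLocalRing
namespace Core
section
variable {A : Type} [CommRing A] {r : ℕ} {M : Submodule A (Fin r → A)}

theorem freeSub_eq : freeSub A r = homogeneousSubmodule (Fin r) A 1 := by
  rw [homogeneousSubmodule_one_eq_span_X, freeSub, Submodule.map_top]
  exact Fintype.range_linearCombination _ _

theorem freeSub_pow (n : ℕ) : freeSub A r ^ n = homogeneousSubmodule (Fin r) A n := by
  rw [freeSub_eq, homogeneousSubmodule_one_pow]

theorem sub1_pow_le (n : ℕ) : sub1 A r M ^ n ≤ homogeneousSubmodule (Fin r) A n := by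
  rw [← freeSub_pow]
  exact pow_le_pow_left' (Submodule.map_mono le_top) n

theorem sub1_pow_le_rees (n : ℕ) : sub1 A r M ^ n ≤ Subalgebra.toSubmodule (reesAlg A r M) := by
  have h0 : sub1 A r M ≤ Subalgebra.toSubmodule (reesAlg A r M) := fun s hs => Algebra.subset_adjoin hs
  induction n with
  | zero => rw [pow_zero, Submodule.one_le]; exact one_mem (reesAlg A r M)
  | succ n ih =>
    rw [pow_succ]
    refine (Submodule.mul_le.2 fun a ha b hb => ?_)
    exact mul_mem (S := Subalgebra A (MvPolynomial (Fin r) A)) (ih ha) (h0 hb)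

theorem rees_comp {s} (hs : s ∈ reesAlg A r M) (n : ℕ) : homogeneousComponent n s ∈ sub1 A r M ^ n := by
  rw [reesAlg, ← Subalgebra.mem_toSubmodule, Algebra.adjoin_eq_span] at hs
  induction hs using Submodule.span_induction with
  | mem s hs =>
    have : ∃ d, s ∈ sub1 A r M ^ d := by
      induction hs using Submonoid.closure_induction with
      | mem s hs => exact ⟨1, by rwa [pow_one]⟩
      | one => exact ⟨0, by rw [pow_zero]; exact Submodule.one_le.1 le_rfl⟩
      | mul s t _ _ h1 h2 =>
        obtain ⟨d, hd⟩ := h1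
        obtain ⟨e, he⟩ := h2
        exact ⟨d + e, by rw [pow_add]; exact Submodule.mul_mem_mul hd he⟩
    obtain ⟨d, hd⟩ := this
    rw [homogeneousComponent_of_mem (sub1_pow_le d hd)]
    split_ifs with h
    · rwa [h]
    · exact zero_mem _
  | zero => rw [map_zero]; exact zero_mem _
  | add s t _ _ h1 h2 => rw [map_add]; exact add_mem h1 h2
  | smul a s _ h1 => rw [map_smul]; exact Submodule.smul_mem _ _ h1

theorem rees_hom {s} {n : ℕ} (hs : s ∈ reesAlg A r M) (hn : s.IsHomogeneous n) : s ∈ sub1 A r M ^ n := by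
  have := rees_comp hs n
  rwa [homogeneousComponent_eq_self hn] at this

section
variable [IsLocalRing A] [IsNoetherianRing A] [IsDomain A] {x : A} {u : Fin (r + 1) → Fin r → A} {c : Fin (r + 1) → A} {k : Fin (r + 1)} {z : A}

theorem Setup.comp (h : Setup x M u c k z) {s} (hs : s ∈ intClAlg A r M) (n : ℕ) : homogeneousComponent n s ∈ intClAlg A r M := by
  obtain ⟨G, v, hv, hsv⟩ := h.pres.surj s ((intCl_iff_DA h.good).1 hs)
  obtain ⟨t, ht⟩ := EvA_eq u v
  rw [intCl_iff_DA h.good]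
  rw [hsv, ht, map_add, map_sum, ← evA_comp]
  refine (isInt_self (mem_DA.2 ⟨_, rfl⟩)).add (IsIntegral.sum _ fun m _ => ?_)
  have h1 : (evA u (monomial m 1) * emb A r (fun i => coeff m (v i))).IsHomogeneous (m.degree + 1) :=
    (evA_hom u (isHomogeneous_monomial _ rfl)).mul (emb_hom _)
  rw [homogeneousComponent_of_mem h1]
  split_ifs with h
  · exact (isInt_self (mem_DA.2 ⟨_, rfl⟩)).mul (hv m)
  · exact isIntegral_zero
end

theorem mem_barPowZ {s} {n : ℤ} (hs : s ∈ barPowZ A r M n) : (0 ≤ n ∧ s.IsHomogeneous n.toNat) ∨ s = 0 := by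
  rw [barPowZ] at hs
  split_ifs at hs with h
  · have := hs.1
    rw [freeSub_pow] at this
    exact Or.inl ⟨h, this⟩
  · exact Or.inr ((Submodule.mem_bot _).1 hs)

theorem grading {X : Type} [AddCommGroup X] [Module A X] (φ : intClAlg A r M →ₗ[A] X) (hφ : Function.Surjective φ)
    (hker : ∀ s, φ s = 0 ↔ (s : MvPolynomial (Fin r) A) ∈ reesAlg A r M)
    (hcomp : ∀ s ∈ intClAlg A r M, ∀ n, homogeneousComponent n s ∈ intClAlg A r M) :
    ∃ g : ℤ → Submodule A X, DirectSum.IsInternal g ∧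
      ∀ n : ℤ, Nonempty (↥(g n) ≃ₗ[A] quotNP A r (subPowZ A r M n) (barPowZ A r M n)) := by
  classical
  have hle : ∀ n, barPowZ A r M n ≤ Subalgebra.toSubmodule (intClAlg A r M) := by
    intro n
    rw [barPowZ]
    split_ifs
    · exact inf_le_right
    · exact bot_le
  let f : ∀ n, barPowZ A r M n →ₗ[A] X := fun n => φ ∘ₗ (Submodule.inclusion (hle n))
  have hf : ∀ n (b : barPowZ A r M n), f n b = 0 ↔ (b : MvPolynomial (Fin r) A) ∈ reesAlg A r M := fun n b => hker _
  have hsub : ∀ n (b : barPowZ A r M n), (b : MvPolynomial (Fin r) A) ∈ reesAlg A r M ↔ (b : MvPolynomial (Fin r) A) ∈ subPowZ A r M n := by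
    rintro n ⟨b, hb⟩
    rw [barPowZ] at hb
    rw [subPowZ]
    split_ifs at hb ⊢ with hn
    · constructor
      · intro h
        refine rees_hom h ?_
        have := hb.1
        rwa [freeSub_pow] at this
      · intro h; exact sub1_pow_le_rees _ h
    · constructor
      · intro h; exact hb
      · intro h
        rw [Submodule.mem_bot] at h
        change b ∈ _
        rw [show b = 0 from h]; exact zero_mem _
  refine ⟨fun n => LinearMap.range (f n), ?_, fun n => ⟨?_⟩⟩
  · rw [DirectSum.isInternal_submodule_iff_iSupIndep_and_iSup_eq_top]
    constructor
    · rw [iSupIndep_iff_finsetSum_eq_zero_imp_eq_zero]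
      intro s v hv hs0 n hn
      have hv' : ∀ n, ∃ b : barPowZ A r M n, n ∈ s → f n b = v n := by
        intro n
        by_cases hn : n ∈ s
        · obtain ⟨b, hb⟩ := hv n hn
          exact ⟨b, fun _ => hb⟩
        · exact ⟨0, fun h => absurd h hn⟩
      choose b hb using hv'
      rw [← hb n hn, hf]
      rcases mem_barPowZ (b n).2 with ⟨h0, hbn⟩ | hbn
      swap
      · rw [hbn]; exact zero_mem _
      have h1 : (∑ n ∈ s, (b n : MvPolynomial (Fin r) A)) ∈ reesAlg A r M := by
        have h2 : φ (∑ n ∈ s, Submodule.inclusion (hle n) (b n)) = 0 := by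
          rw [map_sum, ← hs0]
          exact Finset.sum_congr rfl fun n hn => hb n hn
        rw [hker] at h2
        convert h2
        rw [AddSubmonoidClass.coe_finsetSum]
        rfl
      have h3 := rees_comp h1 n.toNat
      rw [map_sum, Finset.sum_eq_single n] at h3
      · rw [homogeneousComponent_eq_self hbn] at h3
        exact sub1_pow_le_rees _ h3
      · intro l hl hln
        rcases mem_barPowZ (b l).2 with ⟨hl0, hbl⟩ | hbl
        · rw [homogeneousComponent_of_mem hbl, if_neg]
          omega
        · rw [hbl, map_zero]
      · intro h; exact absurd hn h
    · rw [eq_top_iff]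
      rintro y -
      obtain ⟨⟨s, hs⟩, rfl⟩ := hφ y
      have e : (⟨s, hs⟩ : intClAlg A r M) = ∑ i ∈ Finset.range (s.totalDegree + 1), ⟨homogeneousComponent i s, hcomp s hs i⟩ := by
        apply Subtype.ext
        rw [AddSubmonoidClass.coe_finsetSum]
        exact (sum_homogeneousComponent s).symm
      rw [e, map_sum]
      refine Submodule.sum_mem _ fun i _ => ?_
      refine Submodule.mem_iSup_of_mem (i : ℤ) ?_
      refine ⟨⟨homogeneousComponent i s, ?_⟩, rfl⟩
      rw [barPowZ, if_pos (by omega), barPow, Int.toNat_natCast, freeSub_pow]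
      exact ⟨homogeneousComponent_isHomogeneous i s, hcomp s hs i⟩
  · refine ((LinearMap.quotKerEquivRange (f n)).symm.trans (Submodule.quotEquivOfEq _ _ ?_))
    ext b
    rw [LinearMap.mem_ker, hf, hsub]
    rfl

variable [IsLocalRing A] [IsNoetherianRing A] [IsDomain A] {x : A} {u : Fin (r + 1) → Fin r → A} {c : Fin (r + 1) → A} {k : Fin (r + 1)} {z : A}

theorem Setup.partb (h : Setup x M u c k z) (e : (intClAlg A r M ⧸ LinearMap.range (iotaB A M)) ≃ₗ[reesAlg A r M] lcMod A r M 1) :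
    ∃ g : ℤ → Submodule A (lcModA A r M 1), DirectSum.IsInternal g ∧
      ∀ n : ℤ, Nonempty
        (↥(g n) ≃ₗ[A] quotNP A r (subPowZ A r M n) (barPowZ A r M n)) := by
  let φ : intClAlg A r M →ₗ[A] lcModA A r M 1 :=
    { toFun := fun s => (RestrictScalars.addEquiv A (reesAlg A r M) (lcMod A r M 1)).symm (e (Submodule.Quotient.mk s))
      map_add' := fun s t => by rw [Submodule.Quotient.mk_add, map_add, map_add]
      map_smul' := fun a s => by
        have : a • s = algebraMap A (reesAlg A r M) a • s := by
          apply Subtype.ext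
          rw [smulB]
          exact Algebra.smul_def _ _
        rw [this, Submodule.Quotient.mk_smul, map_smul, RestrictScalars.addEquiv_symm_map_algebraMap_smul]
        rfl }
  refine @grading A _ r M (lcModA A r M 1) inferInstance (RestrictScalars.module A (reesAlg A r M) (lcMod A r M 1)) φ ?_ ?_ fun s hs n => h.comp hs n
  · intro y
    obtain ⟨s, hs⟩ := Submodule.Quotient.mk_surjective _ (e.symm (RestrictScalars.addEquiv A (reesAlg A r M) (lcMod A r M 1) y))
    refine ⟨s, ?_⟩
    change (RestrictScalars.addEquiv A (reesAlg A r M) (lcMod A r M 1)).symm (e (Submodule.Quotient.mk s)) = y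
    rw [hs]; simp
  · intro s
    change (RestrictScalars.addEquiv A (reesAlg A r M) (lcMod A r M 1)).symm (e (Submodule.Quotient.mk s)) = 0 ↔ _
    rw [AddEquiv.map_eq_zero_iff, LinearEquiv.map_eq_zero_iff, Submodule.Quotient.mk_eq_zero, mem_range_iotaB]

end
end Core
end

section
set_option maxHeartbeats 1000000
set_option synthInstance.maxHeartbeats 400000
set_option linter.unusedSectionVars false

open MvPolynomial IsLocalRing
namespace Core
section
variable {A : Type} [CommRing A] {r : ℕ} {M : Submodule A (Fin r → A)}

theorem bar1_of_le (h : intClAlg A r M ≤ reesAlg A r M) : barPow A r M 1 = sub1 A r M := by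
  apply le_antisymm
  · rintro s ⟨h1, h2⟩
    have := rees_hom (n := 1) (h h2) (by rwa [freeSub_pow] at h1)
    rwa [pow_one] at this
  · intro s hs
    refine ⟨?_, rees_le_intCl (Algebra.subset_adjoin hs)⟩
    rw [freeSub_pow]
    exact sub1_pow_le 1 (by rwa [pow_one])

variable [IsLocalRing A] [IsNoetherianRing A] [IsDomain A]

theorem two_le_dim (hm : maximalIdeal A ≠ ⊥) (hM0 : M ≠ ⊥) :
    2 ≤ ringKrullDim (Localization.AtPrime (gradedMax A r M)) := by
  have hkd := IsLocalization.AtPrime.ringKrullDim_eq_height (gradedMax A r M) (Localization.AtPrime (gradedMax A r M))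
  refine le_of_le_of_eq ?_ hkd.symm
  let P : Ideal (reesAlg A r M) := RingHom.ker ((MvPolynomial.constantCoeff).comp (reesAlg A r M).val.toRingHom)
  have hP : P.IsPrime := RingHom.ker_isPrime _
  have h0 : (⊥ : Ideal (reesAlg A r M)).IsPrime := Ideal.isPrime_bot
  have h1 : P < gradedMax A r M := by
    refine lt_of_le_of_ne (Ideal.comap_mono bot_le) ?_
    intro he
    apply hm
    rw [eq_bot_iff]
    intro a ha
    have h2 : algebraMap A (reesAlg A r M) a ∈ gradedMax A r M := by
      rw [Ideal.mem_comap]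
      simpa using ha
    rw [← he] at h2
    have h3 : constantCoeff (C a : MvPolynomial (Fin r) A) = 0 := h2
    simpa using h3
  have h2 : ⊥ < P := by
    rw [bot_lt_iff_ne_bot]
    intro he
    apply hM0
    rw [eq_bot_iff]
    intro w hw
    have h2 : (⟨emb A r w, emb_mem_rees hw⟩ : reesAlg A r M) ∈ P := cc_emb w
    rw [he, Ideal.mem_bot] at h2
    have := congrArg Subtype.val h2
    change emb A r w = 0 at this
    rw [Submodule.mem_bot]
    apply embA_inj
    rw [this, map_zero]
  have e1 := Ideal.height_add_one_le_of_lt_of_isPrime h2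
  have e2 := Ideal.height_add_one_le_of_lt_of_isPrime h1
  have : (2 : ℕ∞) ≤ (gradedMax A r M).height := by
    refine le_trans ?_ e2
    have : (2 : ℕ∞) = 1 + 1 := by norm_num
    rw [this]
    gcongr
    exact le_trans (by simp) e1
  exact WithBot.coe_le_coe.2 this

theorem le_of_reg {a b : Localization.AtPrime (gradedMax A r M)} (ha : a ∈ maximalIdeal _) (hb : b ∈ maximalIdeal _)
    (ha0 : a ≠ 0) (hreg : ∀ t, a ∣ b * t → a ∣ t)
    (htors : ∀ s : intClAlg A r M, ∃ k, ∀ b ∈ gradedMax A r M ^ k, ((b • s : intClAlg A r M) : MvPolynomial (Fin r) A) ∈ reesAlg A r M) :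
    intClAlg A r M ≤ reesAlg A r M := by
  by_contra hle
  obtain ⟨s, hs, hsR⟩ := SetLike.not_le_iff_exists.1 hle
  obtain ⟨s, hsB, hsR, hs1⟩ : ∃ s : MvPolynomial (Fin r) A, s ∈ intClAlg A r M ∧ s ∉ reesAlg A r M ∧ ∀ b ∈ gradedMax A r M, (b : MvPolynomial (Fin r) A) * s ∈ reesAlg A r M := by
    obtain ⟨k, hk⟩ := htors ⟨s, hs⟩
    induction k generalizing s with
    | zero => exact absurd (by simpa [smulB] using hk 1 (by simp)) hsR
    | succ k ih =>
      by_cases h : ∀ t ∈ gradedMax A r M ^ k, (t : MvPolynomial (Fin r) A) * s ∈ reesAlg A r M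
      · exact ih s hs hsR h
      · push Not at h
        obtain ⟨t, ht, hts⟩ := h
        refine ⟨t * s, mul_mem (rees_le_intCl t.2) hs, hts, fun b hb => ?_⟩
        have := hk (t * b) (by rw [pow_succ]; exact Ideal.mul_mem_mul ht hb)
        rw [smulB] at this
        convert this using 1
        rw [MulMemClass.coe_mul]
        ring
  obtain ⟨a', σ, rfl⟩ := IsLocalization.exists_mk'_eq (gradedMax A r M).primeCompl a
  obtain ⟨b', τ, rfl⟩ := IsLocalization.exists_mk'_eq (gradedMax A r M).primeCompl b
  rw [IsLocalization.AtPrime.mk'_mem_maximal_iff _ (gradedMax A r M)] at ha hb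
  have ha' := hs1 a' ha
  have hb' := hs1 b' hb
  set L := Localization.AtPrime (gradedMax A r M)
  let f : reesAlg A r M := ⟨_, ha'⟩
  let g : reesAlg A r M := ⟨_, hb'⟩
  have hfg : b' * f = a' * g := by
    apply Subtype.ext
    change (b' : MvPolynomial (Fin r) A) * (a' * s) = a' * (b' * s)
    ring
  have hun : ∀ (σ : (gradedMax A r M).primeCompl), IsUnit (algebraMap _ L (σ : reesAlg A r M)) := fun σ => IsLocalization.map_units L σ
  have hda : ∀ t, IsLocalization.mk' L a' σ ∣ t ↔ algebraMap _ L a' ∣ t := fun t => by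
    have h1 := IsLocalization.mk'_spec L a' σ
    rw [← h1, (hun σ).mul_right_dvd]
  have h2 : algebraMap _ L a' ∣ algebraMap _ L f := by
    rw [← hda]
    apply hreg
    rw [hda, ← (hun τ).dvd_mul_right, mul_right_comm, IsLocalization.mk'_spec, ← map_mul, hfg, map_mul]
    exact dvd_mul_right _ _
  obtain ⟨t, ht⟩ := h2
  obtain ⟨h, ρ, rfl⟩ := IsLocalization.exists_mk'_eq (gradedMax A r M).primeCompl t
  have h3 : algebraMap _ L (f * ρ) = algebraMap _ L (a' * h) := by
    rw [map_mul, ht, mul_assoc, IsLocalization.mk'_spec, map_mul]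
  have h4 : f * ρ = a' * h := IsLocalization.injective L (Ideal.primeCompl_le_nonZeroDivisors (gradedMax A r M)) h3
  have ha'0 : (a' : MvPolynomial (Fin r) A) ≠ 0 := by
    intro h0
    apply ha0
    have : a' = 0 := Subtype.ext h0
    rw [this, IsLocalization.mk'_zero]
  have h5 : (ρ : reesAlg A r M) * s = (h : MvPolynomial (Fin r) A) := by
    have := congrArg Subtype.val h4
    change (a' * s) * (ρ : reesAlg A r M) = (a' * h : MvPolynomial (Fin r) A) at this
    apply mul_left_cancel₀ ha'0
    rw [← this]; ring
  have hρ : IsUnit (constantCoeff ((ρ : reesAlg A r M) : MvPolynomial (Fin r) A)) := by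
    by_contra hn
    exact ρ.2 hn
  obtain ⟨v, hv⟩ := hρ.exists_left_inv
  have h6 := hs1 (1 - algebraMap A _ v * ρ) (by
    rw [mem_gradedMax]
    convert (maximalIdeal A).zero_mem
    simp [hv])
  apply hsR
  have h7 : s = ((1 - algebraMap A _ v * ρ : reesAlg A r M) : MvPolynomial (Fin r) A) * s + ((algebraMap A (reesAlg A r M) v * h : reesAlg A r M) : MvPolynomial (Fin r) A) := by
    rw [MulMemClass.coe_mul, ← h5, AddSubgroupClass.coe_sub, MulMemClass.coe_mul, OneMemClass.coe_one]
    ring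
  rw [h7]
  exact add_mem h6 (SetLike.coe_mem _)

theorem cm_mp (hm : maximalIdeal A ≠ ⊥) (hM0 : M ≠ ⊥)
    (htors : ∀ s : intClAlg A r M, ∃ k, ∀ b ∈ gradedMax A r M ^ k, ((b • s : intClAlg A r M) : MvPolynomial (Fin r) A) ∈ reesAlg A r M)
    (hcm : IsCohenMacaulayLocalRing (Localization.AtPrime (gradedMax A r M))) : barPow A r M 1 = sub1 A r M := by
  obtain ⟨rs, hrs, hreg, hlen⟩ := hcm
  have h2 := two_le_dim hm hM0
  rw [← hlen] at h2
  have h2 : 2 ≤ rs.length := by exact_mod_cast h2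
  obtain ⟨a, b, l, rfl⟩ : ∃ a b l, rs = a :: b :: l := by
    match rs, h2 with
    | a :: b :: l, _ => exact ⟨a, b, l, rfl⟩
  have hw := (wreg_iff _).1 hreg.toIsWeaklyRegular
  have w0 := hw 0 (by simp)
  have w1 := hw 1 (by simp)
  simp only [List.getElem_cons_zero, List.take_zero, Ideal.ofList_nil, Submodule.bot_smul, Submodule.mem_bot] at w0
  simp only [List.getElem_cons_succ, List.getElem_cons_zero, List.take_succ_cons, List.take_zero, Ideal.ofList_singleton, smul_eq_mul, Ideal.mul_top, Ideal.mem_span_singleton] at w1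
  refine bar1_of_le (le_of_reg (hrs a (by simp)) (hrs b (by simp)) ?_ w1 htors)
  rintro rfl
  exact one_ne_zero (w0 1 (by simp))
end
end Core
end

section
set_option maxHeartbeats 1000000
set_option synthInstance.maxHeartbeats 400000
set_option linter.unusedSectionVars false

open MvPolynomial IsLocalRing
namespace Core
section

theorem dim_zero_of_pow_le {L : Type} [CommRing L] [IsLocalRing L] (I : Ideal L) (hI : I ≠ ⊤) (N : ℕ)
    (h : maximalIdeal L ^ N ≤ I) : ringKrullDim (L ⧸ I) = 0 := by
  haveI : Nontrivial (L ⧸ I) := Ideal.Quotient.nontrivial_iff.2 hI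
  haveI : Ring.KrullDimLE 0 (L ⧸ I) := by
    rw [Ring.krullDimLE_zero_iff]
    intro P hP
    have h1 : (P.comap (Ideal.Quotient.mk I)).IsPrime := Ideal.comap_isPrime _ _
    have h2 : maximalIdeal L ≤ P.comap (Ideal.Quotient.mk I) := by
      apply h1.le_of_pow_le (n := N)
      refine h.trans ?_
      intro a ha
      rw [Ideal.mem_comap, Ideal.Quotient.eq_zero_iff_mem.2 ha]
      exact P.zero_mem
    have h3 : P.comap (Ideal.Quotient.mk I) = maximalIdeal L := ((maximalIdeal.isMaximal L).eq_of_le h1.ne_top h2).symm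
    have h4 : (P.comap (Ideal.Quotient.mk I)).IsMaximal := h3 ▸ maximalIdeal.isMaximal L
    have := Ideal.map_comap_of_surjective _ (Ideal.Quotient.mk_surjective (I := I)) P
    rw [← this]
    refine (Ideal.map_eq_top_or_isMaximal_of_surjective _ (Ideal.Quotient.mk_surjective (I := I)) h4).resolve_left ?_
    rw [this]; exact hP.ne_top
  exact le_antisymm (Ring.krullDimLE_iff.1 inferInstance) ringKrullDim_nonneg_of_nontrivial

theorem cm_of_wreg {R : Type} [CommRing R] [IsNoetherianRing R] (p : Ideal R) [p.IsPrime] (rs : List R)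
    (hreg : RingTheory.Sequence.IsWeaklyRegular R rs) (hmem : ∀ s ∈ rs, s ∈ p) (N : ℕ) (hN : p ^ N ≤ Ideal.ofList rs) :
    IsCohenMacaulayLocalRing (Localization.AtPrime p) := by
  have h1 := RingTheory.Sequence.IsWeaklyRegular.isRegular_of_isLocalization_of_mem (Localization.AtPrime p) p hreg hmem
  haveI : IsNoetherianRing (Localization.AtPrime p) := IsLocalization.isNoetherianRing p.primeCompl _ inferInstance
  have hm : ∀ x ∈ rs.map (algebraMap R (Localization.AtPrime p)), x ∈ maximalIdeal (Localization.AtPrime p) := by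
    intro x hx
    obtain ⟨s, hs, rfl⟩ := List.mem_map.1 hx
    exact (IsLocalization.AtPrime.to_map_mem_maximal_iff _ p s).2 (hmem s hs)
  refine ⟨_, hm, h1, ?_⟩
  rw [← ringKrullDim_add_length_eq_ringKrullDim_of_isRegular _ h1, dim_zero_of_pow_le _ ?_ N ?_, zero_add]
  · apply ne_top_of_le_ne_top (maximalIdeal.isMaximal (Localization.AtPrime p)).ne_top
    exact Ideal.span_le.2 hm
  · rw [← Localization.AtPrime.map_eq_maximalIdeal, ← Ideal.map_pow, ← Ideal.map_ofList]
    exact Ideal.map_mono hN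

variable {A : Type} [CommRing A] {r : ℕ} {M : Submodule A (Fin r → A)}
variable [IsLocalRing A] [IsNoetherianRing A] [IsDomain A] {x : A} {u : Fin (r + 1) → Fin r → A} {c : Fin (r + 1) → A} {k : Fin (r + 1)} {z : A}

theorem emb_freeSub (w : Fin r → A) : emb A r w ∈ freeSub A r := by
  exact ⟨w, trivial, rfl⟩

theorem Setup.cm_mpr (h : Setup x M u c k z) (hb : barPow A r M 1 = sub1 A r M) :
    IsCohenMacaulayLocalRing (Localization.AtPrime (gradedMax A r M)) := by
  have htop : LinearMap.range (iotaB A M) = ⊤ := by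
    apply h.B_ind
    · rw [mem_range_iotaB]; exact one_mem _
    · intro w hw
      rw [mem_range_iotaB]
      have : emb A r w ∈ barPow A r M 1 := ⟨by rw [pow_one]; exact emb_freeSub w, hw⟩
      rw [hb] at this
      exact Algebra.subset_adjoin this
  have hinj : Function.Injective (iotaB A M) := fun a b hab => Subtype.ext (congrArg (fun t : intClAlg A r M => (t : MvPolynomial (Fin r) A)) hab)
  let e := LinearEquiv.ofBijective (iotaB A M) ⟨hinj, LinearMap.range_eq_top.1 htop⟩
  have hreg := (e.isWeaklyRegular_congr _).2 h.reg
  obtain ⟨N, hN⟩ := h.pow_le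
  haveI := rees_noeth (A := A) (M := M)
  exact cm_of_wreg _ _ hreg h.mem N hN
end
end Core
end

/-- Theorem 1.2, consequences. Let `(A, 𝔪)` be a two-dimensional
regular local ring with infinite residue field, `M ≠ (0)` a finitely generated
torsion-free `A`-module with `F = M** = A^r` (`r > 0`), and suppose
`widetilde{M} = overline{M}`. Then:
(a) `R(M)` has finite local cohomology (`H^i_𝔐(R(M))` is finitely generated for every
`i ≠ dim R(M) = r + 2`) and `H^p_𝔐(R(M)) = (0)` for every `p ≠ 1, r + 2`;
(b) `H^1_𝔐(R(M))` carries a grading whose `n`-th component is isomorphic to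
`overline{M^n}/M^n` as an `A`-module for every `n ∈ ℤ`;
(c) `R(M)` is a Cohen--Macaulay ring (i.e. `R(M)_𝔐` is Cohen--Macaulay) if and only if
`M` is integrally closed. -/
theorem ratliffRush_statement_16 (A : Type) [CommRing A] [IsLocalRing A]
    [IsNoetherianRing A]
    (hdim : ringKrullDim A = 2)
    (hreg : ∃ x y : A, Ideal.span {x, y} = maximalIdeal A)
    (hres : Infinite (ResidueField A))
    (r : ℕ) (hr : 0 < r) (M : Submodule A (Fin r → A)) (hM0 : M ≠ ⊥)
    (hlen : ∃ n : ℕ, modLength A ((Fin r → A) ⧸ M) = (n : WithBot ℕ∞))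
    (h1 : ratliffRush A r (freeSub A r) (sub1 A r M) = barPow A r M 1) :
    ((∀ i : ℕ, i ≠ r + 2 → Module.Finite ↥(reesAlg A r M) (lcMod A r M i)) ∧
      (∀ p : ℕ, p ≠ 1 → p ≠ r + 2 → Subsingleton (lcMod A r M p))) ∧
    (∃ g : ℤ → Submodule A (lcModA A r M 1), DirectSum.IsInternal g ∧
      ∀ n : ℤ, Nonempty
        (↥(g n) ≃ₗ[A] quotNP A r (subPowZ A r M n) (barPowZ A r M n))) ∧
    (IsCohenMacaulayLocalRing (Localization.AtPrime (gradedMax A r M))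
      ↔ barPow A r M 1 = sub1 A r M) := by
  obtain ⟨hdom, x, y, hR⟩ := Core.exists_rlr2 hdim hreg
  obtain ⟨N, hN⟩ := Core.pow_of_len M hlen
  obtain ⟨u, c, k, z, h⟩ := hR.setup hres M hN
  obtain ⟨ha, ⟨e⟩⟩ := h.lc hN h1
  refine ⟨ha, h.partb e, Core.cm_mp ?_ hM0 (h.tors hN h1), h.cm_mpr⟩
  intro hm
  have := h.xm
  rw [hm] at this
  exact h.x0 this
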